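/- Substitution property of the self-translation, value into value: if Γ, x:A ⊢ t : B and Γ ⊢ u : A are derivable in EEC, then Γᶜ ⊢ (t[u/x])ᶜ = tᶜ[uᶜ/x] : Bᶜ in the equational theory of EEC. -/

import Mathlib

set_option autoImplicit false

namespace EEC

/-! # The enriched effect calculus (EEC)

A deep embedding of the enriched effect calculus of Egger, Møgelberg and
Simpson: value types and computation types, raw terms (de Bruijn indices for
value variables, together with a designated stoup variable `svar`), typing
derivations with an (at most singleton) stoup, the βη-equational theory, the
simply-typed λ-calculus together with βη-equality and Moggi's computational
λ-calculus equality, the standard cbv/cbn translations of typed λ-calculus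
into EEC, Hasegawa's linear-use CPS translations, and the generic linear-use
CPS self-translation of EEC. -/

mutual
  /-- Value types of EEC. -/
  inductive VType : Type
    | base : ℕ → VType                 -- value type constants α
    | unit : VType                     -- 1
    | prod : VType → VType → VType     -- A × B
    | arr : VType → VType → VType      -- A → B
    | comp : CType → VType             -- every computation type is a value type
    | lin : CType → CType → VType      -- A̲ ⊸ B̲
  /-- Computation types of EEC. -/
  inductive CType : Type
    | base : ℕ → CType                 -- computation type constants α̲
    | cunit : CType                    -- 1̲
    | cand : CType → CType → CType     -- A̲ & B̲
    | carr : VType → CType → CType     -- A ⇒ B̲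
    | iunit : CType                    -- I̲
    | bang : VType → CType             -- !A
    | copow : VType → CType → CType    -- !A ⊗ B̲
    | czero : CType                    -- 0̲
    | csum : CType → CType → CType     -- A̲ ⊕ B̲
end

/-- Raw terms of EEC.  Value variables are de Bruijn indices (`var n`, with
`var 0` the innermost bound variable); the unique stoup variable is `svar`
(the constructs `llam`, `copowlet` (in its body) and `ccase` (in its
branches) bind the stoup variable). -/
inductive Tm : Type
  | var : ℕ → Tm                -- value variable
  | svar : Tm                   -- the stoup variable
  | unit : Tm                   -- * : 1
  | vpair : Tm → Tm → Tm        -- ⟨t,u⟩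
  | vfst : Tm → Tm
  | vsnd : Tm → Tm
  | vlam : VType → Tm → Tm      -- λx:A. t
  | vapp : Tm → Tm → Tm
  | cunit : Tm                  -- ⋆ : 1̲
  | cpair : Tm → Tm → Tm        -- ⟨t,u⟩ : A̲ & B̲
  | cfst : Tm → Tm
  | csnd : Tm → Tm
  | clam : VType → Tm → Tm      -- λx:A ⇒ t
  | capp : Tm → Tm → Tm         -- s ⋅ t
  | top : Tm                    -- ⊤ : I̲
  | ilet : Tm → Tm → Tm         -- t to ⊤. u
  | bang : Tm → Tm              -- !t
  | banglet : Tm → Tm → Tm      -- let !x = t in u   (binds a value variable in u)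
  | copow : Tm → Tm → Tm        -- !t ⊗ u
  | copowlet : Tm → Tm → Tm     -- let !x⊗y = s in t (binds a value variable and the stoup variable in t)
  | cimage : CType → Tm → Tm    -- image_{A̲}(t)
  | cinl : Tm → Tm
  | cinr : Tm → Tm
  | ccase : Tm → Tm → Tm → Tm   -- case s of (x. t | y. u)  (branches bind the stoup variable)
  | llam : CType → Tm → Tm      -- λ°z:A̲. t (binds the stoup variable)
  | lapp : Tm → Tm → Tm         -- s[t]

namespace Tm

/-- Lift a renaming of value variables under a binder. -/
def liftN (f : ℕ → ℕ) : ℕ → ℕ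
  | 0 => 0
  | n + 1 => f n + 1

/-- Renaming of value variables. -/
def rename (f : ℕ → ℕ) : Tm → Tm
  | .var n => .var (f n)
  | .svar => .svar
  | .unit => .unit
  | .vpair t u => .vpair (rename f t) (rename f u)
  | .vfst t => .vfst (rename f t)
  | .vsnd t => .vsnd (rename f t)
  | .vlam A t => .vlam A (rename (liftN f) t)
  | .vapp s t => .vapp (rename f s) (rename f t)
  | .cunit => .cunit
  | .cpair t u => .cpair (rename f t) (rename f u)
  | .cfst t => .cfst (rename f t)
  | .csnd t => .csnd (rename f t)
  | .clam A t => .clam A (rename (liftN f) t)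
  | .capp s t => .capp (rename f s) (rename f t)
  | .top => .top
  | .ilet t u => .ilet (rename f t) (rename f u)
  | .bang t => .bang (rename f t)
  | .banglet t u => .banglet (rename f t) (rename (liftN f) u)
  | .copow t u => .copow (rename f t) (rename f u)
  | .copowlet s t => .copowlet (rename f s) (rename (liftN f) t)
  | .cimage A t => .cimage A (rename f t)
  | .cinl t => .cinl (rename f t)
  | .cinr t => .cinr (rename f t)
  | .ccase s t u => .ccase (rename f s) (rename f t) (rename f u)
  | .llam A t => .llam A (rename f t)
  | .lapp s t => .lapp (rename f s) (rename f t)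

/-- Weakening of value variables. -/
def shift (t : Tm) : Tm := rename Nat.succ t

/-- Lift a parallel substitution of value variables under a binder. -/
def liftS (σ : ℕ → Tm) : ℕ → Tm
  | 0 => .var 0
  | n + 1 => shift (σ n)

/-- Parallel (capture-avoiding) substitution for value variables. -/
def psubst (σ : ℕ → Tm) : Tm → Tm
  | .var n => σ n
  | .svar => .svar
  | .unit => .unit
  | .vpair t u => .vpair (psubst σ t) (psubst σ u)
  | .vfst t => .vfst (psubst σ t)
  | .vsnd t => .vsnd (psubst σ t)
  | .vlam A t => .vlam A (psubst (liftS σ) t)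
  | .vapp s t => .vapp (psubst σ s) (psubst σ t)
  | .cunit => .cunit
  | .cpair t u => .cpair (psubst σ t) (psubst σ u)
  | .cfst t => .cfst (psubst σ t)
  | .csnd t => .csnd (psubst σ t)
  | .clam A t => .clam A (psubst (liftS σ) t)
  | .capp s t => .capp (psubst σ s) (psubst σ t)
  | .top => .top
  | .ilet t u => .ilet (psubst σ t) (psubst σ u)
  | .bang t => .bang (psubst σ t)
  | .banglet t u => .banglet (psubst σ t) (psubst (liftS σ) u)
  | .copow t u => .copow (psubst σ t) (psubst σ u)
  | .copowlet s t => .copowlet (psubst σ s) (psubst (liftS σ) t)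
  | .cimage A t => .cimage A (psubst σ t)
  | .cinl t => .cinl (psubst σ t)
  | .cinr t => .cinr (psubst σ t)
  | .ccase s t u => .ccase (psubst σ s) (psubst σ t) (psubst σ u)
  | .llam A t => .llam A (psubst σ t)
  | .lapp s t => .lapp (psubst σ s) (psubst σ t)

/-- Capture-avoiding substitution `t[u/x]` of a term `u` for the innermost
value variable of `t`. -/
def subst0 (u : Tm) (t : Tm) : Tm :=
  psubst (fun n => match n with | 0 => u | m + 1 => .var m) t

/-- Capture-avoiding substitution `t[u/z]` of a term `u` for the stoup
variable of `t`.  The substitution stops at the stoup-variable binders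
(`llam`-bodies, `copowlet`-bodies and `ccase`-branches). -/
def ssubst (u : Tm) : Tm → Tm
  | .var n => .var n
  | .svar => u
  | .unit => .unit
  | .vpair t t' => .vpair (ssubst u t) (ssubst u t')
  | .vfst t => .vfst (ssubst u t)
  | .vsnd t => .vsnd (ssubst u t)
  | .vlam A t => .vlam A (ssubst (shift u) t)
  | .vapp s t => .vapp (ssubst u s) (ssubst u t)
  | .cunit => .cunit
  | .cpair t t' => .cpair (ssubst u t) (ssubst u t')
  | .cfst t => .cfst (ssubst u t)
  | .csnd t => .csnd (ssubst u t)
  | .clam A t => .clam A (ssubst (shift u) t)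
  | .capp s t => .capp (ssubst u s) (ssubst u t)
  | .top => .top
  | .ilet t t' => .ilet (ssubst u t) (ssubst u t')
  | .bang t => .bang (ssubst u t)
  | .banglet t t' => .banglet (ssubst u t) (ssubst (shift u) t')
  | .copow t t' => .copow (ssubst u t) (ssubst u t')
  | .copowlet s t => .copowlet (ssubst u s) t
  | .cimage A t => .cimage A (ssubst u t)
  | .cinl t => .cinl (ssubst u t)
  | .cinr t => .cinr (ssubst u t)
  | .ccase s t t' => .ccase (ssubst u s) t t'
  | .llam A t => .llam A t
  | .lapp s t => .lapp (ssubst u s) (ssubst u t)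

end Tm

/-- Typing derivations of EEC (Figure 1 of the paper).  `Deriv Γ none t A`
is the judgement `Γ ⊢ t : A` (empty stoup); `Deriv Γ (some A̲) t (.comp B̲)`
is the judgement `Γ | z:A̲ ⊢ t : B̲`.  In the rules below `Δ` ranges over an
arbitrary (possibly empty) stoup. -/
inductive Deriv : List VType → Option CType → Tm → VType → Type
  | var (Γ : List VType) (n : ℕ) (A : VType) :
      Γ[n]? = some A → Deriv Γ none (.var n) A
  | svar (Γ : List VType) (A : CType) : Deriv Γ (some A) .svar (.comp A)
  | unit (Γ : List VType) : Deriv Γ none .unit .unit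
  | vpair (Γ : List VType) (t u : Tm) (A B : VType) :
      Deriv Γ none t A → Deriv Γ none u B → Deriv Γ none (.vpair t u) (.prod A B)
  | vfst (Γ : List VType) (t : Tm) (A B : VType) :
      Deriv Γ none t (.prod A B) → Deriv Γ none (.vfst t) A
  | vsnd (Γ : List VType) (t : Tm) (A B : VType) :
      Deriv Γ none t (.prod A B) → Deriv Γ none (.vsnd t) B
  | vlam (Γ : List VType) (t : Tm) (A B : VType) :
      Deriv (A :: Γ) none t B → Deriv Γ none (.vlam A t) (.arr A B)
  | vapp (Γ : List VType) (s t : Tm) (A B : VType) :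
      Deriv Γ none s (.arr A B) → Deriv Γ none t A → Deriv Γ none (.vapp s t) B
  | cunit (Γ : List VType) (Δ : Option CType) : Deriv Γ Δ .cunit (.comp .cunit)
  | cpair (Γ : List VType) (Δ : Option CType) (t u : Tm) (A B : CType) :
      Deriv Γ Δ t (.comp A) → Deriv Γ Δ u (.comp B) →
      Deriv Γ Δ (.cpair t u) (.comp (.cand A B))
  | cfst (Γ : List VType) (Δ : Option CType) (t : Tm) (A B : CType) :
      Deriv Γ Δ t (.comp (.cand A B)) → Deriv Γ Δ (.cfst t) (.comp A)
  | csnd (Γ : List VType) (Δ : Option CType) (t : Tm) (A B : CType) :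
      Deriv Γ Δ t (.comp (.cand A B)) → Deriv Γ Δ (.csnd t) (.comp B)
  | clam (Γ : List VType) (Δ : Option CType) (t : Tm) (A : VType) (B : CType) :
      Deriv (A :: Γ) Δ t (.comp B) → Deriv Γ Δ (.clam A t) (.comp (.carr A B))
  | capp (Γ : List VType) (Δ : Option CType) (s t : Tm) (A : VType) (B : CType) :
      Deriv Γ Δ s (.comp (.carr A B)) → Deriv Γ none t A →
      Deriv Γ Δ (.capp s t) (.comp B)
  | top (Γ : List VType) : Deriv Γ none .top (.comp .iunit)
  | ilet (Γ : List VType) (Δ : Option CType) (t u : Tm) (A : CType) :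
      Deriv Γ Δ t (.comp .iunit) → Deriv Γ none u (.comp A) →
      Deriv Γ Δ (.ilet t u) (.comp A)
  | bang (Γ : List VType) (t : Tm) (A : VType) :
      Deriv Γ none t A → Deriv Γ none (.bang t) (.comp (.bang A))
  | banglet (Γ : List VType) (Δ : Option CType) (t u : Tm) (A : VType) (B : CType) :
      Deriv Γ Δ t (.comp (.bang A)) → Deriv (A :: Γ) none u (.comp B) →
      Deriv Γ Δ (.banglet t u) (.comp B)
  | copow (Γ : List VType) (Δ : Option CType) (t u : Tm) (A : VType) (B : CType) :
      Deriv Γ none t A → Deriv Γ Δ u (.comp B) →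
      Deriv Γ Δ (.copow t u) (.comp (.copow A B))
  | copowlet (Γ : List VType) (Δ : Option CType) (s t : Tm) (A : VType) (B C : CType) :
      Deriv Γ Δ s (.comp (.copow A B)) → Deriv (A :: Γ) (some B) t (.comp C) →
      Deriv Γ Δ (.copowlet s t) (.comp C)
  | cimage (Γ : List VType) (Δ : Option CType) (t : Tm) (A : CType) :
      Deriv Γ Δ t (.comp .czero) → Deriv Γ Δ (.cimage A t) (.comp A)
  | cinl (Γ : List VType) (Δ : Option CType) (t : Tm) (A B : CType) :
      Deriv Γ Δ t (.comp A) → Deriv Γ Δ (.cinl t) (.comp (.csum A B))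
  | cinr (Γ : List VType) (Δ : Option CType) (t : Tm) (A B : CType) :
      Deriv Γ Δ t (.comp B) → Deriv Γ Δ (.cinr t) (.comp (.csum A B))
  | ccase (Γ : List VType) (Δ : Option CType) (s t u : Tm) (A B C : CType) :
      Deriv Γ Δ s (.comp (.csum A B)) → Deriv Γ (some A) t (.comp C) →
      Deriv Γ (some B) u (.comp C) → Deriv Γ Δ (.ccase s t u) (.comp C)
  | llam (Γ : List VType) (t : Tm) (A B : CType) :
      Deriv Γ (some A) t (.comp B) → Deriv Γ none (.llam A t) (.lin A B)
  | lapp (Γ : List VType) (Δ : Option CType) (s t : Tm) (A B : CType) :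
      Deriv Γ none s (.lin A B) → Deriv Γ Δ t (.comp A) →
      Deriv Γ Δ (.lapp s t) (.comp B)

/-- The equational theory of EEC: the smallest type-respecting congruence
containing the βη-equalities of Figure 2 of the paper. -/
inductive EEq : List VType → Option CType → Tm → Tm → VType → Prop
  -- equivalence
  | refl {Γ Δ t A} : Deriv Γ Δ t A → EEq Γ Δ t t A
  | symm {Γ Δ t u A} : EEq Γ Δ t u A → EEq Γ Δ u t A
  | trans {Γ Δ t u v A} : EEq Γ Δ t u A → EEq Γ Δ u v A → EEq Γ Δ t v A
  -- congruence rules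
  | vpair_cong {Γ t t' u u' A B} : EEq Γ none t t' A → EEq Γ none u u' B →
      EEq Γ none (.vpair t u) (.vpair t' u') (.prod A B)
  | vfst_cong {Γ t t' A B} : EEq Γ none t t' (.prod A B) →
      EEq Γ none (.vfst t) (.vfst t') A
  | vsnd_cong {Γ t t' A B} : EEq Γ none t t' (.prod A B) →
      EEq Γ none (.vsnd t) (.vsnd t') B
  | vlam_cong {Γ t t' A B} : EEq (A :: Γ) none t t' B →
      EEq Γ none (.vlam A t) (.vlam A t') (.arr A B)
  | vapp_cong {Γ s s' t t' A B} : EEq Γ none s s' (.arr A B) → EEq Γ none t t' A →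
      EEq Γ none (.vapp s t) (.vapp s' t') B
  | cpair_cong {Γ Δ t t' u u' A B} : EEq Γ Δ t t' (.comp A) → EEq Γ Δ u u' (.comp B) →
      EEq Γ Δ (.cpair t u) (.cpair t' u') (.comp (.cand A B))
  | cfst_cong {Γ Δ t t' A B} : EEq Γ Δ t t' (.comp (.cand A B)) →
      EEq Γ Δ (.cfst t) (.cfst t') (.comp A)
  | csnd_cong {Γ Δ t t' A B} : EEq Γ Δ t t' (.comp (.cand A B)) →
      EEq Γ Δ (.csnd t) (.csnd t') (.comp B)
  | clam_cong {Γ Δ t t' A B} : EEq (A :: Γ) Δ t t' (.comp B) →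
      EEq Γ Δ (.clam A t) (.clam A t') (.comp (.carr A B))
  | capp_cong {Γ Δ s s' t t' A B} : EEq Γ Δ s s' (.comp (.carr A B)) → EEq Γ none t t' A →
      EEq Γ Δ (.capp s t) (.capp s' t') (.comp B)
  | ilet_cong {Γ Δ t t' u u' A} : EEq Γ Δ t t' (.comp .iunit) → EEq Γ none u u' (.comp A) →
      EEq Γ Δ (.ilet t u) (.ilet t' u') (.comp A)
  | bang_cong {Γ t t' A} : EEq Γ none t t' A →
      EEq Γ none (.bang t) (.bang t') (.comp (.bang A))
  | banglet_cong {Γ Δ t t' u u' A B} : EEq Γ Δ t t' (.comp (.bang A)) →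
      EEq (A :: Γ) none u u' (.comp B) →
      EEq Γ Δ (.banglet t u) (.banglet t' u') (.comp B)
  | copow_cong {Γ Δ t t' u u' A B} : EEq Γ none t t' A → EEq Γ Δ u u' (.comp B) →
      EEq Γ Δ (.copow t u) (.copow t' u') (.comp (.copow A B))
  | copowlet_cong {Γ Δ s s' t t' A B C} : EEq Γ Δ s s' (.comp (.copow A B)) →
      EEq (A :: Γ) (some B) t t' (.comp C) →
      EEq Γ Δ (.copowlet s t) (.copowlet s' t') (.comp C)
  | cimage_cong {Γ Δ t t' A} : EEq Γ Δ t t' (.comp .czero) →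
      EEq Γ Δ (.cimage A t) (.cimage A t') (.comp A)
  | cinl_cong {Γ Δ t t' A B} : EEq Γ Δ t t' (.comp A) →
      EEq Γ Δ (.cinl t) (.cinl t') (.comp (.csum A B))
  | cinr_cong {Γ Δ t t' A B} : EEq Γ Δ t t' (.comp B) →
      EEq Γ Δ (.cinr t) (.cinr t') (.comp (.csum A B))
  | ccase_cong {Γ Δ s s' t t' u u' A B C} : EEq Γ Δ s s' (.comp (.csum A B)) →
      EEq Γ (some A) t t' (.comp C) → EEq Γ (some B) u u' (.comp C) →
      EEq Γ Δ (.ccase s t u) (.ccase s' t' u') (.comp C)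
  | llam_cong {Γ t t' A B} : EEq Γ (some A) t t' (.comp B) →
      EEq Γ none (.llam A t) (.llam A t') (.lin A B)
  | lapp_cong {Γ Δ s s' t t' A B} : EEq Γ none s s' (.lin A B) → EEq Γ Δ t t' (.comp A) →
      EEq Γ Δ (.lapp s t) (.lapp s' t') (.comp B)
  -- the equalities of Figure 2
  | unit_eta {Γ t} : Deriv Γ none t .unit → EEq Γ none t .unit .unit
  | vfst_beta {Γ t u A B} : Deriv Γ none t A → Deriv Γ none u B →
      EEq Γ none (.vfst (.vpair t u)) t A
  | vsnd_beta {Γ t u A B} : Deriv Γ none t A → Deriv Γ none u B →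
      EEq Γ none (.vsnd (.vpair t u)) u B
  | vpair_eta {Γ t A B} : Deriv Γ none t (.prod A B) →
      EEq Γ none (.vpair (.vfst t) (.vsnd t)) t (.prod A B)
  | vlam_beta {Γ t u A B} : Deriv (A :: Γ) none t B → Deriv Γ none u A →
      EEq Γ none (.vapp (.vlam A t) u) (Tm.subst0 u t) B
  | vlam_eta {Γ t A B} : Deriv Γ none t (.arr A B) →
      EEq Γ none (.vlam A (.vapp (Tm.shift t) (.var 0))) t (.arr A B)
  | cunit_eta {Γ Δ t} : Deriv Γ Δ t (.comp .cunit) → EEq Γ Δ t .cunit (.comp .cunit)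
  | cfst_beta {Γ Δ t u A B} : Deriv Γ Δ t (.comp A) → Deriv Γ Δ u (.comp B) →
      EEq Γ Δ (.cfst (.cpair t u)) t (.comp A)
  | csnd_beta {Γ Δ t u A B} : Deriv Γ Δ t (.comp A) → Deriv Γ Δ u (.comp B) →
      EEq Γ Δ (.csnd (.cpair t u)) u (.comp B)
  | cpair_eta {Γ Δ t A B} : Deriv Γ Δ t (.comp (.cand A B)) →
      EEq Γ Δ (.cpair (.cfst t) (.csnd t)) t (.comp (.cand A B))
  | clam_beta {Γ Δ t u A B} : Deriv (A :: Γ) Δ t (.comp B) → Deriv Γ none u A →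
      EEq Γ Δ (.capp (.clam A t) u) (Tm.subst0 u t) (.comp B)
  | clam_eta {Γ Δ t A B} : Deriv Γ Δ t (.comp (.carr A B)) →
      EEq Γ Δ (.clam A (.capp (Tm.shift t) (.var 0))) t (.comp (.carr A B))
  | ilet_beta {Γ t A} : Deriv Γ none t (.comp A) →
      EEq Γ none (.ilet .top t) t (.comp A)
  | ilet_eta {Γ Δ t u A} : Deriv Γ Δ t (.comp .iunit) → Deriv Γ (some .iunit) u (.comp A) →
      EEq Γ Δ (.ilet t (Tm.ssubst .top u)) (Tm.ssubst t u) (.comp A)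
  | bang_beta {Γ t u A B} : Deriv Γ none t A → Deriv (A :: Γ) none u (.comp B) →
      EEq Γ none (.banglet (.bang t) u) (Tm.subst0 t u) (.comp B)
  | bang_eta {Γ Δ t u A B} : Deriv Γ Δ t (.comp (.bang A)) →
      Deriv Γ (some (.bang A)) u (.comp B) →
      EEq Γ Δ (.banglet t (Tm.ssubst (.bang (.var 0)) (Tm.shift u))) (Tm.ssubst t u) (.comp B)
  | copow_beta {Γ Δ t s u A B C} : Deriv Γ none t A → Deriv Γ Δ s (.comp B) →
      Deriv (A :: Γ) (some B) u (.comp C) →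
      EEq Γ Δ (.copowlet (.copow t s) u) (Tm.ssubst s (Tm.subst0 t u)) (.comp C)
  | copow_eta {Γ Δ t u A B C} : Deriv Γ Δ t (.comp (.copow A B)) →
      Deriv Γ (some (.copow A B)) u (.comp C) →
      EEq Γ Δ (.copowlet t (Tm.ssubst (.copow (.var 0) .svar) (Tm.shift u))) (Tm.ssubst t u) (.comp C)
  | czero_eta {Γ Δ t u A} : Deriv Γ Δ t (.comp .czero) → Deriv Γ (some .czero) u (.comp A) →
      EEq Γ Δ (.cimage A t) (Tm.ssubst t u) (.comp A)
  | csum_beta_inl {Γ Δ t u u' A B C} : Deriv Γ (some A) u (.comp C) →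
      Deriv Γ (some B) u' (.comp C) → Deriv Γ Δ t (.comp A) →
      EEq Γ Δ (.ccase (.cinl t) u u') (Tm.ssubst t u) (.comp C)
  | csum_beta_inr {Γ Δ t u u' A B C} : Deriv Γ (some A) u (.comp C) →
      Deriv Γ (some B) u' (.comp C) → Deriv Γ Δ t (.comp B) →
      EEq Γ Δ (.ccase (.cinr t) u u') (Tm.ssubst t u') (.comp C)
  | csum_eta {Γ Δ t u A B C} : Deriv Γ Δ t (.comp (.csum A B)) →
      Deriv Γ (some (.csum A B)) u (.comp C) →
      EEq Γ Δ (.ccase t (Tm.ssubst (.cinl .svar) u) (Tm.ssubst (.cinr .svar) u)) (Tm.ssubst t u) (.comp C)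
  | llam_beta {Γ Δ t u A B} : Deriv Γ (some A) t (.comp B) → Deriv Γ Δ u (.comp A) →
      EEq Γ Δ (.lapp (.llam A t) u) (Tm.ssubst u t) (.comp B)
  | llam_eta {Γ t A B} : Deriv Γ none t (.lin A B) →
      EEq Γ none (.llam A (.lapp t .svar)) t (.lin A B)

end EEC

namespace EEC

/-! ## The generic linear-use CPS self-translation of EEC (Figures 4–6) -/

mutual
  /-- CPS translation `Aᶜ` of value types, relative to the result type `R̲`. -/
  def cpsV (R : CType) : VType → VType
    | .base a => .base a
    | .unit => .unit
    | .prod A B => .prod (cpsV R A) (cpsV R B)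
    | .arr A B => .arr (cpsV R A) (cpsV R B)
    | .comp A => .lin (cpsC R A) R
    | .lin A B => .lin (cpsC R B) (cpsC R A)
  /-- CPS translation `A̲ᶜ` of computation types, relative to the result type
  `R̲` (a computation-type constant equal to `R̲` is translated to `I̲`). -/
  def cpsC (R : CType) : CType → CType
    | .base a =>
        match R with
        | .base b => if b = a then .iunit else .base a
        | _ => .base a
    | .cunit => .czero
    | .cand A B => .csum (cpsC R A) (cpsC R B)
    | .carr A B => .copow (cpsV R A) (cpsC R B)
    | .iunit => R
    | .bang A => .carr (cpsV R A) R
    | .copow A B => .carr (cpsV R A) (cpsC R B)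
    | .czero => .cunit
    | .csum A B => .cand (cpsC R A) (cpsC R B)
end

/-- Pointwise CPS translation `Γᶜ` of a context. -/
def cpsCtx (R : CType) (Γ : List VType) : List VType := Γ.map (cpsV R)

/-- The generic linear-use CPS self-translation on terms (Figures 5 and 6 of
the paper), defined by recursion on typing derivations.  A value judgement
`Γ ⊢ t : A` is sent to a term `tᶜ` with `Γᶜ ⊢ tᶜ : Aᶜ`, and a stoup
judgement `Γ | z:A̲ ⊢ t : B̲` is sent (contravariantly) to a term `tᶜ` with
`Γᶜ | k_z:B̲ᶜ ⊢ tᶜ : A̲ᶜ`. -/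
def cps (R : CType) : {Γ : List VType} → {Δ : Option CType} → {t : Tm} → {A : VType} →
    Deriv Γ Δ t A → Tm
  | _, _, _, _, .var _ n _ _ => .var n
  | _, _, _, _, .svar _ _ => .svar
  | _, _, _, _, .unit _ => .unit
  | _, _, _, _, .vpair _ _ _ _ _ d1 d2 => .vpair (cps R d1) (cps R d2)
  | _, _, _, _, .vfst _ _ _ _ d => .vfst (cps R d)
  | _, _, _, _, .vsnd _ _ _ _ d => .vsnd (cps R d)
  | _, _, _, _, .vlam _ _ A _ d => .vlam (cpsV R A) (cps R d)
  | _, _, _, _, .vapp _ _ _ _ _ d1 d2 => .vapp (cps R d1) (cps R d2)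
  | _, _, _, _, .cunit _ none => .llam .czero (.cimage R .svar)
  | _, _, _, _, .cunit _ (some D) => .cimage (cpsC R D) .svar
  | _, _, _, _, .cpair _ none _ _ A B d1 d2 =>
      .llam (.csum (cpsC R A) (cpsC R B))
        (.ccase .svar (.lapp (cps R d1) .svar) (.lapp (cps R d2) .svar))
  | _, _, _, _, .cpair _ (some _) _ _ _ _ d1 d2 => .ccase .svar (cps R d1) (cps R d2)
  | _, _, _, _, .cfst _ none _ A _ d => .llam (cpsC R A) (.lapp (cps R d) (.cinl .svar))
  | _, _, _, _, .cfst _ (some _) _ _ _ d => Tm.ssubst (.cinl .svar) (cps R d)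
  | _, _, _, _, .csnd _ none _ _ B d => .llam (cpsC R B) (.lapp (cps R d) (.cinr .svar))
  | _, _, _, _, .csnd _ (some _) _ _ _ d => Tm.ssubst (.cinr .svar) (cps R d)
  | _, _, _, _, .clam _ none _ A B d =>
      .llam (.copow (cpsV R A) (cpsC R B)) (.copowlet .svar (.lapp (cps R d) .svar))
  | _, _, _, _, .clam _ (some _) _ _ _ d => .copowlet .svar (cps R d)
  | _, _, _, _, .capp _ none _ _ _ B d1 d2 =>
      .llam (cpsC R B) (.lapp (cps R d1) (.copow (cps R d2) .svar))
  | _, _, _, _, .capp _ (some _) _ _ _ _ d1 d2 =>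
      Tm.ssubst (.copow (cps R d2) .svar) (cps R d1)
  | _, _, _, _, .top _ => .llam R .svar
  | _, _, _, _, .ilet _ none _ _ A d1 d2 =>
      .llam (cpsC R A) (.lapp (cps R d1) (.lapp (cps R d2) .svar))
  | _, _, _, _, .ilet _ (some _) _ _ _ d1 d2 =>
      Tm.ssubst (.lapp (cps R d2) .svar) (cps R d1)
  | _, _, _, _, .bang _ _ A d => .llam (.carr (cpsV R A) R) (.capp .svar (cps R d))
  | _, _, _, _, .banglet _ none _ _ A B d1 d2 =>
      .llam (cpsC R B) (.lapp (cps R d1) (.clam (cpsV R A) (.lapp (cps R d2) .svar)))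
  | _, _, _, _, .banglet _ (some _) _ _ A _ d1 d2 =>
      Tm.ssubst (.clam (cpsV R A) (.lapp (cps R d2) .svar)) (cps R d1)
  | _, _, _, _, .copow _ none _ _ A B d1 d2 =>
      .llam (.carr (cpsV R A) (cpsC R B)) (.lapp (cps R d2) (.capp .svar (cps R d1)))
  | _, _, _, _, .copow _ (some _) _ _ _ _ d1 d2 =>
      Tm.ssubst (.capp .svar (cps R d1)) (cps R d2)
  | _, _, _, _, .copowlet _ none _ _ A _ C d1 d2 =>
      .llam (cpsC R C) (.lapp (cps R d1) (.clam (cpsV R A) (cps R d2)))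
  | _, _, _, _, .copowlet _ (some _) _ _ A _ _ d1 d2 =>
      Tm.ssubst (.clam (cpsV R A) (cps R d2)) (cps R d1)
  | _, _, _, _, .cimage _ none _ A d => .llam (cpsC R A) (.lapp (cps R d) .cunit)
  | _, _, _, _, .cimage _ (some _) _ _ d => Tm.ssubst .cunit (cps R d)
  | _, _, _, _, .cinl _ none _ A B d =>
      .llam (.cand (cpsC R A) (cpsC R B)) (.lapp (cps R d) (.cfst .svar))
  | _, _, _, _, .cinl _ (some _) _ _ _ d => Tm.ssubst (.cfst .svar) (cps R d)
  | _, _, _, _, .cinr _ none _ A B d =>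
      .llam (.cand (cpsC R A) (cpsC R B)) (.lapp (cps R d) (.csnd .svar))
  | _, _, _, _, .cinr _ (some _) _ _ _ d => Tm.ssubst (.csnd .svar) (cps R d)
  | _, _, _, _, .ccase _ none _ _ _ _ _ C d1 d2 d3 =>
      .llam (cpsC R C) (.lapp (cps R d1) (.cpair (cps R d2) (cps R d3)))
  | _, _, _, _, .ccase _ (some _) _ _ _ _ _ _ d1 d2 d3 =>
      Tm.ssubst (.cpair (cps R d2) (cps R d3)) (cps R d1)
  | _, _, _, _, .llam _ _ _ B d => .llam (cpsC R B) (cps R d)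
  | _, _, _, _, .lapp _ none _ _ _ B d1 d2 =>
      .llam (cpsC R B) (.lapp (cps R d2) (.lapp (cps R d1) .svar))
  | _, _, _, _, .lapp _ (some _) _ _ _ _ d1 d2 =>
      Tm.ssubst (.lapp (cps R d1) .svar) (cps R d2)

end EEC

namespace EEC

/-! ## The type isomorphisms `ι` of Figure 7, with explicit inverses -/

mutual
  /-- The closed term `ι_A : (Aᶜ)ᶜ → A` (Figure 7). -/
  def iotaV (R : CType) : VType → Tm
    | .base a => .vlam (.base a) (.var 0)
    | .unit => .vlam .unit .unit
    | .prod A B => .vlam (cpsV R (cpsV R (.prod A B)))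
        (.vpair (.vapp (iotaV R A) (.vfst (.var 0))) (.vapp (iotaV R B) (.vsnd (.var 0))))
    | .arr A B => .vlam (cpsV R (cpsV R (.arr A B)))
        (.vlam A (.vapp (iotaV R B) (.vapp (.var 1) (.vapp (iotaVinv R A) (.var 0)))))
    | .comp A => .vlam (cpsV R (cpsV R (.comp A)))
        (.lapp (iotaC R A) (.lapp (.var 0) .top))
    | .lin A B => .vlam (cpsV R (cpsV R (.lin A B)))
        (.llam A (.lapp (iotaC R B) (.lapp (.var 0) (.lapp (iotaCinv R A) .svar))))
  /-- The closed term `ι_A⁻¹ : A → (Aᶜ)ᶜ`. -/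
  def iotaVinv (R : CType) : VType → Tm
    | .base a => .vlam (.base a) (.var 0)
    | .unit => .vlam .unit .unit
    | .prod A B => .vlam (.prod A B)
        (.vpair (.vapp (iotaVinv R A) (.vfst (.var 0))) (.vapp (iotaVinv R B) (.vsnd (.var 0))))
    | .arr A B => .vlam (.arr A B)
        (.vlam (cpsV R (cpsV R A)) (.vapp (iotaVinv R B) (.vapp (.var 1) (.vapp (iotaV R A) (.var 0)))))
    | .comp A => .vlam (.comp A)
        (.llam .iunit (.ilet .svar (.lapp (iotaCinv R A) (.var 0))))
    | .lin A B => .vlam (.lin A B)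
        (.llam (cpsC R (cpsC R A)) (.lapp (iotaCinv R B) (.lapp (.var 0) (.lapp (iotaC R A) .svar))))
  /-- The closed term `ι_A̲ : (A̲ᶜ)ᶜ ⊸ A̲` (Figure 7). -/
  def iotaC (R : CType) : CType → Tm
    | .base a => .llam (cpsC R (cpsC R (.base a))) .svar
    | .cunit => .llam (cpsC R (cpsC R .cunit)) .cunit
    | .cand A B => .llam (cpsC R (cpsC R (.cand A B)))
        (.cpair (.lapp (iotaC R A) (.cfst .svar)) (.lapp (iotaC R B) (.csnd .svar)))
    | .carr A B => .llam (cpsC R (cpsC R (.carr A B)))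
        (.clam A (.lapp (iotaC R B) (.capp .svar (.vapp (iotaVinv R A) (.var 0)))))
    | .iunit => .llam (cpsC R (cpsC R .iunit)) .svar
    | .bang A => .llam (cpsC R (cpsC R (.bang A)))
        (.copowlet .svar (.ilet .svar (.bang (.vapp (iotaV R A) (.var 0)))))
    | .copow A B => .llam (cpsC R (cpsC R (.copow A B)))
        (.copowlet .svar (.copow (.vapp (iotaV R A) (.var 0)) (.lapp (iotaC R B) .svar)))
    | .czero => .llam (cpsC R (cpsC R .czero)) .svar
    | .csum A B => .llam (cpsC R (cpsC R (.csum A B)))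
        (.ccase .svar (.cinl (.lapp (iotaC R A) .svar)) (.cinr (.lapp (iotaC R B) .svar)))
  /-- The closed term `ι_A̲⁻¹ : A̲ ⊸ (A̲ᶜ)ᶜ`. -/
  def iotaCinv (R : CType) : CType → Tm
    | .base a => .llam (.base a) .svar
    | .cunit => .llam .cunit .cunit
    | .cand A B => .llam (.cand A B)
        (.cpair (.lapp (iotaCinv R A) (.cfst .svar)) (.lapp (iotaCinv R B) (.csnd .svar)))
    | .carr A B => .llam (.carr A B)
        (.clam (cpsV R (cpsV R A)) (.lapp (iotaCinv R B) (.capp .svar (.vapp (iotaV R A) (.var 0)))))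
    | .iunit => .llam .iunit .svar
    | .bang A => .llam (.bang A)
        (.banglet .svar (.copow (.vapp (iotaVinv R A) (.var 0)) .top))
    | .copow A B => .llam (.copow A B)
        (.copowlet .svar (.copow (.vapp (iotaVinv R A) (.var 0)) (.lapp (iotaCinv R B) .svar)))
    | .czero => .llam .czero .svar
    | .csum A B => .llam (.csum A B)
        (.ccase .svar (.cinl (.lapp (iotaCinv R A) .svar)) (.cinr (.lapp (iotaCinv R B) .svar)))
end

/-- The substitution `[ι⁻¹(Γ)]`, replacing each variable `xᵢ : Cᵢ` of `Γ` by
`ι_{Cᵢ}⁻¹(xᵢ)`. -/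
def iotaSubst (R : CType) (Γ : List VType) (t : Tm) : Tm :=
  Tm.psubst (fun n =>
    match Γ[n]? with
    | some C => .vapp (iotaVinv R C) (.var n)
    | none => .var n) t

/-! ## The simply-typed λ-calculus -/

/-- Simple types. -/
inductive STy : Type
  | base : ℕ → STy
  | unit : STy
  | prod : STy → STy → STy
  | arr : STy → STy → STy

/-- Raw simply-typed λ-terms (de Bruijn indices). -/
inductive LTm : Type
  | var : ℕ → LTm
  | unit : LTm
  | pair : LTm → LTm → LTm
  | fst : LTm → LTm
  | snd : LTm → LTm
  | lam : STy → LTm → LTm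
  | app : LTm → LTm → LTm

namespace LTm

/-- Renaming of variables. -/
def rename (f : ℕ → ℕ) : LTm → LTm
  | .var n => .var (f n)
  | .unit => .unit
  | .pair M N => .pair (rename f M) (rename f N)
  | .fst M => .fst (rename f M)
  | .snd M => .snd (rename f M)
  | .lam σ M => .lam σ (rename (Tm.liftN f) M)
  | .app M N => .app (rename f M) (rename f N)

/-- Weakening. -/
def shift (M : LTm) : LTm := rename Nat.succ M

/-- Parallel capture-avoiding substitution. -/
def psubst (σ : ℕ → LTm) : LTm → LTm
  | .var n => σ n
  | .unit => .unit
  | .pair M N => .pair (psubst σ M) (psubst σ N)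
  | .fst M => .fst (psubst σ M)
  | .snd M => .snd (psubst σ M)
  | .lam τ M => .lam τ (psubst (fun n => match n with | 0 => .var 0 | m + 1 => shift (σ m)) M)
  | .app M N => .app (psubst σ M) (psubst σ N)

/-- Capture-avoiding substitution `M[N/x]` for the innermost variable. -/
def subst0 (N : LTm) (M : LTm) : LTm :=
  psubst (fun n => match n with | 0 => N | m + 1 => .var m) M

end LTm

/-- Typing derivations of the simply-typed λ-calculus (Figure 3). -/
inductive LDeriv : List STy → LTm → STy → Type
  | var (Θ : List STy) (n : ℕ) (σ : STy) : Θ[n]? = some σ → LDeriv Θ (.var n) σ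
  | unit (Θ : List STy) : LDeriv Θ .unit .unit
  | pair (Θ : List STy) (M N : LTm) (σ τ : STy) :
      LDeriv Θ M σ → LDeriv Θ N τ → LDeriv Θ (.pair M N) (.prod σ τ)
  | fst (Θ : List STy) (M : LTm) (σ τ : STy) :
      LDeriv Θ M (.prod σ τ) → LDeriv Θ (.fst M) σ
  | snd (Θ : List STy) (M : LTm) (σ τ : STy) :
      LDeriv Θ M (.prod σ τ) → LDeriv Θ (.snd M) τ
  | lam (Θ : List STy) (M : LTm) (σ τ : STy) :
      LDeriv (σ :: Θ) M τ → LDeriv Θ (.lam σ M) (.arr σ τ)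
  | app (Θ : List STy) (M N : LTm) (σ τ : STy) :
      LDeriv Θ M (.arr σ τ) → LDeriv Θ N σ → LDeriv Θ (.app M N) τ

/-- Values of the (call-by-value) λ-calculus. -/
inductive LVal : LTm → Prop
  | var (n : ℕ) : LVal (.var n)
  | unit : LVal .unit
  | lam (σ : STy) (M : LTm) : LVal (.lam σ M)
  | pair {M N : LTm} : LVal M → LVal N → LVal (.pair M N)

/-- βη-equality of the simply-typed λ-calculus. -/
inductive LBetaEta : List STy → LTm → LTm → STy → Prop
  | refl {Θ M σ} : LDeriv Θ M σ → LBetaEta Θ M M σ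
  | symm {Θ M N σ} : LBetaEta Θ M N σ → LBetaEta Θ N M σ
  | trans {Θ M N P σ} : LBetaEta Θ M N σ → LBetaEta Θ N P σ → LBetaEta Θ M P σ
  | pair_cong {Θ M M' N N' σ τ} : LBetaEta Θ M M' σ → LBetaEta Θ N N' τ →
      LBetaEta Θ (.pair M N) (.pair M' N') (.prod σ τ)
  | fst_cong {Θ M M' σ τ} : LBetaEta Θ M M' (.prod σ τ) → LBetaEta Θ (.fst M) (.fst M') σ
  | snd_cong {Θ M M' σ τ} : LBetaEta Θ M M' (.prod σ τ) → LBetaEta Θ (.snd M) (.snd M') τ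
  | lam_cong {Θ M M' σ τ} : LBetaEta (σ :: Θ) M M' τ →
      LBetaEta Θ (.lam σ M) (.lam σ M') (.arr σ τ)
  | app_cong {Θ M M' N N' σ τ} : LBetaEta Θ M M' (.arr σ τ) → LBetaEta Θ N N' σ →
      LBetaEta Θ (.app M N) (.app M' N') τ
  | beta {Θ M N σ τ} : LDeriv (σ :: Θ) M τ → LDeriv Θ N σ →
      LBetaEta Θ (.app (.lam σ M) N) (LTm.subst0 N M) τ
  | eta {Θ M σ τ} : LDeriv Θ M (.arr σ τ) →
      LBetaEta Θ (.lam σ (.app (LTm.shift M) (.var 0))) M (.arr σ τ)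
  | fst_beta {Θ M N σ τ} : LDeriv Θ M σ → LDeriv Θ N τ →
      LBetaEta Θ (.fst (.pair M N)) M σ
  | snd_beta {Θ M N σ τ} : LDeriv Θ M σ → LDeriv Θ N τ →
      LBetaEta Θ (.snd (.pair M N)) N τ
  | pair_eta {Θ M σ τ} : LDeriv Θ M (.prod σ τ) →
      LBetaEta Θ (.pair (.fst M) (.snd M)) M (.prod σ τ)
  | unit_eta {Θ M} : LDeriv Θ M .unit → LBetaEta Θ M .unit .unit

/-- Equality in Moggi's computational λ-calculus `λc` (call-by-value
βη-equalities restricted to values, together with the `let`-laws, expressed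
via the standard encoding `let x = M in N := (λx.N) M`). -/
inductive LamC : List STy → LTm → LTm → STy → Prop
  | refl {Θ M σ} : LDeriv Θ M σ → LamC Θ M M σ
  | symm {Θ M N σ} : LamC Θ M N σ → LamC Θ N M σ
  | trans {Θ M N P σ} : LamC Θ M N σ → LamC Θ N P σ → LamC Θ M P σ
  | pair_cong {Θ M M' N N' σ τ} : LamC Θ M M' σ → LamC Θ N N' τ →
      LamC Θ (.pair M N) (.pair M' N') (.prod σ τ)
  | fst_cong {Θ M M' σ τ} : LamC Θ M M' (.prod σ τ) → LamC Θ (.fst M) (.fst M') σ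
  | snd_cong {Θ M M' σ τ} : LamC Θ M M' (.prod σ τ) → LamC Θ (.snd M) (.snd M') τ
  | lam_cong {Θ M M' σ τ} : LamC (σ :: Θ) M M' τ →
      LamC Θ (.lam σ M) (.lam σ M') (.arr σ τ)
  | app_cong {Θ M M' N N' σ τ} : LamC Θ M M' (.arr σ τ) → LamC Θ N N' σ →
      LamC Θ (.app M N) (.app M' N') τ
  | beta_v {Θ M V σ τ} : LDeriv (σ :: Θ) M τ → LDeriv Θ V σ → LVal V →
      LamC Θ (.app (.lam σ M) V) (LTm.subst0 V M) τ
  | eta_v {Θ V σ τ} : LVal V → LDeriv Θ V (.arr σ τ) →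
      LamC Θ (.lam σ (.app (LTm.shift V) (.var 0))) V (.arr σ τ)
  | fst_beta_v {Θ V W σ τ} : LVal V → LVal W → LDeriv Θ V σ → LDeriv Θ W τ →
      LamC Θ (.fst (.pair V W)) V σ
  | snd_beta_v {Θ V W σ τ} : LVal V → LVal W → LDeriv Θ V σ → LDeriv Θ W τ →
      LamC Θ (.snd (.pair V W)) W τ
  | pair_eta_v {Θ V σ τ} : LVal V → LDeriv Θ V (.prod σ τ) →
      LamC Θ (.pair (.fst V) (.snd V)) V (.prod σ τ)
  | unit_eta_v {Θ V} : LVal V → LDeriv Θ V .unit → LamC Θ V .unit .unit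
  | let_eta {Θ M σ} : LDeriv Θ M σ → LamC Θ (.app (.lam σ (.var 0)) M) M σ
  | let_assoc {Θ M N L σ ρ τ} : LDeriv (σ :: Θ) M τ → LDeriv (ρ :: Θ) N σ →
      LDeriv Θ L ρ →
      LamC Θ (.app (.lam σ M) (.app (.lam ρ N) L))
        (.app (.lam ρ (.app (.lam σ (LTm.rename (Tm.liftN Nat.succ) M)) N)) L) τ
  | app_left {Θ M N σ τ} : LDeriv Θ M (.arr σ τ) → LDeriv Θ N σ →
      LamC Θ (.app M N) (.app (.lam (.arr σ τ) (.app (.var 0) (LTm.shift N))) M) τ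
  | app_right {Θ V N σ τ} : LVal V → LDeriv Θ V (.arr σ τ) → LDeriv Θ N σ →
      LamC Θ (.app V N) (.app (.lam σ (.app (LTm.shift V) (.var 0))) N) τ
  | pair_left {Θ M N σ τ} : LDeriv Θ M σ → LDeriv Θ N τ →
      LamC Θ (.pair M N) (.app (.lam σ (.pair (.var 0) (LTm.shift N))) M) (.prod σ τ)
  | pair_right {Θ V N σ τ} : LVal V → LDeriv Θ V σ → LDeriv Θ N τ →
      LamC Θ (.pair V N) (.app (.lam τ (.pair (LTm.shift V) (.var 0))) N) (.prod σ τ)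
  | fst_cc {Θ M σ τ} : LDeriv Θ M (.prod σ τ) →
      LamC Θ (.fst M) (.app (.lam (.prod σ τ) (.fst (.var 0))) M) σ
  | snd_cc {Θ M σ τ} : LDeriv Θ M (.prod σ τ) →
      LamC Θ (.snd M) (.app (.lam (.prod σ τ) (.snd (.var 0))) M) τ

end EEC

namespace EEC

/-! ## The standard cbv and cbn translations of typed λ-calculus into EEC -/

/-- The computation-type constant `α̲` associated with a simply-typed
λ-calculus type constant `α` (the association is injective but not
surjective, so that some computation-type constants of EEC are different
from `α̲` for every λ-calculus type constant `α`). -/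
def assocC (a : ℕ) : CType := .base (a + 1)

/-- The call-by-value translation `σᵛ` on types. -/
def cbvT : STy → VType
  | .base a => .base a
  | .unit => .unit
  | .prod σ τ => .prod (cbvT σ) (cbvT τ)
  | .arr σ τ => .arr (cbvT σ) (.comp (.bang (cbvT τ)))

/-- The call-by-value translation `Θᵛ` on contexts. -/
def cbvCtx (Θ : List STy) : List VType := Θ.map cbvT

/-- The call-by-value translation on terms: `Θ ⊢ M : τ` is sent to
`Θᵛ ⊢ Mᵛ : !(τᵛ)`. -/
def cbvTm : LTm → Tm
  | .var n => .bang (.var n)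
  | .unit => .bang .unit
  | .pair M N => .banglet (cbvTm M) (.banglet (Tm.shift (cbvTm N)) (.bang (.vpair (.var 1) (.var 0))))
  | .fst M => .banglet (cbvTm M) (.bang (.vfst (.var 0)))
  | .snd M => .banglet (cbvTm M) (.bang (.vsnd (.var 0)))
  | .lam σ M => .bang (.vlam (cbvT σ) (cbvTm M))
  | .app M N => .banglet (cbvTm M) (.banglet (Tm.shift (cbvTm N)) (.vapp (.var 1) (.var 0)))

/-- The call-by-name translation `σⁿ` on types. -/
def cbnT : STy → CType
  | .base a => assocC a
  | .unit => .cunit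
  | .prod σ τ => .cand (cbnT σ) (cbnT τ)
  | .arr σ τ => .carr (.comp (cbnT σ)) (cbnT τ)

/-- The call-by-name translation `Θⁿ` on contexts. -/
def cbnCtx (Θ : List STy) : List VType := Θ.map (fun σ => .comp (cbnT σ))

/-- The call-by-name translation on terms: `Θ ⊢ M : τ` is sent to
`Θⁿ ⊢ Mⁿ : τⁿ`, mimicking each construct by the corresponding
computation-type construct of EEC. -/
def cbnTm : LTm → Tm
  | .var n => .var n
  | .unit => .cunit
  | .pair M N => .cpair (cbnTm M) (cbnTm N)
  | .fst M => .cfst (cbnTm M)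
  | .snd M => .csnd (cbnTm M)
  | .lam σ M => .clam (.comp (cbnT σ)) (cbnTm M)
  | .app M N => .capp (cbnTm M) (cbnTm N)

/-! ## Hasegawa's linear-use CPS translations (Section 4) -/

/-- The call-by-value linear-use CPS translation `σᵛᶜ` on types. -/
def cbvcpsT (R : CType) : STy → VType
  | .base a => .base a
  | .unit => .unit
  | .prod σ τ => .prod (cbvcpsT R σ) (cbvcpsT R τ)
  | .arr σ τ => .arr (cbvcpsT R σ) (.lin (.carr (cbvcpsT R τ) R) R)

/-- `Θᵛᶜ`. -/
def cbvcpsCtx (R : CType) (Θ : List STy) : List VType := Θ.map (cbvcpsT R)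

/-- The call-by-value linear-use CPS translation on terms: `Θ ⊢ M : τ` is
sent to `Θᵛᶜ ⊢ Mᵛᶜ : (τᵛᶜ ⇒ R̲) ⊸ R̲`. -/
def cbvcps (R : CType) : {Θ : List STy} → {M : LTm} → {σ : STy} → LDeriv Θ M σ → Tm
  | _, _, _, .var _ n σ _ => .llam (.carr (cbvcpsT R σ) R) (.capp .svar (.var n))
  | _, _, _, .unit _ => .llam (.carr .unit R) (.capp .svar .unit)
  | _, _, _, .pair _ _ _ σ τ dM dN =>
      .llam (.carr (.prod (cbvcpsT R σ) (cbvcpsT R τ)) R)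
        (.lapp (cbvcps R dM)
          (.clam (cbvcpsT R σ)
            (.lapp (Tm.shift (cbvcps R dN))
              (.clam (cbvcpsT R τ) (.capp .svar (.vpair (.var 1) (.var 0)))))))
  | _, _, _, .fst _ _ σ τ dM =>
      .llam (.carr (cbvcpsT R σ) R)
        (.lapp (cbvcps R dM)
          (.clam (.prod (cbvcpsT R σ) (cbvcpsT R τ)) (.capp .svar (.vfst (.var 0)))))
  | _, _, _, .snd _ _ σ τ dM =>
      .llam (.carr (cbvcpsT R τ) R)
        (.lapp (cbvcps R dM)
          (.clam (.prod (cbvcpsT R σ) (cbvcpsT R τ)) (.capp .svar (.vsnd (.var 0)))))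
  | _, _, _, .lam _ _ σ τ dM =>
      .llam (.carr (.arr (cbvcpsT R σ) (.lin (.carr (cbvcpsT R τ) R) R)) R)
        (.capp .svar (.vlam (cbvcpsT R σ) (cbvcps R dM)))
  | _, _, _, .app _ _ _ σ τ dM dN =>
      .llam (.carr (cbvcpsT R τ) R)
        (.lapp (cbvcps R dM)
          (.clam (.arr (cbvcpsT R σ) (.lin (.carr (cbvcpsT R τ) R) R))
            (.lapp (Tm.shift (cbvcps R dN))
              (.clam (cbvcpsT R σ) (.lapp (.vapp (.var 1) (.var 0)) .svar)))))

/-- The call-by-name linear-use CPS translation `σⁿᶜ` on types. -/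
def cbncpsT (R : CType) : STy → CType
  | .base a => assocC a
  | .unit => .czero
  | .prod σ τ => .csum (cbncpsT R σ) (cbncpsT R τ)
  | .arr σ τ => .copow (.lin (cbncpsT R σ) R) (cbncpsT R τ)

/-- `Θⁿᶜ ⊸ R̲`, assigning each variable `xᵢ : σᵢ` the type `σᵢⁿᶜ ⊸ R̲`. -/
def cbncpsCtx (R : CType) (Θ : List STy) : List VType :=
  Θ.map (fun σ => .lin (cbncpsT R σ) R)

/-- The call-by-name linear-use CPS translation on terms: `Θ ⊢ M : τ` is
sent to `Θⁿᶜ ⊸ R̲ ⊢ Mⁿᶜ : τⁿᶜ ⊸ R̲`. -/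
def cbncps (R : CType) : {Θ : List STy} → {M : LTm} → {σ : STy} → LDeriv Θ M σ → Tm
  | _, _, _, .var _ n _ _ => .var n
  | _, _, _, .unit _ => .llam .czero (.cimage R .svar)
  | _, _, _, .pair _ _ _ σ τ dM dN =>
      .llam (.csum (cbncpsT R σ) (cbncpsT R τ))
        (.ccase .svar (.lapp (cbncps R dM) .svar) (.lapp (cbncps R dN) .svar))
  | _, _, _, .fst _ _ σ _τ dM => .llam (cbncpsT R σ) (.lapp (cbncps R dM) (.cinl .svar))
  | _, _, _, .snd _ _ _ τ dM => .llam (cbncpsT R τ) (.lapp (cbncps R dM) (.cinr .svar))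
  | _, _, _, .lam _ _ σ τ dM =>
      .llam (.copow (.lin (cbncpsT R σ) R) (cbncpsT R τ))
        (.copowlet .svar (.lapp (cbncps R dM) .svar))
  | _, _, _, .app _ _ _ σ τ dM dN =>
      .llam (cbncpsT R τ) (.lapp (cbncps R dM) (.copow (cbncps R dN) .svar))

end EEC

namespace EEC

section SubstitutionProperty

open Tm

namespace Tm

theorem liftN_id : liftN id = id := by
  funext n; cases n <;> rfl

theorem liftN_comp (g f : ℕ → ℕ) : liftN g ∘ liftN f = liftN (g ∘ f) := by
  funext n; cases n <;> rfl

theorem rename_id (t : Tm) : rename id t = t := by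
  induction t <;> simp_all [rename, liftN_id]

theorem rename_rename (g f : ℕ → ℕ) (t : Tm) : rename g (rename f t) = rename (g ∘ f) t := by
  induction t generalizing g f <;> simp_all [rename, liftN_comp]

theorem rename_shift (f : ℕ → ℕ) (t : Tm) : rename (liftN f) (shift t) = shift (rename f t) := by
  simp only [shift, rename_rename]; rfl

theorem liftS_comp_liftN (σ : ℕ → Tm) (f : ℕ → ℕ) :
    (fun n => liftS σ (liftN f n)) = liftS fun n => σ (f n) := by
  funext n; cases n <;> rfl

theorem psubst_rename (σ : ℕ → Tm) (f : ℕ → ℕ) (t : Tm) :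
    psubst σ (rename f t) = psubst (fun n => σ (f n)) t := by
  induction t generalizing σ f <;> simp_all [rename, psubst, liftS_comp_liftN]

theorem rename_liftS (σ : ℕ → Tm) (f : ℕ → ℕ) :
    (fun n => rename (liftN f) (liftS σ n)) = liftS fun n => rename f (σ n) := by
  funext n
  cases n with
  | zero => rfl
  | succ n => exact rename_shift f (σ n)

theorem rename_psubst (f : ℕ → ℕ) (σ : ℕ → Tm) (t : Tm) :
    rename f (psubst σ t) = psubst (fun n => rename f (σ n)) t := by
  induction t generalizing σ f <;> simp_all [rename, psubst, rename_liftS]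

theorem psubst_shift (σ : ℕ → Tm) (t : Tm) : psubst (liftS σ) (shift t) = shift (psubst σ t) := by
  simp only [shift, psubst_rename, rename_psubst]; rfl

theorem psubst_liftS (τ σ : ℕ → Tm) :
    (fun n => psubst (liftS τ) (liftS σ n)) = liftS fun n => psubst τ (σ n) := by
  funext n
  cases n with
  | zero => rfl
  | succ n => exact psubst_shift τ (σ n)

theorem psubst_psubst (τ σ : ℕ → Tm) (t : Tm) :
    psubst τ (psubst σ t) = psubst (fun n => psubst τ (σ n)) t := by
  induction t generalizing σ τ <;> simp_all [psubst, psubst_liftS]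

theorem liftS_var : liftS var = var := by
  funext n; cases n <;> rfl

theorem psubst_var (t : Tm) : psubst var t = t := by
  induction t <;> simp_all [psubst, liftS_var]

/-- Extension of a parallel substitution by a term for the innermost variable. -/
def scons (a : Tm) (σ : ℕ → Tm) : ℕ → Tm
  | 0 => a
  | n + 1 => σ n

theorem subst0_eq_psubst (u t : Tm) : subst0 u t = psubst (scons u var) t := by
  unfold subst0
  congr 1

theorem subst0_psubst_liftS (a : Tm) (σ : ℕ → Tm) (t : Tm) :
    subst0 a (psubst (liftS σ) t) = psubst (scons a σ) t := by
  rw [subst0_eq_psubst, psubst_psubst]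
  congr 1
  funext n
  cases n with
  | zero => rfl
  | succ n => exact (psubst_rename _ _ _).trans (psubst_var _)

theorem subst0_shift (a t : Tm) : subst0 a (shift t) = t := by
  rw [subst0_eq_psubst, shift, psubst_rename]
  exact psubst_var t

theorem rename_subst0 (f : ℕ → ℕ) (u t : Tm) :
    rename f (subst0 u t) = subst0 (rename f u) (rename (liftN f) t) := by
  simp only [subst0_eq_psubst, rename_psubst, psubst_rename]
  congr 1
  funext n; cases n <;> rfl

theorem rename_ssubst (f : ℕ → ℕ) (s t : Tm) :
    rename f (ssubst s t) = ssubst (rename f s) (rename f t) := by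
  induction t generalizing s f <;> simp_all [rename, ssubst, rename_shift]

theorem ssubst_svar (t : Tm) : ssubst svar t = t := by
  have h : shift svar = svar := rfl
  induction t <;> simp_all [ssubst]

/-- A term without free occurrences of the stoup variable. -/
def StoupFree (t : Tm) : Prop := ∀ s f, ssubst s (rename f t) = rename f t

theorem StoupFree.ssubst_eq {t : Tm} (h : StoupFree t) (s : Tm) : ssubst s t = t := by
  simpa [rename_id] using h s id

theorem StoupFree.rename {t : Tm} (h : StoupFree t) (f : ℕ → ℕ) : StoupFree (rename f t) := by
  intro s g
  rw [rename_rename]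
  exact h _ _

theorem stoupFree_var (n : ℕ) : StoupFree (var n) := fun _ _ => rfl

theorem stoupFree_liftS {σ : ℕ → Tm} (h : ∀ n, StoupFree (σ n)) (n : ℕ) :
    StoupFree (liftS σ n) := by
  cases n with
  | zero => exact stoupFree_var 0
  | succ n => exact (h n).rename _

theorem stoupFree_scons {a : Tm} {σ : ℕ → Tm} (ha : StoupFree a) (h : ∀ n, StoupFree (σ n))
    (n : ℕ) : StoupFree (scons a σ n) := by
  cases n with
  | zero => exact ha
  | succ n => exact h n

theorem psubst_ssubst {σ : ℕ → Tm} (h : ∀ n, StoupFree (σ n)) (s t : Tm) :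
    psubst σ (ssubst s t) = ssubst (psubst σ s) (psubst σ t) := by
  induction t generalizing s σ with
  | var n => exact ((h n).ssubst_eq _).symm
  | _ => simp_all [psubst, ssubst, ← psubst_shift, stoupFree_liftS]

end Tm


theorem Deriv.stoupFree {Γ : List VType} {t : Tm} {A : VType} (d : Deriv Γ none t A) :
    StoupFree t := by
  generalize hΔ : (none : Option CType) = Δ at d
  have key : ∀ s f, ssubst s (t.rename f) = t.rename f := by
    induction d <;> intro s f <;> simp_all [ssubst, Tm.rename]
  exact key

/-- Derivability of a typing judgement. -/
abbrev HasTy (Γ : List VType) (Δ : Option CType) (t : Tm) (A : VType) : Prop :=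
  Nonempty (Deriv Γ Δ t A)

/-- `f` is a type-preserving renaming from `Γ` to another context. -/
def IsRen (f : ℕ → ℕ) (Γ Γ' : List VType) : Prop :=
  ∀ n A, Γ[n]? = some A → Γ'[f n]? = some A

theorem isRen_id (Γ : List VType) : IsRen id Γ Γ := fun _ _ h => h

theorem isRen_succ (Γ : List VType) (A : VType) : IsRen Nat.succ Γ (A :: Γ) := fun _ _ h => h

theorem IsRen.comp {f g : ℕ → ℕ} {Γ Γ' Γ'' : List VType} (hg : IsRen g Γ' Γ'')
    (hf : IsRen f Γ Γ') : IsRen (g ∘ f) Γ Γ'' :=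
  fun n A h => hg _ A (hf n A h)

theorem IsRen.lift {f : ℕ → ℕ} {Γ Γ' : List VType} (h : IsRen f Γ Γ') (A : VType) :
    IsRen (liftN f) (A :: Γ) (A :: Γ') := by
  intro n B hn
  cases n with
  | zero => exact hn
  | succ n => exact h n B hn

theorem cpsCtx_getElem? (R : CType) (Γ : List VType) (n : ℕ) :
    (cpsCtx R Γ)[n]? = Γ[n]?.map (cpsV R) := by
  simp [cpsCtx]

/-- Weakening of derivations commutes with the self-translation. -/
theorem Deriv.exists_rename (R : CType) {Γ : List VType} {Δ : Option CType} {t : Tm} {A : VType}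
    (d : Deriv Γ Δ t A) : ∀ {Γ' : List VType} {f : ℕ → ℕ}, IsRen f Γ Γ' →
      ∃ d' : Deriv Γ' Δ (t.rename f) A, cps R d' = (cps R d).rename f := by
  induction d with
  | var Γ n A h => exact fun hf => ⟨.var _ _ _ (hf n A h), rfl⟩
  | svar => exact fun _ => ⟨.svar _ _, rfl⟩
  | unit => exact fun _ => ⟨.unit _, rfl⟩
  | top => exact fun _ => ⟨.top _, rfl⟩
  | cunit Γ Δ => exact fun _ => ⟨.cunit _ _, by cases Δ <;> rfl⟩
  | vpair Γ t u A B d1 d2 ih1 ih2 =>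
    intro Γ' f hf
    obtain ⟨e1, h1⟩ := ih1 hf
    obtain ⟨e2, h2⟩ := ih2 hf
    exact ⟨.vpair _ _ _ _ _ e1 e2, by simp [cps, Tm.rename, h1, h2]⟩
  | vfst Γ t A B d ih =>
    intro Γ' f hf
    obtain ⟨e, h⟩ := ih hf
    exact ⟨.vfst _ _ _ _ e, by simp [cps, Tm.rename, h]⟩
  | vsnd Γ t A B d ih =>
    intro Γ' f hf
    obtain ⟨e, h⟩ := ih hf
    exact ⟨.vsnd _ _ _ _ e, by simp [cps, Tm.rename, h]⟩
  | vlam Γ t A B d ih =>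
    intro Γ' f hf
    obtain ⟨e, h⟩ := ih (hf.lift _)
    exact ⟨.vlam _ _ _ _ e, by simp [cps, Tm.rename, h]⟩
  | vapp Γ s t A B d1 d2 ih1 ih2 =>
    intro Γ' f hf
    obtain ⟨e1, h1⟩ := ih1 hf
    obtain ⟨e2, h2⟩ := ih2 hf
    exact ⟨.vapp _ _ _ _ _ e1 e2, by simp [cps, Tm.rename, h1, h2]⟩
  | cpair Γ Δ t u A B d1 d2 ih1 ih2 =>
    intro Γ' f hf
    obtain ⟨e1, h1⟩ := ih1 hf
    obtain ⟨e2, h2⟩ := ih2 hf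
    exact ⟨.cpair _ _ _ _ _ _ e1 e2, by cases Δ <;> simp [cps, Tm.rename, h1, h2]⟩
  | cfst Γ Δ t A B d ih =>
    intro Γ' f hf
    obtain ⟨e, h⟩ := ih hf
    exact ⟨.cfst _ _ _ _ _ e, by cases Δ <;> simp [cps, Tm.rename, rename_ssubst, h]⟩
  | csnd Γ Δ t A B d ih =>
    intro Γ' f hf
    obtain ⟨e, h⟩ := ih hf
    exact ⟨.csnd _ _ _ _ _ e, by cases Δ <;> simp [cps, Tm.rename, rename_ssubst, h]⟩
  | clam Γ Δ t A B d ih =>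
    intro Γ' f hf
    obtain ⟨e, h⟩ := ih (hf.lift _)
    exact ⟨.clam _ _ _ _ _ e, by cases Δ <;> simp [cps, Tm.rename, h]⟩
  | capp Γ Δ s t A B d1 d2 ih1 ih2 =>
    intro Γ' f hf
    obtain ⟨e1, h1⟩ := ih1 hf
    obtain ⟨e2, h2⟩ := ih2 hf
    exact ⟨.capp _ _ _ _ _ _ e1 e2, by cases Δ <;> simp [cps, Tm.rename, rename_ssubst, h1, h2]⟩
  | ilet Γ Δ t u A d1 d2 ih1 ih2 =>
    intro Γ' f hf
    obtain ⟨e1, h1⟩ := ih1 hf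
    obtain ⟨e2, h2⟩ := ih2 hf
    exact ⟨.ilet _ _ _ _ _ e1 e2, by cases Δ <;> simp [cps, Tm.rename, rename_ssubst, h1, h2]⟩
  | bang Γ t A d ih =>
    intro Γ' f hf
    obtain ⟨e, h⟩ := ih hf
    exact ⟨.bang _ _ _ e, by simp [cps, Tm.rename, h]⟩
  | banglet Γ Δ t u A B d1 d2 ih1 ih2 =>
    intro Γ' f hf
    obtain ⟨e1, h1⟩ := ih1 hf
    obtain ⟨e2, h2⟩ := ih2 (hf.lift _)
    exact ⟨.banglet _ _ _ _ _ _ e1 e2, by cases Δ <;> simp [cps, Tm.rename, rename_ssubst, h1, h2]⟩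
  | copow Γ Δ t u A B d1 d2 ih1 ih2 =>
    intro Γ' f hf
    obtain ⟨e1, h1⟩ := ih1 hf
    obtain ⟨e2, h2⟩ := ih2 hf
    exact ⟨.copow _ _ _ _ _ _ e1 e2, by cases Δ <;> simp [cps, Tm.rename, rename_ssubst, h1, h2]⟩
  | copowlet Γ Δ s t A B C d1 d2 ih1 ih2 =>
    intro Γ' f hf
    obtain ⟨e1, h1⟩ := ih1 hf
    obtain ⟨e2, h2⟩ := ih2 (hf.lift _)
    exact ⟨.copowlet _ _ _ _ _ _ _ e1 e2, by cases Δ <;> simp [cps, Tm.rename, rename_ssubst, h1, h2]⟩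
  | cimage Γ Δ t A d ih =>
    intro Γ' f hf
    obtain ⟨e, h⟩ := ih hf
    exact ⟨.cimage _ _ _ _ e, by cases Δ <;> simp [cps, Tm.rename, rename_ssubst, h]⟩
  | cinl Γ Δ t A B d ih =>
    intro Γ' f hf
    obtain ⟨e, h⟩ := ih hf
    exact ⟨.cinl _ _ _ _ _ e, by cases Δ <;> simp [cps, Tm.rename, rename_ssubst, h]⟩
  | cinr Γ Δ t A B d ih =>
    intro Γ' f hf
    obtain ⟨e, h⟩ := ih hf
    exact ⟨.cinr _ _ _ _ _ e, by cases Δ <;> simp [cps, Tm.rename, rename_ssubst, h]⟩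
  | ccase Γ Δ s t u A B C d1 d2 d3 ih1 ih2 ih3 =>
    intro Γ' f hf
    obtain ⟨e1, h1⟩ := ih1 hf
    obtain ⟨e2, h2⟩ := ih2 hf
    obtain ⟨e3, h3⟩ := ih3 hf
    exact ⟨.ccase _ _ _ _ _ _ _ _ e1 e2 e3, by cases Δ <;> simp [cps, Tm.rename, rename_ssubst, h1, h2, h3]⟩
  | llam Γ t A B d ih =>
    intro Γ' f hf
    obtain ⟨e, h⟩ := ih hf
    exact ⟨.llam _ _ _ _ e, by simp [cps, Tm.rename, h]⟩
  | lapp Γ Δ s t A B d1 d2 ih1 ih2 =>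
    intro Γ' f hf
    obtain ⟨e1, h1⟩ := ih1 hf
    obtain ⟨e2, h2⟩ := ih2 hf
    exact ⟨.lapp _ _ _ _ _ _ e1 e2, by cases Δ <;> simp [cps, Tm.rename, rename_ssubst, h1, h2]⟩

/-- Substitution into derivations commutes with the self-translation. -/
theorem Deriv.exists_psubst (R : CType) {Γ : List VType} {Δ : Option CType} {t : Tm} {A : VType}
    (d : Deriv Γ Δ t A) : ∀ {Γ' : List VType} {τ σ : ℕ → Tm}, (∀ n, StoupFree (σ n)) →
      (∀ n A, Γ[n]? = some A → ∃ e : Deriv Γ' none (τ n) A, cps R e = σ n) →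
      ∃ d' : Deriv Γ' Δ (t.psubst τ) A, cps R d' = (cps R d).psubst σ := by
  have lift_deriv : ∀ {Γ Γ' : List VType} {τ σ : ℕ → Tm} (B : VType),
      (∀ n A, Γ[n]? = some A → ∃ e : Deriv Γ' none (τ n) A, cps R e = σ n) →
      ∀ n A, (B :: Γ)[n]? = some A →
        ∃ e : Deriv (B :: Γ') none (liftS τ n) A, cps R e = liftS σ n := by
    intro Γ Γ' τ σ B h n A hn
    cases n with
    | zero => exact ⟨.var _ _ _ hn, rfl⟩
    | succ n =>
      obtain ⟨e, he⟩ := h n A hn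
      obtain ⟨e', he'⟩ := e.exists_rename R (isRen_succ Γ' B)
      exact ⟨e', he'.trans (congrArg (Tm.rename Nat.succ) he)⟩
  induction d with
  | var Γ n A hn => exact fun _ h => h n A hn
  | svar => exact fun _ _ => ⟨.svar _ _, rfl⟩
  | unit => exact fun _ _ => ⟨.unit _, rfl⟩
  | top => exact fun _ _ => ⟨.top _, rfl⟩
  | cunit Γ Δ => exact fun _ _ => ⟨.cunit _ _, by cases Δ <;> rfl⟩
  | vpair Γ t u A B d1 d2 ih1 ih2 =>
    intro Γ' τ σ hσ h
    obtain ⟨e1, h1e⟩ := ih1 hσ h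
    obtain ⟨e2, h2e⟩ := ih2 hσ h
    exact ⟨.vpair _ _ _ _ _ e1 e2, by simp [cps, psubst, h1e, h2e]⟩
  | vfst Γ t A B d ih =>
    intro Γ' τ σ hσ h
    obtain ⟨e, he⟩ := ih hσ h
    exact ⟨.vfst _ _ _ _ e, by simp [cps, psubst, he]⟩
  | vsnd Γ t A B d ih =>
    intro Γ' τ σ hσ h
    obtain ⟨e, he⟩ := ih hσ h
    exact ⟨.vsnd _ _ _ _ e, by simp [cps, psubst, he]⟩
  | vlam Γ t A B d ih =>
    intro Γ' τ σ hσ h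
    obtain ⟨e, he⟩ := ih (stoupFree_liftS hσ) (lift_deriv _ h)
    exact ⟨.vlam _ _ _ _ e, by simp [cps, psubst, he]⟩
  | vapp Γ s t A B d1 d2 ih1 ih2 =>
    intro Γ' τ σ hσ h
    obtain ⟨e1, h1e⟩ := ih1 hσ h
    obtain ⟨e2, h2e⟩ := ih2 hσ h
    exact ⟨.vapp _ _ _ _ _ e1 e2, by simp [cps, psubst, h1e, h2e]⟩
  | cpair Γ Δ t u A B d1 d2 ih1 ih2 =>
    intro Γ' τ σ hσ h
    obtain ⟨e1, h1e⟩ := ih1 hσ h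
    obtain ⟨e2, h2e⟩ := ih2 hσ h
    exact ⟨.cpair _ _ _ _ _ _ e1 e2, by cases Δ <;> simp [cps, psubst, h1e, h2e]⟩
  | cfst Γ Δ t A B d ih =>
    intro Γ' τ σ hσ h
    obtain ⟨e, he⟩ := ih hσ h
    exact ⟨.cfst _ _ _ _ _ e, by cases Δ <;> simp [cps, psubst, psubst_ssubst hσ, he]⟩
  | csnd Γ Δ t A B d ih =>
    intro Γ' τ σ hσ h
    obtain ⟨e, he⟩ := ih hσ h
    exact ⟨.csnd _ _ _ _ _ e, by cases Δ <;> simp [cps, psubst, psubst_ssubst hσ, he]⟩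
  | clam Γ Δ t A B d ih =>
    intro Γ' τ σ hσ h
    obtain ⟨e, he⟩ := ih (stoupFree_liftS hσ) (lift_deriv _ h)
    exact ⟨.clam _ _ _ _ _ e, by cases Δ <;> simp [cps, psubst, he]⟩
  | capp Γ Δ s t A B d1 d2 ih1 ih2 =>
    intro Γ' τ σ hσ h
    obtain ⟨e1, h1e⟩ := ih1 hσ h
    obtain ⟨e2, h2e⟩ := ih2 hσ h
    exact ⟨.capp _ _ _ _ _ _ e1 e2, by cases Δ <;> simp [cps, psubst, psubst_ssubst hσ, h1e, h2e]⟩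
  | ilet Γ Δ t u A d1 d2 ih1 ih2 =>
    intro Γ' τ σ hσ h
    obtain ⟨e1, h1e⟩ := ih1 hσ h
    obtain ⟨e2, h2e⟩ := ih2 hσ h
    exact ⟨.ilet _ _ _ _ _ e1 e2, by cases Δ <;> simp [cps, psubst, psubst_ssubst hσ, h1e, h2e]⟩
  | bang Γ t A d ih =>
    intro Γ' τ σ hσ h
    obtain ⟨e, he⟩ := ih hσ h
    exact ⟨.bang _ _ _ e, by simp [cps, psubst, he]⟩
  | banglet Γ Δ t u A B d1 d2 ih1 ih2 =>
    intro Γ' τ σ hσ h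
    obtain ⟨e1, h1e⟩ := ih1 hσ h
    obtain ⟨e2, h2e⟩ := ih2 (stoupFree_liftS hσ) (lift_deriv _ h)
    exact ⟨.banglet _ _ _ _ _ _ e1 e2, by cases Δ <;> simp [cps, psubst, psubst_ssubst hσ, h1e, h2e]⟩
  | copow Γ Δ t u A B d1 d2 ih1 ih2 =>
    intro Γ' τ σ hσ h
    obtain ⟨e1, h1e⟩ := ih1 hσ h
    obtain ⟨e2, h2e⟩ := ih2 hσ h
    exact ⟨.copow _ _ _ _ _ _ e1 e2, by cases Δ <;> simp [cps, psubst, psubst_ssubst hσ, h1e, h2e]⟩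
  | copowlet Γ Δ s t A B C d1 d2 ih1 ih2 =>
    intro Γ' τ σ hσ h
    obtain ⟨e1, h1e⟩ := ih1 hσ h
    obtain ⟨e2, h2e⟩ := ih2 (stoupFree_liftS hσ) (lift_deriv _ h)
    exact ⟨.copowlet _ _ _ _ _ _ _ e1 e2, by cases Δ <;> simp [cps, psubst, psubst_ssubst hσ, h1e, h2e]⟩
  | cimage Γ Δ t A d ih =>
    intro Γ' τ σ hσ h
    obtain ⟨e, he⟩ := ih hσ h
    exact ⟨.cimage _ _ _ _ e, by cases Δ <;> simp [cps, psubst, psubst_ssubst hσ, he]⟩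
  | cinl Γ Δ t A B d ih =>
    intro Γ' τ σ hσ h
    obtain ⟨e, he⟩ := ih hσ h
    exact ⟨.cinl _ _ _ _ _ e, by cases Δ <;> simp [cps, psubst, psubst_ssubst hσ, he]⟩
  | cinr Γ Δ t A B d ih =>
    intro Γ' τ σ hσ h
    obtain ⟨e, he⟩ := ih hσ h
    exact ⟨.cinr _ _ _ _ _ e, by cases Δ <;> simp [cps, psubst, psubst_ssubst hσ, he]⟩
  | ccase Γ Δ s t u A B C d1 d2 d3 ih1 ih2 ih3 =>
    intro Γ' τ σ hσ h
    obtain ⟨e1, h1e⟩ := ih1 hσ h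
    obtain ⟨e2, h2e⟩ := ih2 hσ h
    obtain ⟨e3, h3e⟩ := ih3 hσ h
    exact ⟨.ccase _ _ _ _ _ _ _ _ e1 e2 e3, by cases Δ <;> simp [cps, psubst, psubst_ssubst hσ, h1e, h2e, h3e]⟩
  | llam Γ t A B d ih =>
    intro Γ' τ σ hσ h
    obtain ⟨e, he⟩ := ih hσ h
    exact ⟨.llam _ _ _ _ e, by simp [cps, psubst, he]⟩
  | lapp Γ Δ s t A B d1 d2 ih1 ih2 =>
    intro Γ' τ σ hσ h
    obtain ⟨e1, h1e⟩ := ih1 hσ h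
    obtain ⟨e2, h2e⟩ := ih2 hσ h
    exact ⟨.lapp _ _ _ _ _ _ e1 e2, by cases Δ <;> simp [cps, psubst, psubst_ssubst hσ, h1e, h2e]⟩

namespace HasTy

variable {Γ : List VType} {Δ : Option CType} {s t u : Tm} {A B : VType} {X Y Z : CType}

theorem var {n : ℕ} (h : Γ[n]? = some A) : HasTy Γ none (.var n) A := ⟨.var _ _ _ h⟩

theorem svar : HasTy Γ (some X) .svar (.comp X) := ⟨.svar _ _⟩

theorem unit : HasTy Γ none .unit .unit := ⟨.unit _⟩

theorem vpair (h : HasTy Γ none t A) (h' : HasTy Γ none u B) :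
    HasTy Γ none (.vpair t u) (.prod A B) :=
  h.elim fun d => h'.map (.vpair _ _ _ _ _ d)

theorem vfst (h : HasTy Γ none t (.prod A B)) : HasTy Γ none (.vfst t) A :=
  h.map (.vfst _ _ _ _)

theorem vsnd (h : HasTy Γ none t (.prod A B)) : HasTy Γ none (.vsnd t) B :=
  h.map (.vsnd _ _ _ _)

theorem vlam (h : HasTy (A :: Γ) none t B) : HasTy Γ none (.vlam A t) (.arr A B) :=
  h.map (.vlam _ _ _ _)

theorem vapp (h : HasTy Γ none s (.arr A B)) (h' : HasTy Γ none t A) :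
    HasTy Γ none (.vapp s t) B :=
  h.elim fun d => h'.map (.vapp _ _ _ _ _ d)

theorem cunit : HasTy Γ Δ .cunit (.comp .cunit) := ⟨.cunit _ _⟩

theorem cpair (h : HasTy Γ Δ t (.comp X)) (h' : HasTy Γ Δ u (.comp Y)) :
    HasTy Γ Δ (.cpair t u) (.comp (.cand X Y)) :=
  h.elim fun d => h'.map (.cpair _ _ _ _ _ _ d)

theorem cfst (h : HasTy Γ Δ t (.comp (.cand X Y))) : HasTy Γ Δ (.cfst t) (.comp X) :=
  h.map (.cfst _ _ _ _ _)

theorem csnd (h : HasTy Γ Δ t (.comp (.cand X Y))) : HasTy Γ Δ (.csnd t) (.comp Y) :=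
  h.map (.csnd _ _ _ _ _)

theorem clam (h : HasTy (A :: Γ) Δ t (.comp X)) : HasTy Γ Δ (.clam A t) (.comp (.carr A X)) :=
  h.map (.clam _ _ _ _ _)

theorem capp (h : HasTy Γ Δ s (.comp (.carr A X))) (h' : HasTy Γ none t A) :
    HasTy Γ Δ (.capp s t) (.comp X) :=
  h.elim fun d => h'.map (.capp _ _ _ _ _ _ d)

theorem top : HasTy Γ none .top (.comp .iunit) := ⟨.top _⟩

theorem ilet (h : HasTy Γ Δ t (.comp .iunit)) (h' : HasTy Γ none u (.comp X)) :
    HasTy Γ Δ (.ilet t u) (.comp X) :=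
  h.elim fun d => h'.map (.ilet _ _ _ _ _ d)

theorem bang (h : HasTy Γ none t A) : HasTy Γ none (.bang t) (.comp (.bang A)) :=
  h.map (.bang _ _ _)

theorem banglet (h : HasTy Γ Δ t (.comp (.bang A))) (h' : HasTy (A :: Γ) none u (.comp X)) :
    HasTy Γ Δ (.banglet t u) (.comp X) :=
  h.elim fun d => h'.map (.banglet _ _ _ _ _ _ d)

theorem copow (h : HasTy Γ none t A) (h' : HasTy Γ Δ u (.comp X)) :
    HasTy Γ Δ (.copow t u) (.comp (.copow A X)) :=
  h.elim fun d => h'.map (.copow _ _ _ _ _ _ d)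

theorem copowlet (h : HasTy Γ Δ s (.comp (.copow A X)))
    (h' : HasTy (A :: Γ) (some X) t (.comp Y)) : HasTy Γ Δ (.copowlet s t) (.comp Y) :=
  h.elim fun d => h'.map (.copowlet _ _ _ _ _ _ _ d)

theorem cimage (h : HasTy Γ Δ t (.comp .czero)) : HasTy Γ Δ (.cimage X t) (.comp X) :=
  h.map (.cimage _ _ _ _)

theorem cinl (h : HasTy Γ Δ t (.comp X)) : HasTy Γ Δ (.cinl t) (.comp (.csum X Y)) :=
  h.map (.cinl _ _ _ _ _)

theorem cinr (h : HasTy Γ Δ t (.comp Y)) : HasTy Γ Δ (.cinr t) (.comp (.csum X Y)) :=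
  h.map (.cinr _ _ _ _ _)

theorem ccase (h : HasTy Γ Δ s (.comp (.csum X Y))) (h₁ : HasTy Γ (some X) t (.comp Z))
    (h₂ : HasTy Γ (some Y) u (.comp Z)) : HasTy Γ Δ (.ccase s t u) (.comp Z) :=
  h.elim fun d => h₁.elim fun d₁ => h₂.map (.ccase _ _ _ _ _ _ _ _ d d₁)

theorem llam (h : HasTy Γ (some X) t (.comp Y)) : HasTy Γ none (.llam X t) (.lin X Y) :=
  h.map (.llam _ _ _ _)

theorem lapp (h : HasTy Γ none s (.lin X Y)) (h' : HasTy Γ Δ t (.comp X)) :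
    HasTy Γ Δ (.lapp s t) (.comp Y) :=
  h.elim fun d => h'.map (.lapp _ _ _ _ _ _ d)

theorem stoupFree (h : HasTy Γ none t A) : StoupFree t := h.elim Deriv.stoupFree

theorem rename {Γ' : List VType} {f : ℕ → ℕ} (h : HasTy Γ Δ t A) (hf : IsRen f Γ Γ') :
    HasTy Γ' Δ (t.rename f) A :=
  h.elim fun d => ⟨(d.exists_rename .iunit hf).choose⟩

theorem shift (h : HasTy Γ Δ t A) : HasTy (B :: Γ) Δ t.shift A := h.rename (isRen_succ _ _)

end HasTy

/-- The substitution `σ` assigns terms over `Γ'` to the variables of `Γ`. -/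
def IsSub (σ : ℕ → Tm) (Γ Γ' : List VType) : Prop :=
  ∀ n A, Γ[n]? = some A → HasTy Γ' none (σ n) A

theorem isSub_var (Γ : List VType) : IsSub Tm.var Γ Γ := fun _ _ h => .var h

theorem IsSub.lift {σ : ℕ → Tm} {Γ Γ' : List VType} (h : IsSub σ Γ Γ') (A : VType) :
    IsSub (liftS σ) (A :: Γ) (A :: Γ') := by
  intro n B hn
  cases n with
  | zero => exact .var hn
  | succ n => exact (h n B hn).shift

theorem IsSub.scons {σ : ℕ → Tm} {Γ Γ' : List VType} (h : IsSub σ Γ Γ') {a : Tm} {A : VType}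
    (ha : HasTy Γ' none a A) : IsSub (scons a σ) (A :: Γ) Γ' := by
  intro n B hn
  cases n with
  | zero => cases hn; exact ha
  | succ n => exact h n B hn

theorem Deriv.hasTy_psubst {Γ : List VType} {Δ : Option CType} {t : Tm} {A : VType}
    (d : Deriv Γ Δ t A) :
    ∀ {Γ' : List VType} {σ : ℕ → Tm}, IsSub σ Γ Γ' → HasTy Γ' Δ (t.psubst σ) A := by
  induction d with
  | var Γ n A h => exact fun hσ => hσ n A h
  | svar => exact fun _ => .svar
  | unit => exact fun _ => .unit
  | vpair _ _ _ _ _ _ _ ih ih' => exact fun hσ => .vpair (ih hσ) (ih' hσ)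
  | vfst _ _ _ _ _ ih => exact fun hσ => .vfst (ih hσ)
  | vsnd _ _ _ _ _ ih => exact fun hσ => .vsnd (ih hσ)
  | vlam _ _ _ _ _ ih => exact fun hσ => .vlam (ih (hσ.lift _))
  | vapp _ _ _ _ _ _ _ ih ih' => exact fun hσ => .vapp (ih hσ) (ih' hσ)
  | cunit => exact fun _ => .cunit
  | cpair _ _ _ _ _ _ _ _ ih ih' => exact fun hσ => .cpair (ih hσ) (ih' hσ)
  | cfst _ _ _ _ _ _ ih => exact fun hσ => .cfst (ih hσ)
  | csnd _ _ _ _ _ _ ih => exact fun hσ => .csnd (ih hσ)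
  | clam _ _ _ _ _ _ ih => exact fun hσ => .clam (ih (hσ.lift _))
  | capp _ _ _ _ _ _ _ _ ih ih' => exact fun hσ => .capp (ih hσ) (ih' hσ)
  | top => exact fun _ => .top
  | ilet _ _ _ _ _ _ _ ih ih' => exact fun hσ => .ilet (ih hσ) (ih' hσ)
  | bang _ _ _ _ ih => exact fun hσ => .bang (ih hσ)
  | banglet _ _ _ _ _ _ _ _ ih ih' => exact fun hσ => .banglet (ih hσ) (ih' (hσ.lift _))
  | copow _ _ _ _ _ _ _ _ ih ih' => exact fun hσ => .copow (ih hσ) (ih' hσ)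
  | copowlet _ _ _ _ _ _ _ _ _ ih ih' => exact fun hσ => .copowlet (ih hσ) (ih' (hσ.lift _))
  | cimage _ _ _ _ _ ih => exact fun hσ => .cimage (ih hσ)
  | cinl _ _ _ _ _ _ ih => exact fun hσ => .cinl (ih hσ)
  | cinr _ _ _ _ _ _ ih => exact fun hσ => .cinr (ih hσ)
  | ccase _ _ _ _ _ _ _ _ _ _ _ ih₁ ih₂ ih₃ => exact fun hσ => .ccase (ih₁ hσ) (ih₂ hσ) (ih₃ hσ)
  | llam _ _ _ _ _ ih => exact fun hσ => .llam (ih hσ)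
  | lapp _ _ _ _ _ _ _ _ ih ih' => exact fun hσ => .lapp (ih hσ) (ih' hσ)

theorem HasTy.psubst {Γ Γ' : List VType} {Δ : Option CType} {t : Tm} {A : VType} {σ : ℕ → Tm}
    (h : HasTy Γ Δ t A) (hσ : IsSub σ Γ Γ') : HasTy Γ' Δ (t.psubst σ) A :=
  h.elim fun d => d.hasTy_psubst hσ

theorem HasTy.subst0 {Γ : List VType} {Δ : Option CType} {t u : Tm} {A B : VType}
    (h : HasTy (A :: Γ) Δ t B) (hu : HasTy Γ none u A) : HasTy Γ Δ (Tm.subst0 u t) B := by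
  rw [subst0_eq_psubst]
  exact h.psubst ((isSub_var Γ).scons hu)

theorem Deriv.hasTy_ssubst {Γ : List VType} {Δ₀ : Option CType} {t : Tm} {B : VType}
    (d : Deriv Γ Δ₀ t B) : ∀ {Δ : Option CType} {s : Tm} {X : CType}, Δ₀ = some X →
      HasTy Γ Δ s (.comp X) → HasTy Γ Δ (ssubst s t) B := by
  induction d with
  | var | unit | vpair | vfst | vsnd | vlam | vapp | top | bang | llam =>
    intro _ _ _ h; cases h
  | svar => intro _ _ _ h hs; cases h; exact hs
  | cunit => exact fun _ _ => .cunit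
  | cpair _ _ _ _ _ _ _ _ ih ih' => exact fun h hs => .cpair (ih h hs) (ih' h hs)
  | cfst _ _ _ _ _ _ ih => exact fun h hs => .cfst (ih h hs)
  | csnd _ _ _ _ _ _ ih => exact fun h hs => .csnd (ih h hs)
  | clam _ _ _ _ _ _ ih => exact fun h hs => .clam (ih h hs.shift)
  | capp _ _ _ _ _ _ _ d' ih =>
    exact fun h hs => .capp (ih h hs) ((d'.stoupFree.ssubst_eq _).symm ▸ ⟨d'⟩)
  | ilet _ _ _ _ _ _ d' ih =>
    exact fun h hs => .ilet (ih h hs) ((d'.stoupFree.ssubst_eq _).symm ▸ ⟨d'⟩)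
  | banglet _ _ _ _ _ _ _ d' ih =>
    exact fun h hs => .banglet (ih h hs) ((d'.stoupFree.ssubst_eq _).symm ▸ ⟨d'⟩)
  | copow _ _ _ _ _ _ d' _ _ ih =>
    exact fun h hs => .copow ((d'.stoupFree.ssubst_eq _).symm ▸ ⟨d'⟩) (ih h hs)
  | copowlet _ _ _ _ _ _ _ _ d' ih => exact fun h hs => .copowlet (ih h hs) ⟨d'⟩
  | cimage _ _ _ _ _ ih => exact fun h hs => .cimage (ih h hs)
  | cinl _ _ _ _ _ _ ih => exact fun h hs => .cinl (ih h hs)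
  | cinr _ _ _ _ _ _ ih => exact fun h hs => .cinr (ih h hs)
  | ccase _ _ _ _ _ _ _ _ _ d₁ d₂ ih => exact fun h hs => .ccase (ih h hs) ⟨d₁⟩ ⟨d₂⟩
  | lapp _ _ _ _ _ _ d' _ _ ih =>
    exact fun h hs => .lapp ((d'.stoupFree.ssubst_eq _).symm ▸ ⟨d'⟩) (ih h hs)

theorem HasTy.ssubst {Γ : List VType} {Δ : Option CType} {s t : Tm} {B : VType} {X : CType}
    (h : HasTy Γ (some X) t B) (hs : HasTy Γ Δ s (.comp X)) : HasTy Γ Δ (ssubst s t) B :=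
  h.elim fun d => d.hasTy_ssubst rfl hs

/-- Provable equality only relates terms of the type at which it is stated. -/
theorem EEq.hasTy {Γ : List VType} {Δ : Option CType} {t u : Tm} {A : VType}
    (h : EEq Γ Δ t u A) : HasTy Γ Δ t A ∧ HasTy Γ Δ u A := by
  induction h with
  | refl d => exact ⟨⟨d⟩, ⟨d⟩⟩
  | symm _ ih => exact ih.symm
  | trans _ _ ih ih' => exact ⟨ih.1, ih'.2⟩
  | vpair_cong _ _ ih ih' => exact ⟨.vpair ih.1 ih'.1, .vpair ih.2 ih'.2⟩
  | vfst_cong _ ih => exact ⟨.vfst ih.1, .vfst ih.2⟩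
  | vsnd_cong _ ih => exact ⟨.vsnd ih.1, .vsnd ih.2⟩
  | vlam_cong _ ih => exact ⟨.vlam ih.1, .vlam ih.2⟩
  | vapp_cong _ _ ih ih' => exact ⟨.vapp ih.1 ih'.1, .vapp ih.2 ih'.2⟩
  | cpair_cong _ _ ih ih' => exact ⟨.cpair ih.1 ih'.1, .cpair ih.2 ih'.2⟩
  | cfst_cong _ ih => exact ⟨.cfst ih.1, .cfst ih.2⟩
  | csnd_cong _ ih => exact ⟨.csnd ih.1, .csnd ih.2⟩
  | clam_cong _ ih => exact ⟨.clam ih.1, .clam ih.2⟩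
  | capp_cong _ _ ih ih' => exact ⟨.capp ih.1 ih'.1, .capp ih.2 ih'.2⟩
  | ilet_cong _ _ ih ih' => exact ⟨.ilet ih.1 ih'.1, .ilet ih.2 ih'.2⟩
  | bang_cong _ ih => exact ⟨.bang ih.1, .bang ih.2⟩
  | banglet_cong _ _ ih ih' => exact ⟨.banglet ih.1 ih'.1, .banglet ih.2 ih'.2⟩
  | copow_cong _ _ ih ih' => exact ⟨.copow ih.1 ih'.1, .copow ih.2 ih'.2⟩
  | copowlet_cong _ _ ih ih' => exact ⟨.copowlet ih.1 ih'.1, .copowlet ih.2 ih'.2⟩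
  | cimage_cong _ ih => exact ⟨.cimage ih.1, .cimage ih.2⟩
  | cinl_cong _ ih => exact ⟨.cinl ih.1, .cinl ih.2⟩
  | cinr_cong _ ih => exact ⟨.cinr ih.1, .cinr ih.2⟩
  | ccase_cong _ _ _ ih₁ ih₂ ih₃ => exact ⟨.ccase ih₁.1 ih₂.1 ih₃.1, .ccase ih₁.2 ih₂.2 ih₃.2⟩
  | llam_cong _ ih => exact ⟨.llam ih.1, .llam ih.2⟩
  | lapp_cong _ _ ih ih' => exact ⟨.lapp ih.1 ih'.1, .lapp ih.2 ih'.2⟩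
  | unit_eta d => exact ⟨⟨d⟩, .unit⟩
  | vfst_beta d d' => exact ⟨.vfst (.vpair ⟨d⟩ ⟨d'⟩), ⟨d⟩⟩
  | vsnd_beta d d' => exact ⟨.vsnd (.vpair ⟨d⟩ ⟨d'⟩), ⟨d'⟩⟩
  | vpair_eta d => exact ⟨.vpair (.vfst ⟨d⟩) (.vsnd ⟨d⟩), ⟨d⟩⟩
  | vlam_beta d d' => exact ⟨.vapp (.vlam ⟨d⟩) ⟨d'⟩, .subst0 ⟨d⟩ ⟨d'⟩⟩
  | vlam_eta d => exact ⟨.vlam (.vapp (.shift ⟨d⟩) (.var rfl)), ⟨d⟩⟩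
  | cunit_eta d => exact ⟨⟨d⟩, .cunit⟩
  | cfst_beta d d' => exact ⟨.cfst (.cpair ⟨d⟩ ⟨d'⟩), ⟨d⟩⟩
  | csnd_beta d d' => exact ⟨.csnd (.cpair ⟨d⟩ ⟨d'⟩), ⟨d'⟩⟩
  | cpair_eta d => exact ⟨.cpair (.cfst ⟨d⟩) (.csnd ⟨d⟩), ⟨d⟩⟩
  | clam_beta d d' => exact ⟨.capp (.clam ⟨d⟩) ⟨d'⟩, .subst0 ⟨d⟩ ⟨d'⟩⟩
  | clam_eta d => exact ⟨.clam (.capp (.shift ⟨d⟩) (.var rfl)), ⟨d⟩⟩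
  | ilet_beta d => exact ⟨.ilet .top ⟨d⟩, ⟨d⟩⟩
  | ilet_eta d d' => exact ⟨.ilet ⟨d⟩ (.ssubst ⟨d'⟩ .top), .ssubst ⟨d'⟩ ⟨d⟩⟩
  | bang_beta d d' => exact ⟨.banglet (.bang ⟨d⟩) ⟨d'⟩, .subst0 ⟨d'⟩ ⟨d⟩⟩
  | bang_eta d d' =>
    exact ⟨.banglet ⟨d⟩ (.ssubst (.shift ⟨d'⟩) (.bang (.var rfl))), .ssubst ⟨d'⟩ ⟨d⟩⟩
  | copow_beta d d' e =>
    exact ⟨.copowlet (.copow ⟨d⟩ ⟨d'⟩) ⟨e⟩, .ssubst (.subst0 ⟨e⟩ ⟨d⟩) ⟨d'⟩⟩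
  | copow_eta d d' =>
    exact ⟨.copowlet ⟨d⟩ (.ssubst (.shift ⟨d'⟩) (.copow (.var rfl) .svar)), .ssubst ⟨d'⟩ ⟨d⟩⟩
  | czero_eta d d' => exact ⟨.cimage ⟨d⟩, .ssubst ⟨d'⟩ ⟨d⟩⟩
  | csum_beta_inl d d' e => exact ⟨.ccase (.cinl ⟨e⟩) ⟨d⟩ ⟨d'⟩, .ssubst ⟨d⟩ ⟨e⟩⟩
  | csum_beta_inr d d' e => exact ⟨.ccase (.cinr ⟨e⟩) ⟨d⟩ ⟨d'⟩, .ssubst ⟨d'⟩ ⟨e⟩⟩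
  | csum_eta d d' =>
    exact ⟨.ccase ⟨d⟩ (.ssubst ⟨d'⟩ (.cinl .svar)) (.ssubst ⟨d'⟩ (.cinr .svar)), .ssubst ⟨d'⟩ ⟨d⟩⟩
  | llam_beta d d' => exact ⟨.lapp (.llam ⟨d⟩) ⟨d'⟩, .ssubst ⟨d⟩ ⟨d'⟩⟩
  | llam_eta d => exact ⟨.llam (.lapp ⟨d⟩ .svar), ⟨d⟩⟩

theorem Deriv.hasTy_rename {Γ Γ' : List VType} {Δ : Option CType} {t : Tm} {A : VType}
    {f : ℕ → ℕ} (d : Deriv Γ Δ t A) (hf : IsRen f Γ Γ') : HasTy Γ' Δ (t.rename f) A :=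
  HasTy.rename ⟨d⟩ hf

/-- Provable equality is stable under weakening. -/
theorem EEq.rename {Γ : List VType} {Δ : Option CType} {t u : Tm} {A : VType}
    (h : EEq Γ Δ t u A) : ∀ {Γ' : List VType} {f : ℕ → ℕ}, IsRen f Γ Γ' →
      EEq Γ' Δ (t.rename f) (u.rename f) A := by
  induction h with
  | refl d => exact fun hf => (d.hasTy_rename hf).elim .refl
  | symm _ ih => exact fun hf => .symm (ih hf)
  | trans _ _ ih ih' => exact fun hf => .trans (ih hf) (ih' hf)
  | vpair_cong _ _ ih ih' => exact fun hf => .vpair_cong (ih hf) (ih' hf)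
  | vfst_cong _ ih => exact fun hf => .vfst_cong (ih hf)
  | vsnd_cong _ ih => exact fun hf => .vsnd_cong (ih hf)
  | vlam_cong _ ih => exact fun hf => .vlam_cong (ih (hf.lift _))
  | vapp_cong _ _ ih ih' => exact fun hf => .vapp_cong (ih hf) (ih' hf)
  | cpair_cong _ _ ih ih' => exact fun hf => .cpair_cong (ih hf) (ih' hf)
  | cfst_cong _ ih => exact fun hf => .cfst_cong (ih hf)
  | csnd_cong _ ih => exact fun hf => .csnd_cong (ih hf)
  | clam_cong _ ih => exact fun hf => .clam_cong (ih (hf.lift _))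
  | capp_cong _ _ ih ih' => exact fun hf => .capp_cong (ih hf) (ih' hf)
  | ilet_cong _ _ ih ih' => exact fun hf => .ilet_cong (ih hf) (ih' hf)
  | bang_cong _ ih => exact fun hf => .bang_cong (ih hf)
  | banglet_cong _ _ ih ih' => exact fun hf => .banglet_cong (ih hf) (ih' (hf.lift _))
  | copow_cong _ _ ih ih' => exact fun hf => .copow_cong (ih hf) (ih' hf)
  | copowlet_cong _ _ ih ih' => exact fun hf => .copowlet_cong (ih hf) (ih' (hf.lift _))
  | cimage_cong _ ih => exact fun hf => .cimage_cong (ih hf)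
  | cinl_cong _ ih => exact fun hf => .cinl_cong (ih hf)
  | cinr_cong _ ih => exact fun hf => .cinr_cong (ih hf)
  | ccase_cong _ _ _ ih₁ ih₂ ih₃ => exact fun hf => .ccase_cong (ih₁ hf) (ih₂ hf) (ih₃ hf)
  | llam_cong _ ih => exact fun hf => .llam_cong (ih hf)
  | lapp_cong _ _ ih ih' => exact fun hf => .lapp_cong (ih hf) (ih' hf)
  | unit_eta d => exact fun hf => (d.hasTy_rename hf).elim .unit_eta
  | vfst_beta d d' =>
    exact fun hf => (d.hasTy_rename hf).elim fun e => (d'.hasTy_rename hf).elim (.vfst_beta e)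
  | vsnd_beta d d' =>
    exact fun hf => (d.hasTy_rename hf).elim fun e => (d'.hasTy_rename hf).elim (.vsnd_beta e)
  | vpair_eta d => exact fun hf => (d.hasTy_rename hf).elim .vpair_eta
  | vlam_beta d d' =>
    intro _ f hf
    rw [rename_subst0]
    exact (d.hasTy_rename (hf.lift _)).elim fun e => (d'.hasTy_rename hf).elim (.vlam_beta e)
  | vlam_eta d =>
    intro _ f hf
    simp only [Tm.rename, rename_shift]
    exact (d.hasTy_rename hf).elim .vlam_eta
  | cunit_eta d => exact fun hf => (d.hasTy_rename hf).elim .cunit_eta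
  | cfst_beta d d' =>
    exact fun hf => (d.hasTy_rename hf).elim fun e => (d'.hasTy_rename hf).elim (.cfst_beta e)
  | csnd_beta d d' =>
    exact fun hf => (d.hasTy_rename hf).elim fun e => (d'.hasTy_rename hf).elim (.csnd_beta e)
  | cpair_eta d => exact fun hf => (d.hasTy_rename hf).elim .cpair_eta
  | clam_beta d d' =>
    intro _ f hf
    rw [rename_subst0]
    exact (d.hasTy_rename (hf.lift _)).elim fun e => (d'.hasTy_rename hf).elim (.clam_beta e)
  | clam_eta d =>
    intro _ f hf
    simp only [Tm.rename, rename_shift]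
    exact (d.hasTy_rename hf).elim .clam_eta
  | ilet_beta d => exact fun hf => (d.hasTy_rename hf).elim .ilet_beta
  | ilet_eta d d' =>
    intro _ f hf
    simp only [Tm.rename, rename_ssubst]
    exact (d.hasTy_rename hf).elim fun e => (d'.hasTy_rename hf).elim (.ilet_eta e)
  | bang_beta d d' =>
    intro _ f hf
    rw [rename_subst0]
    exact (d.hasTy_rename hf).elim fun e => (d'.hasTy_rename (hf.lift _)).elim (.bang_beta e)
  | bang_eta d d' =>
    intro _ f hf
    simp only [Tm.rename, rename_ssubst, rename_shift]
    exact (d.hasTy_rename hf).elim fun e => (d'.hasTy_rename hf).elim (.bang_eta e)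
  | copow_beta d d' c =>
    intro _ f hf
    simp only [Tm.rename, rename_ssubst, rename_subst0]
    exact (d.hasTy_rename hf).elim fun e => (d'.hasTy_rename hf).elim fun e' =>
      (c.hasTy_rename (hf.lift _)).elim (.copow_beta e e')
  | copow_eta d d' =>
    intro _ f hf
    simp only [Tm.rename, rename_ssubst, rename_shift]
    exact (d.hasTy_rename hf).elim fun e => (d'.hasTy_rename hf).elim (.copow_eta e)
  | czero_eta d d' =>
    intro _ f hf
    simp only [Tm.rename, rename_ssubst]
    exact (d.hasTy_rename hf).elim fun e => (d'.hasTy_rename hf).elim (.czero_eta e)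
  | csum_beta_inl d d' c =>
    intro _ f hf
    simp only [Tm.rename, rename_ssubst]
    exact (d.hasTy_rename hf).elim fun e => (d'.hasTy_rename hf).elim fun e' =>
      (c.hasTy_rename hf).elim (.csum_beta_inl e e')
  | csum_beta_inr d d' c =>
    intro _ f hf
    simp only [Tm.rename, rename_ssubst]
    exact (d.hasTy_rename hf).elim fun e => (d'.hasTy_rename hf).elim fun e' =>
      (c.hasTy_rename hf).elim (.csum_beta_inr e e')
  | csum_eta d d' =>
    intro _ f hf
    simp only [Tm.rename, rename_ssubst]
    exact (d.hasTy_rename hf).elim fun e => (d'.hasTy_rename hf).elim (.csum_eta e)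
  | llam_beta d d' =>
    intro _ f hf
    simp only [Tm.rename, rename_ssubst]
    exact (d.hasTy_rename hf).elim fun e => (d'.hasTy_rename hf).elim (.llam_beta e)
  | llam_eta d => exact fun hf => (d.hasTy_rename hf).elim .llam_eta

section

variable {Γ : List VType} {Δ : Option CType} {s s' t t' u u' : Tm} {A B : VType} {X Y Z : CType}

theorem HasTy.eeq (h : HasTy Γ Δ t A) : EEq Γ Δ t t A := h.elim .refl

theorem eeq_lapp_llam (h : HasTy Γ (some X) t (.comp Y)) (hu : HasTy Γ Δ u (.comp X)) :
    EEq Γ Δ (.lapp (.llam X t) u) (ssubst u t) (.comp Y) :=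
  h.elim fun d => hu.elim (.llam_beta d)

theorem eeq_llam_eta (h : HasTy Γ none t (.lin X Y)) :
    EEq Γ none (.llam X (.lapp t .svar)) t (.lin X Y) := h.elim .llam_eta

/-- Extensionality for linear functions. -/
theorem eeq_of_lapp_svar (ht : HasTy Γ none t (.lin X Y)) (hu : HasTy Γ none u (.lin X Y))
    (h : EEq Γ (some X) (.lapp t .svar) (.lapp u .svar) (.comp Y)) : EEq Γ none t u (.lin X Y) :=
  (eeq_llam_eta ht).symm.trans ((EEq.llam_cong h).trans (eeq_llam_eta hu))

theorem eeq_vapp_vlam (h : HasTy (A :: Γ) none t B) (hu : HasTy Γ none u A) :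
    EEq Γ none (.vapp (.vlam A t) u) (subst0 u t) B :=
  h.elim fun d => hu.elim (.vlam_beta d)

theorem eeq_capp_clam (h : HasTy (A :: Γ) Δ t (.comp X)) (hu : HasTy Γ none u A) :
    EEq Γ Δ (.capp (.clam A t) u) (subst0 u t) (.comp X) :=
  h.elim fun d => hu.elim (.clam_beta d)

/-- Extensionality for functions between value types. -/
theorem eeq_of_vapp_var (ht : HasTy Γ none t (.arr A B)) (hu : HasTy Γ none u (.arr A B))
    (h : EEq (A :: Γ) none (.vapp t.shift (.var 0)) (.vapp u.shift (.var 0)) B) :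
    EEq Γ none t u (.arr A B) :=
  (ht.elim EEq.vlam_eta).symm.trans ((EEq.vlam_cong h).trans (hu.elim .vlam_eta))

/-- Extensionality for functions from a value type to a computation type. -/
theorem eeq_of_capp_var (ht : HasTy Γ Δ t (.comp (.carr A X)))
    (hu : HasTy Γ Δ u (.comp (.carr A X)))
    (h : EEq (A :: Γ) Δ (.capp t.shift (.var 0)) (.capp u.shift (.var 0)) (.comp X)) :
    EEq Γ Δ t u (.comp (.carr A X)) :=
  (ht.elim EEq.clam_eta).symm.trans ((EEq.clam_cong h).trans (hu.elim .clam_eta))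

theorem eeq_of_cproj (ht : HasTy Γ Δ t (.comp (.cand X Y))) (hu : HasTy Γ Δ u (.comp (.cand X Y)))
    (h : EEq Γ Δ (.cfst t) (.cfst u) (.comp X)) (h' : EEq Γ Δ (.csnd t) (.csnd u) (.comp Y)) :
    EEq Γ Δ t u (.comp (.cand X Y)) :=
  (ht.elim EEq.cpair_eta).symm.trans ((EEq.cpair_cong h h').trans (hu.elim .cpair_eta))

theorem eeq_of_vproj (ht : HasTy Γ none t (.prod A B)) (hu : HasTy Γ none u (.prod A B))
    (h : EEq Γ none (.vfst t) (.vfst u) A) (h' : EEq Γ none (.vsnd t) (.vsnd u) B) :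
    EEq Γ none t u (.prod A B) :=
  (ht.elim EEq.vpair_eta).symm.trans ((EEq.vpair_cong h h').trans (hu.elim .vpair_eta))

theorem ssubst_lapp_stoupFree (h : StoupFree t) (s u : Tm) :
    Tm.ssubst s (.lapp t u) = .lapp t (Tm.ssubst s u) := by
  simp [Tm.ssubst, h.ssubst_eq]

/-- A linear function out of the zero type is the canonical one. -/
theorem eeq_lapp_czero (hK : HasTy Γ none t (.lin .czero Y)) (hu : HasTy Γ Δ u (.comp .czero)) :
    EEq Γ Δ (.lapp t u) (.cimage Y u) (.comp Y) := by
  have h : HasTy Γ (some .czero) (.lapp t .svar) (.comp Y) := .lapp hK .svar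
  have key := hu.elim fun d => h.elim (EEq.czero_eta d)
  rw [ssubst_lapp_stoupFree hK.stoupFree] at key
  exact key.symm

/-- Two linear functions out of a sum agree if they agree on both injections. -/
theorem eeq_of_cinj (ht : HasTy Γ none t (.lin (.csum X Y) Z))
    (hu : HasTy Γ none u (.lin (.csum X Y) Z))
    (h : EEq Γ (some X) (.lapp t (.cinl .svar)) (.lapp u (.cinl .svar)) (.comp Z))
    (h' : EEq Γ (some Y) (.lapp t (.cinr .svar)) (.lapp u (.cinr .svar)) (.comp Z)) :
    EEq Γ none t u (.lin (.csum X Y) Z) := by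
  have eta : ∀ {r : Tm}, HasTy Γ none r (.lin (.csum X Y) Z) →
      EEq Γ (some (.csum X Y)) (.ccase .svar (.lapp r (.cinl .svar)) (.lapp r (.cinr .svar)))
        (.lapp r .svar) (.comp Z) := by
    intro r hr
    have key := (HasTy.lapp hr .svar).elim (EEq.csum_eta (.svar Γ (.csum X Y)))
    simpa only [Tm.ssubst, hr.stoupFree.ssubst_eq] using key
  exact eeq_of_lapp_svar ht hu ((eta ht).symm.trans
    ((EEq.ccase_cong (.refl (.svar _ _)) h h').trans (eta hu)))

/-- Two linear functions out of a copower agree if they agree on its generators. -/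
theorem eeq_of_copow (ht : HasTy Γ none t (.lin (.copow A Y) Z))
    (hu : HasTy Γ none u (.lin (.copow A Y) Z))
    (h : EEq (A :: Γ) (some Y) (.lapp t.shift (.copow (.var 0) .svar))
      (.lapp u.shift (.copow (.var 0) .svar)) (.comp Z)) :
    EEq Γ none t u (.lin (.copow A Y) Z) := by
  have eta : ∀ {r : Tm}, HasTy Γ none r (.lin (.copow A Y) Z) →
      EEq Γ (some (.copow A Y)) (.copowlet .svar (.lapp r.shift (.copow (.var 0) .svar)))
        (.lapp r .svar) (.comp Z) := by
    intro r hr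
    have key := (HasTy.lapp hr .svar).elim (EEq.copow_eta (.svar Γ (.copow A Y)))
    rw [ssubst_lapp_stoupFree hr.stoupFree] at key
    have hs : Tm.shift (.lapp r .svar) = .lapp r.shift .svar := rfl
    rw [hs, ssubst_lapp_stoupFree (HasTy.shift (B := A) hr).stoupFree] at key
    exact key
  exact eeq_of_lapp_svar ht hu ((eta ht).symm.trans
    ((EEq.copowlet_cong (.refl (.svar _ _)) h).trans (eta hu)))

end

/-- Relations between pairs of linear terms with a common codomain. -/
abbrev TestRel := List VType → CType → Tm → Tm → Prop

/-- Typed stoup terms that are identified by all pairs of linear tests related by `P`. -/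
def lrel (P : TestRel) (A A' : CType) : TestRel := fun Γ X f f' =>
  HasTy Γ (some X) f (.comp A) ∧ HasTy Γ (some X) f' (.comp A') ∧
  ∀ Γ₂ ρ, IsRen ρ Γ Γ₂ → ∀ T K K', HasTy Γ₂ none K (.lin A T) → HasTy Γ₂ none K' (.lin A' T) →
    P Γ₂ T K K' →
    EEq Γ₂ (some X) (.lapp K (f.rename ρ)) (.lapp K' (f'.rename ρ)) (.comp T)

/-- A relation between values together with the types of its arguments. -/
def vrel (P : List VType → Tm → Tm → Prop) (A A' : VType) : List VType → Tm → Tm → Prop :=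
  fun Γ a a' => HasTy Γ none a A ∧ HasTy Γ none a' A' ∧ P Γ a a'

mutual
  /-- The logical relation between translated values of two value types. -/
  def relV (R : CType) : VType → VType → List VType → Tm → Tm → Prop
    | .base a, .base b => fun Γ t t' => a = b ∧ EEq Γ none t t' (.base a)
    | .unit, .unit => fun _ _ _ => True
    | .prod A B, .prod A' B' => fun Γ t t' =>
        relV R A A' Γ (.vfst t) (.vfst t') ∧ relV R B B' Γ (.vsnd t) (.vsnd t')
    | .arr A B, .arr A' B' => fun Γ t t' =>
        ∀ Γ₂ ρ, IsRen ρ Γ Γ₂ → ∀ a a',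
          vrel (relV R A A') (cpsV R A) (cpsV R A') Γ₂ a a' →
          relV R B B' Γ₂ (.vapp (t.rename ρ) a) (.vapp (t'.rename ρ) a')
    | .comp A, .comp A' => fun Γ t t' =>
        ∀ Γ₂ ρ, IsRen ρ Γ Γ₂ → ∀ X f f',
          lrel (testC R A A') (cpsC R A) (cpsC R A') Γ₂ X f f' →
          EEq Γ₂ (some X) (.lapp (t.rename ρ) f) (.lapp (t'.rename ρ) f') (.comp R)
    | .lin A B, .lin A' B' => fun Γ t t' =>
        ∀ Γ₂ ρ, IsRen ρ Γ Γ₂ → ∀ X f f',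
          lrel (testC R B B') (cpsC R B) (cpsC R B') Γ₂ X f f' →
          lrel (testC R A A') (cpsC R A) (cpsC R A') Γ₂ X
            (.lapp (t.rename ρ) f) (.lapp (t'.rename ρ) f')
    | _, _ => fun _ _ _ => False
  /-- Related tests on the translations of two computation types. -/
  def testC (R : CType) : CType → CType → TestRel
    | .base a, .base b => fun _ T K K' =>
        a = b ∧ T = cpsC R (.base a) ∧ K = .llam T .svar ∧ K' = .llam T .svar
    | .cunit, .cunit => fun _ _ _ _ => True
    | .cand A B, .cand A' B' => fun Γ T K K' =>
        ∀ Γ₂ ρ, IsRen ρ Γ Γ₂ → ∀ X f f',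
          (lrel (testC R A A') (cpsC R A) (cpsC R A') Γ₂ X f f' →
            EEq Γ₂ (some X) (.lapp (K.rename ρ) (.cinl f)) (.lapp (K'.rename ρ) (.cinl f'))
              (.comp T)) ∧
          (lrel (testC R B B') (cpsC R B) (cpsC R B') Γ₂ X f f' →
            EEq Γ₂ (some X) (.lapp (K.rename ρ) (.cinr f)) (.lapp (K'.rename ρ) (.cinr f'))
              (.comp T))
    | .carr A B, .carr A' B' => fun Γ T K K' =>
        ∀ Γ₂ ρ, IsRen ρ Γ Γ₂ → ∀ a a' X f f',
          vrel (relV R A A') (cpsV R A) (cpsV R A') Γ₂ a a' →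
          lrel (testC R B B') (cpsC R B) (cpsC R B') Γ₂ X f f' →
          EEq Γ₂ (some X) (.lapp (K.rename ρ) (.copow a f)) (.lapp (K'.rename ρ) (.copow a' f'))
            (.comp T)
    | .iunit, .iunit => fun _ T K K' => T = R ∧ K = .llam R .svar ∧ K' = .llam R .svar
    | .bang A, .bang A' => fun Γ T K K' =>
        ∃ a a', vrel (relV R A A') (cpsV R A) (cpsV R A') Γ a a' ∧ T = R ∧
          K = .llam (.carr (cpsV R A) R) (.capp .svar a) ∧
          K' = .llam (.carr (cpsV R A') R) (.capp .svar a')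
    | .copow A B, .copow A' B' => fun Γ T K K' =>
        ∃ a a' L L', vrel (relV R A A') (cpsV R A) (cpsV R A') Γ a a' ∧
          HasTy Γ none L (.lin (cpsC R B) T) ∧ HasTy Γ none L' (.lin (cpsC R B') T) ∧
          testC R B B' Γ T L L' ∧
          K = .llam (.carr (cpsV R A) (cpsC R B)) (.lapp L (.capp .svar a)) ∧
          K' = .llam (.carr (cpsV R A') (cpsC R B')) (.lapp L' (.capp .svar a'))
    | .csum A B, .csum A' B' => fun Γ T K K' =>
        (∃ L L', HasTy Γ none L (.lin (cpsC R A) T) ∧ HasTy Γ none L' (.lin (cpsC R A') T) ∧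
          testC R A A' Γ T L L' ∧
          K = .llam (.cand (cpsC R A) (cpsC R B)) (.lapp L (.cfst .svar)) ∧
          K' = .llam (.cand (cpsC R A') (cpsC R B')) (.lapp L' (.cfst .svar))) ∨
        (∃ L L', HasTy Γ none L (.lin (cpsC R B) T) ∧ HasTy Γ none L' (.lin (cpsC R B') T) ∧
          testC R B B' Γ T L L' ∧
          K = .llam (.cand (cpsC R A) (cpsC R B)) (.lapp L (.csnd .svar)) ∧
          K' = .llam (.cand (cpsC R A') (cpsC R B')) (.lapp L' (.csnd .svar)))
    | _, _ => fun _ _ _ _ => False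
end

/-- Typed related values. -/
abbrev ValRel (R : CType) (A B : VType) : List VType → Tm → Tm → Prop :=
  vrel (relV R A B) (cpsV R A) (cpsV R B)

/-- Typed related continuations. -/
abbrev StoupRel (R : CType) (A A' : CType) : TestRel :=
  lrel (testC R A A') (cpsC R A) (cpsC R A')

theorem lrel.rename {P : TestRel} {A A' X : CType} {Γ Γ' : List VType} {f f' : Tm} {ρ : ℕ → ℕ}
    (h : lrel P A A' Γ X f f') (hρ : IsRen ρ Γ Γ') :
    lrel P A A' Γ' X (f.rename ρ) (f'.rename ρ) := by
  refine ⟨h.1.rename hρ, h.2.1.rename hρ, fun Γ₂ ρ₂ hρ₂ T K K' hK hK' hP => ?_⟩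
  rw [rename_rename, rename_rename]
  exact h.2.2 _ _ (hρ₂.comp hρ) _ _ _ hK hK' hP

theorem lrel.eeq {P : TestRel} {A A' X : CType} {Γ : List VType} {f f' g g' : Tm}
    (h : lrel P A A' Γ X f f') (e : EEq Γ (some X) f g (.comp A))
    (e' : EEq Γ (some X) f' g' (.comp A')) : lrel P A A' Γ X g g' := by
  refine ⟨e.hasTy.2, e'.hasTy.2, fun Γ₂ ρ hρ T K K' hK hK' hP => ?_⟩
  exact (EEq.lapp_cong hK.eeq (e.rename hρ)).symm.trans
    ((h.2.2 _ _ hρ _ _ _ hK hK' hP).trans (EEq.lapp_cong hK'.eeq (e'.rename hρ)))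

theorem relV.rename (R : CType) : ∀ (A A' : VType) {Γ Γ' : List VType} {t t' : Tm} {ρ : ℕ → ℕ},
    relV R A A' Γ t t' → IsRen ρ Γ Γ' → relV R A A' Γ' (t.rename ρ) (t'.rename ρ)
  | .base _, A', _, _, _, _, _, h, hρ => by
    cases A' with
    | base b => exact ⟨h.1, h.2.rename hρ⟩
    | _ => exact h.elim
  | .unit, A', _, _, _, _, _, h, hρ => by
    cases A' with
    | unit => exact trivial
    | _ => exact h.elim
  | .prod A B, A', _, _, _, _, _, h, hρ => by
    cases A' with
    | prod A' B' => exact ⟨relV.rename R A A' h.1 hρ, relV.rename R B B' h.2 hρ⟩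
    | _ => exact h.elim
  | .arr A B, A', _, _, _, _, _, h, hρ => by
    cases A' with
    | arr A' B' =>
      intro Γ₂ ρ₂ hρ₂ a a' ha
      rw [rename_rename, rename_rename]
      exact h _ _ (hρ₂.comp hρ) _ _ ha
    | _ => exact h.elim
  | .comp A, A', _, _, _, _, _, h, hρ => by
    cases A' with
    | comp A' =>
      intro Γ₂ ρ₂ hρ₂ X f f' hf
      rw [rename_rename, rename_rename]
      exact h _ _ (hρ₂.comp hρ) _ _ _ hf
    | _ => exact h.elim
  | .lin A B, A', _, _, _, _, _, h, hρ => by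
    cases A' with
    | lin A' B' =>
      intro Γ₂ ρ₂ hρ₂ X f f' hf
      rw [rename_rename, rename_rename]
      exact h _ _ (hρ₂.comp hρ) _ _ _ hf
    | _ => exact h.elim

theorem ValRel.rename {R : CType} {A A' : VType} {Γ Γ' : List VType} {t t' : Tm} {ρ : ℕ → ℕ}
    (h : ValRel R A A' Γ t t') (hρ : IsRen ρ Γ Γ') :
    ValRel R A A' Γ' (t.rename ρ) (t'.rename ρ) :=
  ⟨h.1.rename hρ, h.2.1.rename hρ, h.2.2.rename R A A' hρ⟩

theorem relV.eeq (R : CType) : ∀ (A A' : VType) {Γ : List VType} {t t' u u' : Tm},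
    relV R A A' Γ t t' → EEq Γ none t u (cpsV R A) → EEq Γ none t' u' (cpsV R A') →
    relV R A A' Γ u u'
  | .base _, A', _, _, _, _, _, h, e, e' => by
    cases A' with
    | base b =>
      obtain ⟨rfl, h⟩ := h
      exact ⟨rfl, e.symm.trans (h.trans e')⟩
    | _ => exact h.elim
  | .unit, A', _, _, _, _, _, h, e, e' => by
    cases A' with
    | unit => exact trivial
    | _ => exact h.elim
  | .prod A B, A', _, _, _, _, _, h, e, e' => by
    cases A' with
    | prod A' B' =>
      exact ⟨relV.eeq R A A' h.1 (.vfst_cong e) (.vfst_cong e'),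
        relV.eeq R B B' h.2 (.vsnd_cong e) (.vsnd_cong e')⟩
    | _ => exact h.elim
  | .arr A B, A', _, _, _, _, _, h, e, e' => by
    cases A' with
    | arr A' B' =>
      intro Γ₂ ρ₂ hρ₂ a a' ha
      exact relV.eeq R B B' (h _ _ hρ₂ _ _ ha) (.vapp_cong (e.rename hρ₂) ha.1.eeq)
        (.vapp_cong (e'.rename hρ₂) ha.2.1.eeq)
    | _ => exact h.elim
  | .comp A, A', _, _, _, _, _, h, e, e' => by
    cases A' with
    | comp A' =>
      intro Γ₂ ρ₂ hρ₂ X f f' hf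
      exact (EEq.lapp_cong (e.rename hρ₂) hf.1.eeq).symm.trans ((h _ _ hρ₂ _ _ _ hf).trans
        (EEq.lapp_cong (e'.rename hρ₂) hf.2.1.eeq))
    | _ => exact h.elim
  | .lin A B, A', _, _, _, _, _, h, e, e' => by
    cases A' with
    | lin A' B' =>
      intro Γ₂ ρ₂ hρ₂ X f f' hf
      exact (h _ _ hρ₂ _ _ _ hf).eeq (EEq.lapp_cong (e.rename hρ₂) hf.1.eeq)
        (EEq.lapp_cong (e'.rename hρ₂) hf.2.1.eeq)
    | _ => exact h.elim

section

variable {R : CType} {Γ : List VType} {A A' : VType} {B B' C C' X Y Z : CType}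
  {a a' f f' g g' s t u E L M M' : Tm}

theorem eeq_lapp_llam_lapp (hL : HasTy Γ none L (.lin Y Z)) (hE : HasTy Γ (some X) E (.comp Y))
    {Δ : Option CType} (hu : HasTy Γ Δ u (.comp X)) :
    EEq Γ Δ (.lapp (.llam X (.lapp L E)) u) (.lapp L (ssubst u E)) (.comp Z) := by
  rw [← ssubst_lapp_stoupFree hL.stoupFree]
  exact eeq_lapp_llam (.lapp hL hE) hu

theorem eeq_lapp_llam_svar {Δ : Option CType} (hu : HasTy Γ Δ u (.comp X)) :
    EEq Γ Δ (.lapp (.llam X .svar) u) u (.comp X) :=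
  eeq_lapp_llam .svar hu

theorem eeq_lapp_llam_capp {Δ : Option CType} (ha : HasTy Γ none a A)
    (hu : HasTy Γ Δ u (.comp (.carr A X))) :
    EEq Γ Δ (.lapp (.llam (.carr A X) (.capp .svar a)) u) (.capp u a) (.comp X) := by
  simpa only [ssubst, ha.stoupFree.ssubst_eq] using eeq_lapp_llam (.capp .svar ha) hu

theorem eeq_lapp_llam_lapp_capp {Δ : Option CType} (hL : HasTy Γ none L (.lin X Y))
    (ha : HasTy Γ none a A) (hu : HasTy Γ Δ u (.comp (.carr A X))) :
    EEq Γ Δ (.lapp (.llam (.carr A X) (.lapp L (.capp .svar a))) u) (.lapp L (.capp u a))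
      (.comp Y) := by
  simpa only [ssubst, ha.stoupFree.ssubst_eq] using
    eeq_lapp_llam_lapp hL (.capp .svar ha) hu

/-- Two terms related at the translation of the unit `I` are provably equal. -/
theorem StoupRel.eeq_of_iunit (h : StoupRel R .iunit .iunit Γ X f f') :
    EEq Γ (some X) f f' (.comp R) := by
  have key := h.2.2 Γ id (isRen_id Γ) R _ _ (.llam .svar) (.llam .svar) ⟨rfl, rfl, rfl⟩
  rw [rename_id, rename_id] at key
  exact (eeq_lapp_llam_svar h.1).symm.trans (key.trans (eeq_lapp_llam_svar h.2.1))

theorem StoupRel.iunit_of_eeq (h : EEq Γ (some X) f f' (.comp R)) :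
    StoupRel R .iunit .iunit Γ X f f' := by
  refine ⟨h.hasTy.1, h.hasTy.2, ?_⟩
  rintro Γ₂ ρ hρ T K K' hK hK' ⟨rfl, rfl, rfl⟩
  exact .lapp_cong hK.eeq (h.rename hρ)

theorem StoupRel.cinl (h : StoupRel R B B' Γ X f f') :
    StoupRel R (.cand B C) (.cand B' C') Γ X (.cinl f) (.cinl f') := by
  refine ⟨.cinl h.1, .cinl h.2.1, fun Γ₂ ρ hρ T K K' hK hK' hP => ?_⟩
  have key := (hP Γ₂ id (isRen_id _) X _ _).1 (h.rename hρ)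
  rwa [rename_id, rename_id] at key

theorem StoupRel.cinr (h : StoupRel R C C' Γ X f f') :
    StoupRel R (.cand B C) (.cand B' C') Γ X (.cinr f) (.cinr f') := by
  refine ⟨.cinr h.1, .cinr h.2.1, fun Γ₂ ρ hρ T K K' hK hK' hP => ?_⟩
  have key := (hP Γ₂ id (isRen_id _) X _ _).2 (h.rename hρ)
  rwa [rename_id, rename_id] at key

theorem StoupRel.copow (ha : ValRel R A A' Γ a a') (h : StoupRel R B B' Γ X f f') :
    StoupRel R (.carr A B) (.carr A' B') Γ X (.copow a f) (.copow a' f') := by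
  refine ⟨.copow ha.1 h.1, .copow ha.2.1 h.2.1, fun Γ₂ ρ hρ T K K' hK hK' hP => ?_⟩
  have key := hP Γ₂ id (isRen_id _) _ _ X _ _ (ha.rename hρ) (h.rename hρ)
  rwa [rename_id, rename_id] at key

theorem StoupRel.cfst (h : StoupRel R (.csum B C) (.csum B' C') Γ X f f') :
    StoupRel R B B' Γ X (.cfst f) (.cfst f') := by
  refine ⟨.cfst h.1, .cfst h.2.1, fun Γ₂ ρ hρ T K K' hK hK' hP => ?_⟩
  have key := h.2.2 Γ₂ ρ hρ T _ _ (.llam (.lapp hK (.cfst .svar)))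
    (.llam (.lapp hK' (.cfst .svar))) (.inl ⟨K, K', hK, hK', hP, rfl, rfl⟩)
  exact (eeq_lapp_llam_lapp hK (.cfst .svar) (h.1.rename hρ)).symm.trans
    (key.trans (eeq_lapp_llam_lapp hK' (.cfst .svar) (h.2.1.rename hρ)))

theorem StoupRel.csnd (h : StoupRel R (.csum B C) (.csum B' C') Γ X f f') :
    StoupRel R C C' Γ X (.csnd f) (.csnd f') := by
  refine ⟨.csnd h.1, .csnd h.2.1, fun Γ₂ ρ hρ T K K' hK hK' hP => ?_⟩
  have key := h.2.2 Γ₂ ρ hρ T _ _ (.llam (.lapp hK (.csnd .svar)))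
    (.llam (.lapp hK' (.csnd .svar))) (.inr ⟨K, K', hK, hK', hP, rfl, rfl⟩)
  exact (eeq_lapp_llam_lapp hK (.csnd .svar) (h.1.rename hρ)).symm.trans
    (key.trans (eeq_lapp_llam_lapp hK' (.csnd .svar) (h.2.1.rename hρ)))

theorem StoupRel.capp (h : StoupRel R (.copow A B) (.copow A' B') Γ X f f')
    (ha : ValRel R A A' Γ a a') : StoupRel R B B' Γ X (.capp f a) (.capp f' a') := by
  refine ⟨.capp h.1 ha.1, .capp h.2.1 ha.2.1, fun Γ₂ ρ hρ T K K' hK hK' hP => ?_⟩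
  have ha' := ha.rename hρ
  have key := h.2.2 Γ₂ ρ hρ T _ _ (.llam (.lapp hK (.capp .svar ha'.1)))
    (.llam (.lapp hK' (.capp .svar ha'.2.1))) ⟨_, _, K, K', ha', hK, hK', hP, rfl, rfl⟩
  exact (eeq_lapp_llam_lapp_capp hK ha'.1 (h.1.rename hρ)).symm.trans
    (key.trans (eeq_lapp_llam_lapp_capp hK' ha'.2.1 (h.2.1.rename hρ)))

theorem StoupRel.eeq_capp (h : StoupRel R (.bang A) (.bang A') Γ X f f')
    (ha : ValRel R A A' Γ a a') : EEq Γ (some X) (.capp f a) (.capp f' a') (.comp R) := by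
  have key := h.2.2 Γ id (isRen_id _) R _ _ (.llam (.capp .svar ha.1))
    (.llam (.capp .svar ha.2.1)) ⟨a, a', ha, rfl, rfl, rfl⟩
  rw [rename_id, rename_id] at key
  exact (eeq_lapp_llam_capp ha.1 h.1).symm.trans (key.trans (eeq_lapp_llam_capp ha.2.1 h.2.1))

theorem stoupRel_cunit : StoupRel R .czero .czero Γ X .cunit .cunit :=
  ⟨.cunit, .cunit, fun _ _ _ _ _ _ _ _ hP => hP.elim⟩

theorem StoupRel.cpair (h : StoupRel R B B' Γ X f f') (h' : StoupRel R C C' Γ X g g') :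
    StoupRel R (.csum B C) (.csum B' C') Γ X (.cpair f g) (.cpair f' g') := by
  refine ⟨.cpair h.1 h'.1, .cpair h.2.1 h'.2.1, ?_⟩
  have beta₁ : ∀ {Γ₂ : List VType} {Y Z T : CType} {u v L : Tm}, HasTy Γ₂ none L (.lin Y T) →
      HasTy Γ₂ (some X) u (.comp Y) → HasTy Γ₂ (some X) v (.comp Z) →
      EEq Γ₂ (some X) (.lapp (.llam (.cand Y Z) (.lapp L (.cfst .svar))) (.cpair u v))
        (.lapp L u) (.comp T) := fun hL hu hv =>
    (eeq_lapp_llam_lapp hL (.cfst .svar) (.cpair hu hv)).trans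
      (.lapp_cong hL.eeq (hu.elim fun d => hv.elim (.cfst_beta d)))
  have beta₂ : ∀ {Γ₂ : List VType} {Y Z T : CType} {u v L : Tm}, HasTy Γ₂ none L (.lin Z T) →
      HasTy Γ₂ (some X) u (.comp Y) → HasTy Γ₂ (some X) v (.comp Z) →
      EEq Γ₂ (some X) (.lapp (.llam (.cand Y Z) (.lapp L (.csnd .svar))) (.cpair u v))
        (.lapp L v) (.comp T) := fun hL hu hv =>
    (eeq_lapp_llam_lapp hL (.csnd .svar) (.cpair hu hv)).trans
      (.lapp_cong hL.eeq (hu.elim fun d => hv.elim (.csnd_beta d)))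
  rintro Γ₂ ρ hρ T _ _ - - (⟨L, L', hL, hL', hP, rfl, rfl⟩ | ⟨L, L', hL, hL', hP, rfl, rfl⟩)
  · exact (beta₁ hL (h.1.rename hρ) (h'.1.rename hρ)).trans
      ((h.2.2 _ _ hρ _ _ _ hL hL' hP).trans
        (beta₁ hL' (h.2.1.rename hρ) (h'.2.1.rename hρ)).symm)
  · exact (beta₂ hL (h.1.rename hρ) (h'.1.rename hρ)).trans
      ((h'.2.2 _ _ hρ _ _ _ hL hL' hP).trans
        (beta₂ hL' (h.2.1.rename hρ) (h'.2.1.rename hρ)).symm)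

theorem stoupRel_clam_copow (hg : HasTy (cpsV R A :: Γ) (some X) g (.comp (cpsC R B)))
    (hg' : HasTy (cpsV R A' :: Γ) (some X) g' (.comp (cpsC R B')))
    (h : ∀ Γ₂ ρ, IsRen ρ Γ Γ₂ → ∀ a a', ValRel R A A' Γ₂ a a' →
      StoupRel R B B' Γ₂ X (subst0 a (g.rename (liftN ρ))) (subst0 a' (g'.rename (liftN ρ)))) :
    StoupRel R (.copow A B) (.copow A' B') Γ X (.clam (cpsV R A) g) (.clam (cpsV R A') g') := by
  refine ⟨.clam hg, .clam hg', ?_⟩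
  have beta : ∀ {Γ₂ : List VType} {A : VType} {Y T : CType} {g a L : Tm},
      HasTy Γ₂ none L (.lin Y T) → HasTy Γ₂ none a A → HasTy (A :: Γ₂) (some X) g (.comp Y) →
      EEq Γ₂ (some X) (.lapp (.llam (.carr A Y) (.lapp L (.capp .svar a))) (.clam A g))
        (.lapp L (subst0 a g)) (.comp T) := fun hL ha hg =>
    (eeq_lapp_llam_lapp_capp hL ha (.clam hg)).trans (.lapp_cong hL.eeq (eeq_capp_clam hg ha))
  rintro Γ₂ ρ hρ T _ _ - - ⟨a, a', L, L', ha, hL, hL', hP, rfl, rfl⟩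
  have key := (h Γ₂ ρ hρ a a' ha).2.2 Γ₂ id (isRen_id _) T L L' hL hL' hP
  rw [rename_id, rename_id] at key
  exact (beta hL ha.1 (hg.rename (hρ.lift _))).trans
    (key.trans (beta hL' ha.2.1 (hg'.rename (hρ.lift _))).symm)

theorem stoupRel_clam_bang (hg : HasTy (cpsV R A :: Γ) (some X) g (.comp R))
    (hg' : HasTy (cpsV R A' :: Γ) (some X) g' (.comp R))
    (h : ∀ Γ₂ ρ, IsRen ρ Γ Γ₂ → ∀ a a', ValRel R A A' Γ₂ a a' →
      EEq Γ₂ (some X) (subst0 a (g.rename (liftN ρ))) (subst0 a' (g'.rename (liftN ρ)))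
        (.comp R)) :
    StoupRel R (.bang A) (.bang A') Γ X (.clam (cpsV R A) g) (.clam (cpsV R A') g') := by
  refine ⟨.clam hg, .clam hg', ?_⟩
  have beta : ∀ {Γ₂ : List VType} {A : VType} {g a : Tm},
      HasTy Γ₂ none a A → HasTy (A :: Γ₂) (some X) g (.comp R) →
      EEq Γ₂ (some X) (.lapp (.llam (.carr A R) (.capp .svar a)) (.clam A g))
        (subst0 a g) (.comp R) := fun ha hg =>
    (eeq_lapp_llam_capp ha (.clam hg)).trans (eeq_capp_clam hg ha)
  rintro Γ₂ ρ hρ T _ _ - - ⟨a, a', ha, rfl, rfl, rfl⟩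
  exact (beta ha.1 (hg.rename (hρ.lift _))).trans
    ((h Γ₂ ρ hρ a a' ha).trans (beta ha.2.1 (hg'.rename (hρ.lift _))).symm)

/-- A linear function transports related terms if precomposition with it preserves tests. -/
theorem StoupRel.lapp_of_tests (hM : HasTy Γ none M (.lin (cpsC R B) (cpsC R C)))
    (hM' : HasTy Γ none M' (.lin (cpsC R B') (cpsC R C')))
    (h : ∀ Γ₂ ρ, IsRen ρ Γ Γ₂ → ∀ T K K', HasTy Γ₂ none K (.lin (cpsC R C) T) →
      HasTy Γ₂ none K' (.lin (cpsC R C') T) → testC R C C' Γ₂ T K K' →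
      testC R B B' Γ₂ T (.llam (cpsC R B) (.lapp K (.lapp (M.rename ρ) .svar)))
        (.llam (cpsC R B') (.lapp K' (.lapp (M'.rename ρ) .svar))))
    (hf : StoupRel R B B' Γ X f f') :
    StoupRel R C C' Γ X (.lapp M f) (.lapp M' f') := by
  refine ⟨.lapp hM hf.1, .lapp hM' hf.2.1, fun Γ₂ ρ hρ T K K' hK hK' hP => ?_⟩
  have beta : ∀ {Y Z : CType} {K M f : Tm}, HasTy Γ none M (.lin Y Z) →
      HasTy Γ (some X) f (.comp Y) → HasTy Γ₂ none K (.lin Z T) →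
      EEq Γ₂ (some X) (.lapp (.llam Y (.lapp K (.lapp (M.rename ρ) .svar))) (f.rename ρ))
        (.lapp K (.lapp (M.rename ρ) (f.rename ρ))) (.comp T) := by
    intro Y Z K M f hM hf hK
    have hM' := hM.rename hρ
    simpa only [ssubst, hM'.stoupFree.ssubst_eq] using
      eeq_lapp_llam_lapp hK (.lapp hM' .svar) (hf.rename hρ)
  exact (beta hM hf.1 hK).symm.trans ((hf.2.2 Γ₂ ρ hρ T _ _
    (.llam (.lapp hK (.lapp (hM.rename hρ) .svar)))
    (.llam (.lapp hK' (.lapp (hM'.rename hρ) .svar))) (h Γ₂ ρ hρ T K K' hK hK' hP)).trans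
    (beta hM' hf.2.1 hK'))

end

theorem StoupRel.refl_of_tests {R A X : CType} {Γ : List VType} {f f' : Tm}
    (hA : ∀ {Γ T K K'}, HasTy Γ none K (.lin (cpsC R A) T) → HasTy Γ none K' (.lin (cpsC R A) T) →
      testC R A A Γ T K K' → EEq Γ none K K' (.lin (cpsC R A) T))
    (h : EEq Γ (some X) f f' (.comp (cpsC R A))) : StoupRel R A A Γ X f f' :=
  ⟨h.hasTy.1, h.hasTy.2, fun _ _ hρ _ _ _ hK hK' hP => .lapp_cong (hA hK hK' hP) (h.rename hρ)⟩

/-- Related terms are equal if the identity is a related test. -/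
theorem StoupRel.eeq_of_test {R A X : CType} {Γ : List VType} {f f' : Tm}
    (h : StoupRel R A A Γ X f f')
    (hA : testC R A A Γ (cpsC R A) (.llam (cpsC R A) .svar) (.llam (cpsC R A) .svar)) :
    EEq Γ (some X) f f' (.comp (cpsC R A)) := by
  have key := h.2.2 Γ id (isRen_id Γ) _ _ _ (.llam .svar) (.llam .svar) hA
  rw [rename_id, rename_id] at key
  exact (eeq_lapp_llam_svar h.1).symm.trans (key.trans (eeq_lapp_llam_svar h.2.1))

mutual

/-- Over equal types the logical relation is provable equality. -/
theorem relV_iff_eeq (R : CType) : ∀ (A : VType) {Γ : List VType} {t t' : Tm},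
    HasTy Γ none t (cpsV R A) → HasTy Γ none t' (cpsV R A) →
    (relV R A A Γ t t' ↔ EEq Γ none t t' (cpsV R A))
  | .base _, _, _, _, _, _ => ⟨fun h => h.2, fun h => ⟨rfl, h⟩⟩
  | .unit, _, _, _, h, h' =>
    ⟨fun _ => (h.elim EEq.unit_eta).trans (h'.elim EEq.unit_eta).symm, fun _ => trivial⟩
  | .prod A B, _, _, _, h, h' =>
    ⟨fun hr => eeq_of_vproj h h' ((relV_iff_eeq R A h.vfst h'.vfst).1 hr.1)
        ((relV_iff_eeq R B h.vsnd h'.vsnd).1 hr.2),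
      fun he => ⟨(relV_iff_eeq R A h.vfst h'.vfst).2 (.vfst_cong he),
        (relV_iff_eeq R B h.vsnd h'.vsnd).2 (.vsnd_cong he)⟩⟩
  | .arr A B, Γ, _, _, h, h' => by
    constructor
    · intro hr
      have h0 : HasTy (cpsV R A :: Γ) none (.var 0) (cpsV R A) := .var rfl
      exact eeq_of_vapp_var h h' ((relV_iff_eeq R B (.vapp h.shift h0) (.vapp h'.shift h0)).1
        (hr _ _ (isRen_succ _ _) _ _ ⟨h0, h0, (relV_iff_eeq R A h0 h0).2 h0.eeq⟩))
    · intro he Γ₂ ρ hρ a a' ha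
      exact (relV_iff_eeq R B (.vapp (h.rename hρ) ha.1) (.vapp (h'.rename hρ) ha.2.1)).2
        (.vapp_cong (he.rename hρ) ((relV_iff_eeq R A ha.1 ha.2.1).1 ha.2.2))
  | .comp A, Γ, _, _, h, h' => by
    constructor
    · intro hr
      have key := hr _ _ (isRen_id Γ) _ _ _
        (StoupRel.refl_of_tests (eeq_of_testC R A) (HasTy.svar.eeq))
      rw [rename_id, rename_id] at key
      exact eeq_of_lapp_svar h h' key
    · intro he Γ₂ ρ hρ X f f' hf
      exact .lapp_cong (he.rename hρ) (StoupRel.eeq R A hf)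
  | .lin A B, Γ, _, _, h, h' => by
    constructor
    · intro hr
      have key := StoupRel.eeq R A (hr _ _ (isRen_id Γ) _ _ _
        (StoupRel.refl_of_tests (eeq_of_testC R B) (HasTy.svar.eeq)))
      rw [rename_id, rename_id] at key
      exact eeq_of_lapp_svar h h' key
    · intro he Γ₂ ρ hρ X f f' hf
      exact StoupRel.refl_of_tests (eeq_of_testC R A)
        (.lapp_cong (he.rename hρ) (StoupRel.eeq R B hf))

/-- Related tests over equal types are provably equal. -/
theorem eeq_of_testC (R : CType) : ∀ (A : CType) {Γ : List VType} {T : CType} {K K' : Tm},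
    HasTy Γ none K (.lin (cpsC R A) T) → HasTy Γ none K' (.lin (cpsC R A) T) →
    testC R A A Γ T K K' → EEq Γ none K K' (.lin (cpsC R A) T)
  | .base _, _, _, _, _, h, _, hP => by
    obtain ⟨-, rfl, rfl, rfl⟩ := hP
    exact h.eeq
  | .cunit, _, _, _, _, h, h', _ =>
    eeq_of_lapp_svar h h' ((eeq_lapp_czero h .svar).trans (eeq_lapp_czero h' .svar).symm)
  | .cand A B, Γ, _, _, _, h, h', hP => by
    have key₁ := (hP _ _ (isRen_id Γ) _ _ _).1
      (StoupRel.refl_of_tests (eeq_of_testC R A) (HasTy.svar.eeq))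
    have key₂ := (hP _ _ (isRen_id Γ) _ _ _).2
      (StoupRel.refl_of_tests (eeq_of_testC R B) (HasTy.svar.eeq))
    rw [rename_id, rename_id] at key₁ key₂
    exact eeq_of_cinj h h' key₁ key₂
  | .carr A B, Γ, _, _, _, h, h', hP => by
    have h0 : HasTy (cpsV R A :: Γ) none (.var 0) (cpsV R A) := .var rfl
    exact eeq_of_copow h h' (hP _ _ (isRen_succ _ _) _ _ _ _ _
      ⟨h0, h0, (relV_iff_eeq R A h0 h0).2 h0.eeq⟩
      (StoupRel.refl_of_tests (eeq_of_testC R B) (HasTy.svar.eeq)))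
  | .iunit, _, _, _, _, h, _, hP => by
    obtain ⟨rfl, rfl, rfl⟩ := hP
    exact h.eeq
  | .bang A, _, _, _, _, _, _, hP => by
    obtain ⟨a, a', ha, rfl, rfl, rfl⟩ := hP
    exact .llam_cong (.capp_cong HasTy.svar.eeq ((relV_iff_eeq _ A ha.1 ha.2.1).1 ha.2.2))
  | .copow A B, _, _, _, _, _, _, hP => by
    obtain ⟨a, a', L, L', ha, hL, hL', hP, rfl, rfl⟩ := hP
    exact .llam_cong (.lapp_cong (eeq_of_testC R B hL hL' hP)
      (.capp_cong HasTy.svar.eeq ((relV_iff_eeq R A ha.1 ha.2.1).1 ha.2.2)))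
  | .czero, _, _, _, _, _, _, hP => hP.elim
  | .csum A B, _, _, _, _, _, _, hP => by
    obtain ⟨L, L', hL, hL', hP, rfl, rfl⟩ | ⟨L, L', hL, hL', hP, rfl, rfl⟩ := hP
    · exact .llam_cong (.lapp_cong (eeq_of_testC R A hL hL' hP) (HasTy.cfst .svar).eeq)
    · exact .llam_cong (.lapp_cong (eeq_of_testC R B hL hL' hP) (HasTy.csnd .svar).eeq)

/-- Related continuations over equal types are provably equal. -/
theorem StoupRel.eeq (R : CType) : ∀ (A : CType) {Γ : List VType} {X : CType} {f f' : Tm},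
    StoupRel R A A Γ X f f' → EEq Γ (some X) f f' (.comp (cpsC R A))
  | .base _, _, _, _, _, h => h.eeq_of_test ⟨rfl, rfl, rfl, rfl⟩
  | .cunit, _, _, _, _, h => h.eeq_of_test trivial
  | .cand A B, _, _, _, _, h => h.eeq_of_test fun _ _ _ _ _ _ =>
      ⟨fun hf => .lapp_cong (HasTy.llam .svar).eeq (.cinl_cong (StoupRel.eeq R A hf)),
        fun hf => .lapp_cong (HasTy.llam .svar).eeq (.cinr_cong (StoupRel.eeq R B hf))⟩
  | .carr A B, _, _, _, _, h => h.eeq_of_test fun _ _ _ _ _ _ _ _ ha hf =>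
      .lapp_cong (HasTy.llam .svar).eeq
        (.copow_cong ((relV_iff_eeq R A ha.1 ha.2.1).1 ha.2.2) (StoupRel.eeq R B hf))
  | .iunit, _, _, _, _, h => h.eeq_of_iunit
  | .bang A, Γ, _, _, _, h => by
    have h0 : HasTy (cpsV R A :: Γ) none (.var 0) (cpsV R A) := .var rfl
    exact eeq_of_capp_var h.1 h.2.1 (StoupRel.eeq_capp (lrel.rename h (isRen_succ _ _))
      ⟨h0, h0, (relV_iff_eeq R A h0 h0).2 h0.eeq⟩)
  | .copow A B, Γ, _, _, _, h => by
    have h0 : HasTy (cpsV R A :: Γ) none (.var 0) (cpsV R A) := .var rfl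
    exact eeq_of_capp_var h.1 h.2.1 (StoupRel.eeq R B (StoupRel.capp
      (lrel.rename h (isRen_succ _ _)) ⟨h0, h0, (relV_iff_eeq R A h0 h0).2 h0.eeq⟩))
  | .czero, _, _, _, _, h => (h.1.elim EEq.cunit_eta).trans (h.2.1.elim EEq.cunit_eta).symm
  | .csum A B, _, _, _, _, h => eeq_of_cproj h.1 h.2.1
      (StoupRel.eeq R A (StoupRel.cfst h)) (StoupRel.eeq R B (StoupRel.csnd h))

end

/-- The computation type carried by a stoup, with `I` for the empty stoup. -/
def stoupType : Option CType → CType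
  | none => .iunit
  | some X => X

/-- A translated judgement with result type `X`, viewed as a linear function from `X`. -/
def asLin : Option CType → CType → Tm → Tm
  | none, _, c => c
  | some _, X, c => .llam X c

/-- Precomposition of a translated judgement with a term `E` in the stoup variable. -/
def elimTm : Option CType → CType → Tm → Tm → Tm
  | none, X, E, c => .llam X (.lapp c E)
  | some _, _, E, c => ssubst E c

/-- The translation of a pair of computations. -/
def pairTm : Option CType → CType → CType → Tm → Tm → Tm
  | none, X, Y, c, d => .llam (.csum X Y) (.ccase .svar (.lapp c .svar) (.lapp d .svar))
  | some _, _, _, c, d => .ccase .svar c d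

/-- The translation of an abstraction of a computation over a value. -/
def lamTm : Option CType → VType → CType → Tm → Tm
  | none, A, X, c => .llam (.copow A X) (.copowlet .svar (.lapp c .svar))
  | some _, _, _, c => .copowlet .svar c

section

variable {Γ : List VType} {Δ : Option CType} {A : VType} {X Y Z : CType} {c c' E : Tm}
  {σ : ℕ → Tm}

theorem psubst_asLin : psubst σ (asLin Δ X c) = asLin Δ X (psubst σ c) := by
  cases Δ <;> rfl

theorem psubst_elimTm (hσ : ∀ n, StoupFree (σ n)) :
    psubst σ (elimTm Δ X E c) = elimTm Δ X (psubst σ E) (psubst σ c) := by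
  cases Δ with
  | none => rfl
  | some _ => exact psubst_ssubst hσ _ _

theorem psubst_pairTm :
    psubst σ (pairTm Δ X Y c c') = pairTm Δ X Y (psubst σ c) (psubst σ c') := by
  cases Δ <;> rfl

theorem psubst_lamTm : psubst σ (lamTm Δ A X c) = lamTm Δ A X (psubst (liftS σ) c) := by
  cases Δ <;> rfl

theorem HasTy.of_llam (h : HasTy Γ none (.llam X c) (.lin X Y)) :
    HasTy Γ (some X) c (.comp Y) := by
  obtain ⟨d⟩ := h
  cases d with
  | llam _ _ _ _ d => exact ⟨d⟩

/-- Applying a translated judgement to a stoup term. -/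
theorem eeq_lapp_asLin_some {W : CType} (h : HasTy Γ none (asLin (some W) X c) (.lin X Y))
    (hE : HasTy Γ Δ E (.comp X)) : EEq Γ Δ (.lapp (asLin (some W) X c) E) (ssubst E c) (.comp Y) :=
  eeq_lapp_llam h.of_llam hE

theorem eeq_asLin_elimTm (hc : HasTy Γ none (asLin Δ Y c) (.lin Y Z))
    (hE : HasTy Γ (some X) E (.comp Y)) :
    EEq Γ none (asLin Δ X (elimTm Δ X E c)) (.llam X (.lapp (asLin Δ Y c) E)) (.lin X Z) := by
  cases Δ with
  | none => exact (HasTy.llam (.lapp hc hE)).eeq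
  | some _ => exact .llam_cong (eeq_lapp_asLin_some hc hE).symm

theorem eeq_asLin_pairTm (hc : HasTy Γ none (asLin Δ X c) (.lin X Z))
    (hc' : HasTy Γ none (asLin Δ Y c') (.lin Y Z)) :
    EEq Γ none (asLin Δ (.csum X Y) (pairTm Δ X Y c c'))
      (.llam (.csum X Y) (.ccase .svar (.lapp (asLin Δ X c) .svar) (.lapp (asLin Δ Y c') .svar)))
      (.lin (.csum X Y) Z) := by
  cases Δ with
  | none => exact (HasTy.llam (.ccase .svar (.lapp hc .svar) (.lapp hc' .svar))).eeq
  | some _ =>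
    have h := (eeq_lapp_asLin_some hc .svar).symm
    have h' := (eeq_lapp_asLin_some hc' .svar).symm
    rw [ssubst_svar] at h h'
    exact .llam_cong (.ccase_cong HasTy.svar.eeq h h')

theorem eeq_asLin_lamTm (hc : HasTy (A :: Γ) none (asLin Δ X c) (.lin X Z)) :
    EEq Γ none (asLin Δ (.copow A X) (lamTm Δ A X c))
      (.llam (.copow A X) (.copowlet .svar (.lapp (asLin Δ X c) .svar)))
      (.lin (.copow A X) Z) := by
  cases Δ with
  | none => exact (HasTy.llam (.copowlet .svar (.lapp hc .svar))).eeq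
  | some _ =>
    have h := (eeq_lapp_asLin_some hc .svar).symm
    rw [ssubst_svar] at h
    exact .llam_cong (.copowlet_cong HasTy.svar.eeq h)

end

section

variable {R : CType} {Γ : List VType} {Δ : Option CType} {A : VType} {X Y Z : CType}
  {s t u : Tm}

theorem asLin_cps_cunit :
    asLin Δ .czero (cps R (.cunit Γ Δ)) = .llam .czero (.cimage (cpsC R (stoupType Δ)) .svar) := by
  cases Δ <;> rfl

theorem cps_cpair (d : Deriv Γ Δ t (.comp X)) (e : Deriv Γ Δ u (.comp Y)) :
    cps R (.cpair _ _ _ _ _ _ d e) = pairTm Δ (cpsC R X) (cpsC R Y) (cps R d) (cps R e) := by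
  cases Δ <;> rfl

theorem cps_cfst (d : Deriv Γ Δ t (.comp (.cand X Y))) :
    cps R (.cfst _ _ _ _ _ d) = elimTm Δ (cpsC R X) (.cinl .svar) (cps R d) := by
  cases Δ <;> rfl

theorem cps_csnd (d : Deriv Γ Δ t (.comp (.cand X Y))) :
    cps R (.csnd _ _ _ _ _ d) = elimTm Δ (cpsC R Y) (.cinr .svar) (cps R d) := by
  cases Δ <;> rfl

theorem cps_clam (d : Deriv (A :: Γ) Δ t (.comp X)) :
    cps R (.clam _ _ _ _ _ d) = lamTm Δ (cpsV R A) (cpsC R X) (cps R d) := by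
  cases Δ <;> rfl

theorem cps_capp (d : Deriv Γ Δ s (.comp (.carr A X))) (e : Deriv Γ none t A) :
    cps R (.capp _ _ _ _ _ _ d e) = elimTm Δ (cpsC R X) (.copow (cps R e) .svar) (cps R d) := by
  cases Δ <;> rfl

theorem cps_ilet (d : Deriv Γ Δ t (.comp .iunit)) (e : Deriv Γ none u (.comp X)) :
    cps R (.ilet _ _ _ _ _ d e) = elimTm Δ (cpsC R X) (.lapp (cps R e) .svar) (cps R d) := by
  cases Δ <;> rfl

theorem cps_banglet (d : Deriv Γ Δ t (.comp (.bang A))) (e : Deriv (A :: Γ) none u (.comp X)) :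
    cps R (.banglet _ _ _ _ _ _ d e) =
      elimTm Δ (cpsC R X) (.clam (cpsV R A) (.lapp (cps R e) .svar)) (cps R d) := by
  cases Δ <;> rfl

theorem cps_copow (d : Deriv Γ none t A) (e : Deriv Γ Δ u (.comp X)) :
    cps R (.copow _ _ _ _ _ _ d e) =
      elimTm Δ (.carr (cpsV R A) (cpsC R X)) (.capp .svar (cps R d)) (cps R e) := by
  cases Δ <;> rfl

theorem cps_copowlet (d : Deriv Γ Δ s (.comp (.copow A X)))
    (e : Deriv (A :: Γ) (some X) t (.comp Y)) :
    cps R (.copowlet _ _ _ _ _ _ _ d e) =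
      elimTm Δ (cpsC R Y) (.clam (cpsV R A) (cps R e)) (cps R d) := by
  cases Δ <;> rfl

theorem cps_cimage (d : Deriv Γ Δ t (.comp .czero)) :
    cps R (.cimage _ _ _ X d) = elimTm Δ (cpsC R X) .cunit (cps R d) := by
  cases Δ <;> rfl

theorem cps_cinl (d : Deriv Γ Δ t (.comp X)) :
    cps R (.cinl _ _ _ _ Y d) =
      elimTm Δ (.cand (cpsC R X) (cpsC R Y)) (.cfst .svar) (cps R d) := by
  cases Δ <;> rfl

theorem cps_cinr (d : Deriv Γ Δ t (.comp Y)) :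
    cps R (.cinr _ _ _ X _ d) =
      elimTm Δ (.cand (cpsC R X) (cpsC R Y)) (.csnd .svar) (cps R d) := by
  cases Δ <;> rfl

theorem cps_ccase (d : Deriv Γ Δ s (.comp (.csum X Y))) (e : Deriv Γ (some X) t (.comp Z))
    (e' : Deriv Γ (some Y) u (.comp Z)) :
    cps R (.ccase _ _ _ _ _ _ _ _ d e e') =
      elimTm Δ (cpsC R Z) (.cpair (cps R e) (cps R e')) (cps R d) := by
  cases Δ <;> rfl

theorem cps_lapp (d : Deriv Γ none s (.lin X Y)) (e : Deriv Γ Δ t (.comp X)) :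
    cps R (.lapp _ _ _ _ _ _ d e) = elimTm Δ (cpsC R Y) (.lapp (cps R d) .svar) (cps R e) := by
  cases Δ <;> rfl

end

/-- Typing of the translation of a judgement. -/
inductive JudgTy (R : CType) (Γ : List VType) : Option CType → VType → Tm → Prop
  | val {A c} : HasTy (cpsCtx R Γ) none c (cpsV R A) → JudgTy R Γ none A c
  | comp {Δ X c} : HasTy (cpsCtx R Γ) none (asLin Δ (cpsC R X) c)
      (.lin (cpsC R X) (cpsC R (stoupType Δ))) → JudgTy R Γ Δ (.comp X) c

section

variable {R : CType} {Γ : List VType} {Δ : Option CType} {A : VType} {X Y : CType} {c E : Tm}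

theorem JudgTy.hasTy (h : JudgTy R Γ none A c) : HasTy (cpsCtx R Γ) none c (cpsV R A) := by
  cases h with
  | val h => exact h
  | comp h => exact h

theorem JudgTy.hasTy_asLin (h : JudgTy R Γ Δ (.comp X) c) :
    HasTy (cpsCtx R Γ) none (asLin Δ (cpsC R X) c) (.lin (cpsC R X) (cpsC R (stoupType Δ))) := by
  cases h with
  | val h => exact h
  | comp h => exact h

theorem JudgTy.hasTy_some (h : JudgTy R Γ (some Y) (.comp X) c) :
    HasTy (cpsCtx R Γ) (some (cpsC R X)) c (.comp (cpsC R Y)) :=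
  h.hasTy_asLin.of_llam

theorem JudgTy.elimTm (h : JudgTy R Γ Δ (.comp Y) c)
    (hE : HasTy (cpsCtx R Γ) (some (cpsC R X)) E (.comp (cpsC R Y))) :
    JudgTy R Γ Δ (.comp X) (elimTm Δ (cpsC R X) E c) :=
  .comp (eeq_asLin_elimTm h.hasTy_asLin hE).hasTy.1

end

/-- The translation preserves typing. -/
theorem Deriv.judgTy (R : CType) {Γ : List VType} {Δ : Option CType} {t : Tm} {A : VType}
    (d : Deriv Γ Δ t A) : JudgTy R Γ Δ A (cps R d) := by
  induction d with
  | var Γ n A h => exact .val (.var (by rw [cpsCtx_getElem?, h]; rfl))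
  | svar => exact .comp (.llam .svar)
  | unit => exact .val .unit
  | vpair _ _ _ _ _ _ _ ih ih' => exact .val (.vpair ih.hasTy ih'.hasTy)
  | vfst _ _ _ _ _ ih => exact .val (.vfst ih.hasTy)
  | vsnd _ _ _ _ _ ih => exact .val (.vsnd ih.hasTy)
  | vlam _ _ _ _ _ ih => exact .val (.vlam ih.hasTy)
  | vapp _ _ _ _ _ _ _ ih ih' => exact .val (.vapp ih.hasTy ih'.hasTy)
  | cunit =>
    refine .comp ?_
    erw [asLin_cps_cunit]
    exact .llam (.cimage .svar)
  | cpair _ _ _ _ _ _ _ _ ih ih' =>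
    rw [cps_cpair]
    exact .comp (eeq_asLin_pairTm ih.hasTy_asLin ih'.hasTy_asLin).hasTy.1
  | cfst _ _ _ _ _ _ ih => rw [cps_cfst]; exact ih.elimTm (.cinl .svar)
  | csnd _ _ _ _ _ _ ih => rw [cps_csnd]; exact ih.elimTm (.cinr .svar)
  | clam _ _ _ _ _ _ ih =>
    rw [cps_clam]
    exact .comp (eeq_asLin_lamTm ih.hasTy_asLin).hasTy.1
  | capp _ _ _ _ _ _ _ _ ih ih' => rw [cps_capp]; exact ih.elimTm (.copow ih'.hasTy .svar)
  | top => exact .val (.llam .svar)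
  | ilet _ _ _ _ _ _ _ ih ih' => rw [cps_ilet]; exact ih.elimTm (.lapp ih'.hasTy .svar)
  | bang _ _ _ _ ih => exact .val (.llam (.capp .svar ih.hasTy))
  | banglet _ _ _ _ _ _ _ _ ih ih' =>
    rw [cps_banglet]; exact ih.elimTm (.clam (.lapp ih'.hasTy .svar))
  | copow _ _ _ _ _ _ _ _ ih ih' => rw [cps_copow]; exact ih'.elimTm (.capp .svar ih.hasTy)
  | copowlet _ _ _ _ _ _ _ _ _ ih ih' =>
    rw [cps_copowlet]; exact ih.elimTm (.clam ih'.hasTy_some)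
  | cimage _ _ _ _ _ ih => rw [cps_cimage]; exact ih.elimTm .cunit
  | cinl _ _ _ _ _ _ ih => rw [cps_cinl]; exact ih.elimTm (.cfst .svar)
  | cinr _ _ _ _ _ _ ih => rw [cps_cinr]; exact ih.elimTm (.csnd .svar)
  | ccase _ _ _ _ _ _ _ _ _ _ _ ih ih₁ ih₂ =>
    rw [cps_ccase]; exact ih.elimTm (.cpair ih₁.hasTy_some ih₂.hasTy_some)
  | llam _ _ _ _ _ ih => exact .val (.llam ih.hasTy_some)
  | lapp _ _ _ _ _ _ _ _ ih ih' => rw [cps_lapp]; exact ih'.elimTm (.lapp ih.hasTy .svar)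

theorem relV_comp_iff_lin {R : CType} {X X' : CType} {Γ : List VType} {t t' : Tm} :
    relV R (.comp X) (.comp X') Γ t t' ↔ relV R (.lin .iunit X) (.lin .iunit X') Γ t t' :=
  ⟨fun h _ _ hρ _ _ _ hf => StoupRel.iunit_of_eeq (h _ _ hρ _ _ _ hf),
    fun h _ _ hρ _ _ _ hf => StoupRel.eeq_of_iunit (h _ _ hρ _ _ _ hf)⟩

theorem testC.rename (R : CType) : ∀ (A A' : CType) {Γ Γ' : List VType} {T : CType} {K K' : Tm}
    {ρ : ℕ → ℕ}, testC R A A' Γ T K K' → IsRen ρ Γ Γ' →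
    testC R A A' Γ' T (K.rename ρ) (K'.rename ρ)
  | .base _, A', _, _, _, _, _, _, h, hρ => by
    cases A' with
    | base b =>
      obtain ⟨rfl, rfl, rfl, rfl⟩ := h
      exact ⟨rfl, rfl, rfl, rfl⟩
    | _ => exact h.elim
  | .cunit, A', _, _, _, _, _, _, h, hρ => by
    cases A' with
    | cunit => exact trivial
    | _ => exact h.elim
  | .cand A B, A', _, _, _, _, _, _, h, hρ => by
    cases A' with
    | cand A' B' =>
      intro Γ₂ ρ₂ hρ₂ X f f'
      rw [rename_rename, rename_rename]
      exact h _ _ (hρ₂.comp hρ) X f f'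
    | _ => exact h.elim
  | .carr A B, A', _, _, _, _, _, _, h, hρ => by
    cases A' with
    | carr A' B' =>
      intro Γ₂ ρ₂ hρ₂ a a' X f f'
      rw [rename_rename, rename_rename]
      exact h _ _ (hρ₂.comp hρ) a a' X f f'
    | _ => exact h.elim
  | .iunit, A', _, _, _, _, _, _, h, hρ => by
    cases A' with
    | iunit =>
      obtain ⟨rfl, rfl, rfl⟩ := h
      exact ⟨rfl, rfl, rfl⟩
    | _ => exact h.elim
  | .bang A, A', _, _, _, _, _, _, h, hρ => by
    cases A' with
    | bang A' =>
      obtain ⟨a, a', ha, rfl, rfl, rfl⟩ := h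
      exact ⟨_, _, ValRel.rename ha hρ, rfl, rfl, rfl⟩
    | _ => exact h.elim
  | .copow A B, A', _, _, _, _, _, _, h, hρ => by
    cases A' with
    | copow A' B' =>
      obtain ⟨a, a', L, L', ha, hL, hL', hP, rfl, rfl⟩ := h
      exact ⟨_, _, _, _, ValRel.rename ha hρ, hL.rename hρ, hL'.rename hρ,
        testC.rename R B B' hP hρ, rfl, rfl⟩
    | _ => exact h.elim
  | .czero, A', _, _, _, _, _, _, h, hρ => by
    cases A' with
    | _ => exact h.elim
  | .csum A B, A', _, _, _, _, _, _, h, hρ => by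
    cases A' with
    | csum A' B' =>
      obtain ⟨L, L', hL, hL', hP, rfl, rfl⟩ | ⟨L, L', hL, hL', hP, rfl, rfl⟩ := h
      · exact .inl ⟨_, _, hL.rename hρ, hL'.rename hρ, testC.rename R A A' hP hρ, rfl, rfl⟩
      · exact .inr ⟨_, _, hL.rename hρ, hL'.rename hρ, testC.rename R B B' hP hρ, rfl, rfl⟩
    | _ => exact h.elim

/-- Related tests observe related continuations over an extended context equally. -/
theorem StoupRel.eeq_lapp {R C C' T X : CType} {Γ Γ₂ : List VType} {f f' K K' : Tm} {ρ : ℕ → ℕ}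
    (hf : StoupRel R C C' Γ₂ X f f') (hρ : IsRen ρ Γ Γ₂)
    (hK : HasTy Γ none K (.lin (cpsC R C) T)) (hK' : HasTy Γ none K' (.lin (cpsC R C') T))
    (hP : testC R C C' Γ T K K') :
    EEq Γ₂ (some X) (.lapp (K.rename ρ) f) (.lapp (K'.rename ρ) f') (.comp T) := by
  have key := hf.2.2 Γ₂ id (isRen_id Γ₂) T _ _ (hK.rename hρ) (hK'.rename hρ)
    (hP.rename R C C' hρ)
  rwa [rename_id, rename_id] at key

/-- Related substitutions for two translated contexts. -/
structure EnvRel (R : CType) (Γ Γ' Γ₁ : List VType) (σ σ' : ℕ → Tm) : Prop where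
  stoupFree : ∀ n, StoupFree (σ n)
  stoupFree' : ∀ n, StoupFree (σ' n)
  isSub : IsSub σ (cpsCtx R Γ) Γ₁
  isSub' : IsSub σ' (cpsCtx R Γ') Γ₁
  rel : ∀ n A A', Γ[n]? = some A → Γ'[n]? = some A' → relV R A A' Γ₁ (σ n) (σ' n)

section

variable {R : CType} {Γ Γ' Γ₁ Γ₂ : List VType} {σ σ' : ℕ → Tm} {ρ : ℕ → ℕ} {A A' : VType}
  {a a' : Tm}

theorem EnvRel.rename (h : EnvRel R Γ Γ' Γ₁ σ σ') (hρ : IsRen ρ Γ₁ Γ₂) :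
    EnvRel R Γ Γ' Γ₂ (fun n => (σ n).rename ρ) (fun n => (σ' n).rename ρ) where
  stoupFree n := (h.stoupFree n).rename ρ
  stoupFree' n := (h.stoupFree' n).rename ρ
  isSub n A hn := (h.isSub n A hn).rename hρ
  isSub' n A hn := (h.isSub' n A hn).rename hρ
  rel n A A' hn hn' := (h.rel n A A' hn hn').rename R A A' hρ

theorem EnvRel.scons (h : EnvRel R Γ Γ' Γ₁ σ σ') (ha : ValRel R A A' Γ₁ a a') :
    EnvRel R (A :: Γ) (A' :: Γ') Γ₁ (scons a σ) (scons a' σ') where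
  stoupFree := stoupFree_scons ha.1.stoupFree h.stoupFree
  stoupFree' := stoupFree_scons ha.2.1.stoupFree h.stoupFree'
  isSub := h.isSub.scons ha.1
  isSub' := h.isSub'.scons ha.2.1
  rel n B B' hn hn' := by
    cases n with
    | zero =>
      obtain rfl : A = B := by simpa using hn
      obtain rfl : A' = B' := by simpa using hn'
      exact ha.2.2
    | succ n => exact h.rel n B B' (by simpa using hn) (by simpa using hn')

theorem EnvRel.isSub_liftS (h : EnvRel R Γ Γ' Γ₁ σ σ') (A : VType) :
    IsSub (liftS σ) (cpsCtx R (A :: Γ)) (cpsV R A :: Γ₁) := h.isSub.lift _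

theorem EnvRel.isSub_liftS' (h : EnvRel R Γ Γ' Γ₁ σ σ') (A : VType) :
    IsSub (liftS σ') (cpsCtx R (A :: Γ')) (cpsV R A :: Γ₁) := h.isSub'.lift _

end

theorem subst0_rename_psubst_liftS (a : Tm) (σ : ℕ → Tm) (ρ : ℕ → ℕ) (t : Tm) :
    subst0 a ((psubst (liftS σ) t).rename (liftN ρ)) =
      psubst (scons a fun n => (σ n).rename ρ) t := by
  rw [rename_psubst, rename_liftS, subst0_psubst_liftS]

/-- The logical relation between two translated judgements. -/
inductive JudgRel (R : CType) (Γ : List VType) :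
    Option CType → Option CType → VType → VType → Tm → Tm → Prop
  | val {A A' c c'} : relV R A A' Γ c c' → JudgRel R Γ none none A A' c c'
  | comp {Δ Δ' X X' c c'} : relV R (.lin (stoupType Δ) X) (.lin (stoupType Δ') X') Γ
      (asLin Δ (cpsC R X) c) (asLin Δ' (cpsC R X') c') →
      JudgRel R Γ Δ Δ' (.comp X) (.comp X') c c'

section

variable {R : CType} {Γ Γ' Γ₁ : List VType} {σ σ' : ℕ → Tm} {Δ Δ' : Option CType}
  {A A' : VType} {X X' Y Y' Z Z' W W' : CType} {c c' E E' f f' : Tm}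

theorem JudgRel.relV (h : JudgRel R Γ none none A A' c c') : relV R A A' Γ c c' := by
  cases h with
  | val h => exact h
  | comp h => exact relV_comp_iff_lin.2 h

theorem JudgRel.relV_asLin (h : JudgRel R Γ Δ Δ' (.comp X) (.comp X') c c') :
    EEC.relV R (.lin (stoupType Δ) X) (.lin (stoupType Δ') X') Γ
      (asLin Δ (cpsC R X) c) (asLin Δ' (cpsC R X') c') := by
  cases h with
  | val h => exact relV_comp_iff_lin.1 h
  | comp h => exact h

/-- Related translations send related continuations to related continuations. -/
theorem JudgRel.stoupRel_lapp (h : JudgRel R Γ Δ Δ' (.comp X) (.comp X') c c')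
    (hf : StoupRel R X X' Γ Y f f') :
    StoupRel R (stoupType Δ) (stoupType Δ') Γ Y (.lapp (asLin Δ (cpsC R X) c) f)
      (.lapp (asLin Δ' (cpsC R X') c') f') := by
  have key := h.relV_asLin _ _ (isRen_id Γ) _ _ _ hf
  rwa [rename_id, rename_id] at key

theorem JudgRel.stoupRel_ssubst (h : JudgRel R Γ (some W) (some W') (.comp X) (.comp X') c c')
    (hc : HasTy Γ (some (cpsC R X)) c (.comp (cpsC R W)))
    (hc' : HasTy Γ (some (cpsC R X')) c' (.comp (cpsC R W')))
    (hf : StoupRel R X X' Γ Y f f') :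
    StoupRel R W W' Γ Y (ssubst f c) (ssubst f' c') :=
  lrel.eeq (h.stoupRel_lapp hf) (eeq_lapp_llam hc hf.1) (eeq_lapp_llam hc' hf.2.1)

theorem JudgRel.eeq_lapp (h : JudgRel R Γ none none (.comp X) (.comp X') c c')
    (hf : StoupRel R X X' Γ Y f f') : EEq Γ (some Y) (.lapp c f) (.lapp c' f') (.comp R) :=
  StoupRel.eeq_of_iunit (h.stoupRel_lapp hf)

/-- Precomposition with related terms in the stoup variable preserves the logical relation. -/
theorem JudgRel.elimTm (he : EnvRel R Γ Γ' Γ₁ σ σ')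
    (h : JudgRel R Γ₁ Δ Δ' (.comp Y) (.comp Y') (psubst σ c) (psubst σ' c'))
    (hc : JudgTy R Γ Δ (.comp Y) c) (hc' : JudgTy R Γ' Δ' (.comp Y') c')
    (hE : HasTy (cpsCtx R Γ) (some (cpsC R X)) E (.comp (cpsC R Y)))
    (hE' : HasTy (cpsCtx R Γ') (some (cpsC R X')) E' (.comp (cpsC R Y')))
    (hEE : ∀ Γ₂ τ τ', EnvRel R Γ Γ' Γ₂ τ τ' → ∀ Z f f', StoupRel R X X' Γ₂ Z f f' →
      StoupRel R Y Y' Γ₂ Z (ssubst f (psubst τ E)) (ssubst f' (psubst τ' E'))) :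
    JudgRel R Γ₁ Δ Δ' (.comp X) (.comp X') (psubst σ (elimTm Δ (cpsC R X) E c))
      (psubst σ' (elimTm Δ' (cpsC R X') E' c')) := by
  have tc := hc.hasTy_asLin.psubst he.isSub
  have tc' := hc'.hasTy_asLin.psubst he.isSub'
  rw [psubst_asLin] at tc tc'
  have tE := hE.psubst he.isSub
  have tE' := hE'.psubst he.isSub'
  rw [psubst_elimTm he.stoupFree, psubst_elimTm he.stoupFree']
  refine .comp (relV.eeq R _ _ ?_ (eeq_asLin_elimTm tc tE).symm (eeq_asLin_elimTm tc' tE').symm)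
  intro Γ₂ ρ hρ Z f f' hf
  have key := hEE Γ₂ _ _ (he.rename hρ) Z f f' hf
  rw [← rename_psubst, ← rename_psubst] at key
  exact (h.relV_asLin Γ₂ ρ hρ Z _ _ key).eeq
    (eeq_lapp_llam_lapp (tc.rename hρ) (tE.rename hρ) hf.1).symm
    (eeq_lapp_llam_lapp (tc'.rename hρ) (tE'.rename hρ) hf.2.1).symm

/-- A translated judgement preserves the logical relation if it pulls back related tests. -/
theorem JudgRel.of_tests
    {M M' : Tm} (hM : HasTy Γ₁ none M (.lin (cpsC R X) (cpsC R (stoupType Δ))))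
    (hM' : HasTy Γ₁ none M' (.lin (cpsC R X') (cpsC R (stoupType Δ'))))
    (e : EEq Γ₁ none (asLin Δ (cpsC R X) c) M (.lin (cpsC R X) (cpsC R (stoupType Δ))))
    (e' : EEq Γ₁ none (asLin Δ' (cpsC R X') c') M' (.lin (cpsC R X') (cpsC R (stoupType Δ'))))
    (h : ∀ Γ₂ ρ, IsRen ρ Γ₁ Γ₂ → ∀ T K K',
      HasTy Γ₂ none K (.lin (cpsC R (stoupType Δ)) T) →
      HasTy Γ₂ none K' (.lin (cpsC R (stoupType Δ')) T) →
      testC R (stoupType Δ) (stoupType Δ') Γ₂ T K K' →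
      testC R X X' Γ₂ T (.llam (cpsC R X) (.lapp K (.lapp (M.rename ρ) .svar)))
        (.llam (cpsC R X') (.lapp K' (.lapp (M'.rename ρ) .svar)))) :
    JudgRel R Γ₁ Δ Δ' (.comp X) (.comp X') c c' := by
  refine .comp (relV.eeq R _ _ ?_ e.symm e'.symm)
  intro Γ₂ ρ hρ Z f f' hf
  refine StoupRel.lapp_of_tests (hM.rename hρ) (hM'.rename hρ) ?_ hf
  intro Γ₃ ρ₂ hρ₂ T K K' hK hK' hP
  rw [rename_rename, rename_rename]
  exact h _ _ (hρ₂.comp hρ) T K K' hK hK' hP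

end

section

variable {Γ : List VType} {Δ : Option CType} {A : VType} {X Y Z T W : CType} {K L L' a f : Tm}

theorem eeq_lapp_comp_ccase_cinl (hK : HasTy Γ none K (.lin Z T)) (hL : HasTy Γ none L (.lin X Z))
    (hL' : HasTy Γ none L' (.lin Y Z)) (hf : HasTy Γ (some W) f (.comp X)) :
    EEq Γ (some W) (.lapp (.llam (.csum X Y) (.lapp K (.lapp (.llam (.csum X Y)
      (.ccase .svar (.lapp L .svar) (.lapp L' .svar))) .svar))) (.cinl f))
      (.lapp K (.lapp L f)) (.comp T) := by
  have h : HasTy Γ (some X) (.lapp L .svar) (.comp Z) := .lapp hL .svar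
  have h' : HasTy Γ (some Y) (.lapp L' .svar) (.comp Z) := .lapp hL' .svar
  have hM := HasTy.llam (.ccase (Γ := Γ) .svar h h')
  have e₁ := eeq_lapp_llam_lapp hK (.lapp hM .svar) (HasTy.cinl (Y := Y) hf)
  rw [ssubst_lapp_stoupFree hM.stoupFree] at e₁
  have e₂ : EEq Γ (some W) (.ccase (.cinl f) (.lapp L .svar) (.lapp L' .svar))
      (ssubst f (.lapp L .svar)) (.comp Z) :=
    h.elim fun d => h'.elim fun d' => hf.elim (.csum_beta_inl d d')
  rw [ssubst_lapp_stoupFree hL.stoupFree] at e₂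
  exact e₁.trans (.lapp_cong hK.eeq
    ((eeq_lapp_llam (.ccase .svar h h') (HasTy.cinl hf)).trans e₂))

theorem eeq_lapp_comp_ccase_cinr (hK : HasTy Γ none K (.lin Z T)) (hL : HasTy Γ none L (.lin X Z))
    (hL' : HasTy Γ none L' (.lin Y Z)) (hf : HasTy Γ (some W) f (.comp Y)) :
    EEq Γ (some W) (.lapp (.llam (.csum X Y) (.lapp K (.lapp (.llam (.csum X Y)
      (.ccase .svar (.lapp L .svar) (.lapp L' .svar))) .svar))) (.cinr f))
      (.lapp K (.lapp L' f)) (.comp T) := by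
  have h : HasTy Γ (some X) (.lapp L .svar) (.comp Z) := .lapp hL .svar
  have h' : HasTy Γ (some Y) (.lapp L' .svar) (.comp Z) := .lapp hL' .svar
  have hM := HasTy.llam (.ccase (Γ := Γ) .svar h h')
  have e₁ := eeq_lapp_llam_lapp hK (.lapp hM .svar) (HasTy.cinr (X := X) hf)
  rw [ssubst_lapp_stoupFree hM.stoupFree] at e₁
  have e₂ : EEq Γ (some W) (.ccase (.cinr f) (.lapp L .svar) (.lapp L' .svar))
      (ssubst f (.lapp L' .svar)) (.comp Z) :=
    h.elim fun d => h'.elim fun d' => hf.elim (.csum_beta_inr d d')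
  rw [ssubst_lapp_stoupFree hL'.stoupFree] at e₂
  exact e₁.trans (.lapp_cong hK.eeq
    ((eeq_lapp_llam (.ccase .svar h h') (HasTy.cinr hf)).trans e₂))

theorem eeq_lapp_comp_copowlet (hK : HasTy Γ none K (.lin Z T))
    (hL : HasTy (A :: Γ) none L (.lin X Z)) (ha : HasTy Γ none a A)
    (hf : HasTy Γ (some W) f (.comp X)) :
    EEq Γ (some W) (.lapp (.llam (.copow A X) (.lapp K (.lapp (.llam (.copow A X)
      (.copowlet .svar (.lapp L .svar))) .svar))) (.copow a f))
      (.lapp K (.lapp (subst0 a L) f)) (.comp T) := by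
  have h : HasTy (A :: Γ) (some X) (.lapp L .svar) (.comp Z) := .lapp hL .svar
  have hM := HasTy.llam (.copowlet (Γ := Γ) .svar h)
  have e₁ := eeq_lapp_llam_lapp hK (.lapp hM .svar) (HasTy.copow ha hf)
  rw [ssubst_lapp_stoupFree hM.stoupFree] at e₁
  have e₂ : EEq Γ (some W) (.copowlet (.copow a f) (.lapp L .svar))
      (ssubst f (.lapp (subst0 a L) .svar)) (.comp Z) :=
    ha.elim fun d => hf.elim fun d' => h.elim (.copow_beta d d')
  rw [ssubst_lapp_stoupFree (hL.subst0 ha).stoupFree] at e₂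
  exact e₁.trans (.lapp_cong hK.eeq
    ((eeq_lapp_llam (.copowlet .svar h) (HasTy.copow ha hf)).trans e₂))

theorem subst0_rename_asLin (ρ : ℕ → ℕ) (c : Tm) :
    subst0 a ((asLin Δ X c).rename ρ) = asLin Δ X (subst0 a (c.rename ρ)) := by
  cases Δ <;> rfl

theorem subst0_rename_shift (ρ : ℕ → ℕ) (a f : Tm) :
    subst0 a ((shift f).rename (liftN ρ)) = f.rename ρ := by
  rw [rename_shift, subst0_shift]

theorem subst0_rename_ssubst_shift (ρ : ℕ → ℕ) (ha : StoupFree a) (t : Tm) :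
    subst0 a ((ssubst (shift f) t).rename (liftN ρ)) =
      ssubst (f.rename ρ) (subst0 a (t.rename (liftN ρ))) := by
  rw [rename_ssubst, subst0_eq_psubst, psubst_ssubst (stoupFree_scons ha stoupFree_var),
    ← subst0_eq_psubst, ← subst0_eq_psubst, subst0_rename_shift]

end

section

variable {R : CType} {Γ Γ' : List VType} {Δ Δ' : Option CType} {A A' : VType}
  {X X' Y Y' : CType} {c c' c₁ c₁' c₂ c₂' : Tm}

theorem JudgRel.pairTm (h₁ : JudgRel R Γ Δ Δ' (.comp X) (.comp X') c₁ c₁')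
    (h₂ : JudgRel R Γ Δ Δ' (.comp Y) (.comp Y') c₂ c₂')
    (t₁ : HasTy Γ none (asLin Δ (cpsC R X) c₁) (.lin (cpsC R X) (cpsC R (stoupType Δ))))
    (t₁' : HasTy Γ none (asLin Δ' (cpsC R X') c₁') (.lin (cpsC R X') (cpsC R (stoupType Δ'))))
    (t₂ : HasTy Γ none (asLin Δ (cpsC R Y) c₂) (.lin (cpsC R Y) (cpsC R (stoupType Δ))))
    (t₂' : HasTy Γ none (asLin Δ' (cpsC R Y') c₂') (.lin (cpsC R Y') (cpsC R (stoupType Δ')))) :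
    JudgRel R Γ Δ Δ' (.comp (.cand X Y)) (.comp (.cand X' Y'))
      (pairTm Δ (cpsC R X) (cpsC R Y) c₁ c₂) (pairTm Δ' (cpsC R X') (cpsC R Y') c₁' c₂') := by
  refine .of_tests (.llam (.ccase .svar (.lapp t₁ .svar) (.lapp t₂ .svar)))
    (.llam (.ccase .svar (.lapp t₁' .svar) (.lapp t₂' .svar)))
    (eeq_asLin_pairTm t₁ t₂) (eeq_asLin_pairTm t₁' t₂') ?_
  intro Γ₂ ρ hρ T K K' hK hK' hP Γ₃ ρ₃ hρ₃ Z f f'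
  constructor
  · intro hf
    have key := StoupRel.eeq_lapp (h₁.relV_asLin _ _ (hρ₃.comp hρ) Z f f' hf) hρ₃ hK hK' hP
    rw [← rename_rename, ← rename_rename] at key
    exact (eeq_lapp_comp_ccase_cinl (hK.rename hρ₃) ((t₁.rename hρ).rename hρ₃)
      ((t₂.rename hρ).rename hρ₃) hf.1).trans (key.trans
      (eeq_lapp_comp_ccase_cinl (hK'.rename hρ₃) ((t₁'.rename hρ).rename hρ₃)
      ((t₂'.rename hρ).rename hρ₃) hf.2.1).symm)
  · intro hf
    have key := StoupRel.eeq_lapp (h₂.relV_asLin _ _ (hρ₃.comp hρ) Z f f' hf) hρ₃ hK hK' hP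
    rw [← rename_rename, ← rename_rename] at key
    exact (eeq_lapp_comp_ccase_cinr (hK.rename hρ₃) ((t₁.rename hρ).rename hρ₃)
      ((t₂.rename hρ).rename hρ₃) hf.1).trans (key.trans
      (eeq_lapp_comp_ccase_cinr (hK'.rename hρ₃) ((t₁'.rename hρ).rename hρ₃)
      ((t₂'.rename hρ).rename hρ₃) hf.2.1).symm)

theorem JudgRel.lamTm
    (h : ∀ Γ₂ ρ, IsRen ρ Γ Γ₂ → ∀ a a', ValRel R A A' Γ₂ a a' →
      JudgRel R Γ₂ Δ Δ' (.comp X) (.comp X') (subst0 a (c.rename (liftN ρ)))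
        (subst0 a' (c'.rename (liftN ρ))))
    (tc : HasTy (cpsV R A :: Γ) none (asLin Δ (cpsC R X) c)
      (.lin (cpsC R X) (cpsC R (stoupType Δ))))
    (tc' : HasTy (cpsV R A' :: Γ) none (asLin Δ' (cpsC R X') c')
      (.lin (cpsC R X') (cpsC R (stoupType Δ')))) :
    JudgRel R Γ Δ Δ' (.comp (.carr A X)) (.comp (.carr A' X'))
      (lamTm Δ (cpsV R A) (cpsC R X) c) (lamTm Δ' (cpsV R A') (cpsC R X') c') := by
  refine .of_tests (.llam (.copowlet .svar (.lapp tc .svar)))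
    (.llam (.copowlet .svar (.lapp tc' .svar))) (eeq_asLin_lamTm tc) (eeq_asLin_lamTm tc') ?_
  intro Γ₂ ρ hρ T K K' hK hK' hP Γ₃ ρ₃ hρ₃ a a' Z f f' ha hf
  have key := StoupRel.eeq_lapp ((h _ _ (hρ₃.comp hρ) a a' ha).stoupRel_lapp hf) hρ₃ hK hK' hP
  rw [← subst0_rename_asLin, ← subst0_rename_asLin, ← liftN_comp, ← rename_rename,
    ← rename_rename] at key
  exact (eeq_lapp_comp_copowlet (hK.rename hρ₃) ((tc.rename (hρ.lift _)).rename (hρ₃.lift _))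
      ha.1 hf.1).trans (key.trans
    (eeq_lapp_comp_copowlet (hK'.rename hρ₃) ((tc'.rename (hρ.lift _)).rename (hρ₃.lift _))
      ha.2.1 hf.2.1).symm)

end

/-- The translations of any two derivations for a raw term are logically related. -/
theorem Deriv.judgRel (R : CType) {Γ : List VType} {Δ : Option CType} {t : Tm} {A : VType}
    (d : Deriv Γ Δ t A) : ∀ {Γ' : List VType} {Δ' : Option CType} {A' : VType}
      (d' : Deriv Γ' Δ' t A') {Γ₁ : List VType} {σ σ' : ℕ → Tm}, EnvRel R Γ Γ' Γ₁ σ σ' →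
      JudgRel R Γ₁ Δ Δ' A A' (psubst σ (cps R d)) (psubst σ' (cps R d')) := by
  induction d with
  | var Γ n A h =>
    intro Γ' Δ' A' d' Γ₁ σ σ' he
    cases d' with
    | var _ _ _ h' => exact .val (he.rel n _ _ h h')
  | svar Γ A =>
    intro Γ' Δ' A' d' Γ₁ σ σ' he
    cases d' with
    | svar => exact .comp fun _ _ _ _ _ _ hf =>
        lrel.eeq hf (eeq_lapp_llam_svar hf.1).symm (eeq_lapp_llam_svar hf.2.1).symm
  | unit =>
    intro Γ' Δ' A' d' Γ₁ σ σ' he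
    cases d' with
    | unit => exact .val trivial
  | vpair _ _ _ _ _ d₁ d₂ ih₁ ih₂ =>
    intro Γ' Δ' A' d' Γ₁ σ σ' he
    cases d' with
    | vpair _ _ _ _ _ e₁ e₂ =>
      have a₁ := d₁.judgTy R |>.hasTy.psubst he.isSub
      have a₂ := d₂.judgTy R |>.hasTy.psubst he.isSub
      have b₁ := e₁.judgTy R |>.hasTy.psubst he.isSub'
      have b₂ := e₂.judgTy R |>.hasTy.psubst he.isSub'
      have fst : ∀ {A B : VType} {t u : Tm}, HasTy Γ₁ none t A → HasTy Γ₁ none u B →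
          EEq Γ₁ none t (.vfst (.vpair t u)) A := fun h h' =>
        (h.elim fun d => h'.elim fun d' => EEq.vfst_beta d d').symm
      have snd : ∀ {A B : VType} {t u : Tm}, HasTy Γ₁ none t A → HasTy Γ₁ none u B →
          EEq Γ₁ none u (.vsnd (.vpair t u)) B := fun h h' =>
        (h.elim fun d => h'.elim fun d' => EEq.vsnd_beta d d').symm
      exact .val ⟨relV.eeq R _ _ (ih₁ e₁ he).relV (fst a₁ a₂) (fst b₁ b₂),
        relV.eeq R _ _ (ih₂ e₂ he).relV (snd a₁ a₂) (snd b₁ b₂)⟩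
  | vfst _ _ _ _ _ ih =>
    intro Γ' Δ' A' d' Γ₁ σ σ' he
    cases d' with
    | vfst _ _ _ _ e => exact .val (ih e he).relV.1
  | vsnd _ _ _ _ _ ih =>
    intro Γ' Δ' A' d' Γ₁ σ σ' he
    cases d' with
    | vsnd _ _ _ _ e => exact .val (ih e he).relV.2
  | vlam _ _ _ _ d ih =>
    intro Γ' Δ' A' d' Γ₁ σ σ' he
    cases d' with
    | vlam _ _ _ _ e =>
      refine .val fun Γ₂ ρ hρ a a' ha => ?_
      have tc := ((d.judgTy R).hasTy.psubst (he.isSub_liftS _)).rename (hρ.lift _)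
      have tc' := ((e.judgTy R).hasTy.psubst (he.isSub_liftS' _)).rename (hρ.lift _)
      have key := (ih e ((he.rename hρ).scons ha)).relV
      rw [← subst0_rename_psubst_liftS, ← subst0_rename_psubst_liftS] at key
      exact relV.eeq R _ _ key (eeq_vapp_vlam tc ha.1).symm (eeq_vapp_vlam tc' ha.2.1).symm
  | vapp _ _ _ _ _ d₁ d₂ ih₁ ih₂ =>
    intro Γ' Δ' A' d' Γ₁ σ σ' he
    cases d' with
    | vapp _ _ _ _ _ e₁ e₂ =>
      have key := (ih₁ e₁ he).relV _ _ (isRen_id Γ₁) _ _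
        ⟨(d₂.judgTy R).hasTy.psubst he.isSub, (e₂.judgTy R).hasTy.psubst he.isSub',
          (ih₂ e₂ he).relV⟩
      rw [rename_id, rename_id] at key
      exact .val key
  | cunit Γ Δ =>
    intro Γ' Δ' A' d' Γ₁ σ σ' he
    cases d' with
    | cunit =>
      have e : ∀ {Γ : List VType} {Δ : Option CType} {σ : ℕ → Tm},
          EEq Γ₁ none (asLin Δ (cpsC R .cunit) (psubst σ (cps R (.cunit Γ Δ))))
            (.llam .czero (.cimage (cpsC R (stoupType Δ)) .svar))
            (.lin (cpsC R .cunit) (cpsC R (stoupType Δ))) := by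
        intro Γ Δ σ
        rw [← psubst_asLin]
        erw [asLin_cps_cunit]
        exact (HasTy.llam (.cimage .svar)).eeq
      exact .of_tests (.llam (.cimage .svar)) (.llam (.cimage .svar)) e e
        fun _ _ _ _ _ _ _ _ _ => trivial
  | cpair _ _ _ _ _ _ d₁ d₂ ih₁ ih₂ =>
    intro Γ' Δ' A' d' Γ₁ σ σ' he
    cases d' with
    | cpair _ _ _ _ _ _ e₁ e₂ =>
      rw [cps_cpair, cps_cpair, psubst_pairTm, psubst_pairTm]
      refine .pairTm (ih₁ e₁ he) (ih₂ e₂ he) ?_ ?_ ?_ ?_ <;> rw [← psubst_asLin]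
      · exact (d₁.judgTy R).hasTy_asLin.psubst he.isSub
      · exact (e₁.judgTy R).hasTy_asLin.psubst he.isSub'
      · exact (d₂.judgTy R).hasTy_asLin.psubst he.isSub
      · exact (e₂.judgTy R).hasTy_asLin.psubst he.isSub'
  | cfst _ _ _ _ _ d ih =>
    intro Γ' Δ' A' d' Γ₁ σ σ' he
    cases d' with
    | cfst _ _ _ _ _ e =>
      rw [cps_cfst, cps_cfst]
      exact .elimTm he (ih e he) (d.judgTy R) (e.judgTy R) (.cinl .svar) (.cinl .svar)
        fun _ _ _ _ _ _ _ hf => StoupRel.cinl hf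
  | csnd _ _ _ _ _ d ih =>
    intro Γ' Δ' A' d' Γ₁ σ σ' he
    cases d' with
    | csnd _ _ _ _ _ e =>
      rw [cps_csnd, cps_csnd]
      exact .elimTm he (ih e he) (d.judgTy R) (e.judgTy R) (.cinr .svar) (.cinr .svar)
        fun _ _ _ _ _ _ _ hf => StoupRel.cinr hf
  | clam _ _ _ _ _ d ih =>
    intro Γ' Δ' A' d' Γ₁ σ σ' he
    cases d' with
    | clam _ _ _ _ _ e =>
      rw [cps_clam, cps_clam, psubst_lamTm, psubst_lamTm]
      refine .lamTm (fun Γ₂ ρ hρ a a' ha => ?_) ?_ ?_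
      · rw [subst0_rename_psubst_liftS, subst0_rename_psubst_liftS]
        exact ih e ((he.rename hρ).scons ha)
      · rw [← psubst_asLin]
        exact (d.judgTy R).hasTy_asLin.psubst (he.isSub_liftS _)
      · rw [← psubst_asLin]
        exact (e.judgTy R).hasTy_asLin.psubst (he.isSub_liftS' _)
  | capp _ _ _ _ _ _ d₁ d₂ ih₁ ih₂ =>
    intro Γ' Δ' A' d' Γ₁ σ σ' he
    cases d' with
    | capp _ _ _ _ _ _ e₁ e₂ =>
      rw [cps_capp, cps_capp]
      have a := (d₂.judgTy R).hasTy
      have a' := (e₂.judgTy R).hasTy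
      refine .elimTm he (ih₁ e₁ he) (d₁.judgTy R) (e₁.judgTy R) (.copow a .svar)
        (.copow a' .svar) fun Γ₂ τ τ' hτ Z f f' hf => ?_
      have b := a.psubst hτ.isSub
      have b' := a'.psubst hτ.isSub'
      simp only [psubst, ssubst, b.stoupFree.ssubst_eq, b'.stoupFree.ssubst_eq]
      exact StoupRel.copow ⟨b, b', (ih₂ e₂ hτ).relV⟩ hf
  | top =>
    intro Γ' Δ' A' d' Γ₁ σ σ' he
    cases d' with
    | top => exact .val fun _ _ _ _ _ _ hf =>
        .lapp_cong (HasTy.llam .svar).eeq (StoupRel.eeq_of_iunit hf)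
  | ilet _ _ _ _ _ d₁ d₂ ih₁ ih₂ =>
    intro Γ' Δ' A' d' Γ₁ σ σ' he
    cases d' with
    | ilet _ _ _ _ _ e₁ e₂ =>
      rw [cps_ilet, cps_ilet]
      have a := (d₂.judgTy R).hasTy
      have a' := (e₂.judgTy R).hasTy
      refine .elimTm he (ih₁ e₁ he) (d₁.judgTy R) (e₁.judgTy R) (.lapp a .svar)
        (.lapp a' .svar) fun Γ₂ τ τ' hτ Z f f' hf => ?_
      simp only [psubst, ssubst, (a.psubst hτ.isSub).stoupFree.ssubst_eq,
        (a'.psubst hτ.isSub').stoupFree.ssubst_eq]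
      exact StoupRel.iunit_of_eeq ((ih₂ e₂ hτ).eeq_lapp hf)
  | bang _ _ _ d ih =>
    intro Γ' Δ' A' d' Γ₁ σ σ' he
    cases d' with
    | bang _ _ _ e =>
      refine .val fun Γ₂ ρ hρ X f f' hf => ?_
      have ha : ValRel R _ _ Γ₁ _ _ := ⟨(d.judgTy R).hasTy.psubst he.isSub,
        (e.judgTy R).hasTy.psubst he.isSub', (ih e he).relV⟩
      have hb := ha.rename hρ
      exact (eeq_lapp_llam_capp hb.1 hf.1).trans ((StoupRel.eeq_capp hf hb).trans
        (eeq_lapp_llam_capp hb.2.1 hf.2.1).symm)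
  | banglet _ _ _ _ _ _ d₁ d₂ ih₁ ih₂ =>
    intro Γ' Δ' A' d' Γ₁ σ σ' he
    cases d' with
    | banglet _ _ _ _ _ _ e₁ e₂ =>
      rw [cps_banglet, cps_banglet]
      have u := (d₂.judgTy R).hasTy
      have u' := (e₂.judgTy R).hasTy
      refine .elimTm he (ih₁ e₁ he) (d₁.judgTy R) (e₁.judgTy R) (.clam (.lapp u .svar))
        (.clam (.lapp u' .svar)) fun Γ₂ τ τ' hτ Z f f' hf => ?_
      have v := u.psubst (hτ.isSub_liftS _)
      have v' := u'.psubst (hτ.isSub_liftS' _)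
      simp only [psubst, ssubst, v.stoupFree.ssubst_eq, v'.stoupFree.ssubst_eq]
      refine stoupRel_clam_bang (.lapp v hf.1.shift) (.lapp v' hf.2.1.shift)
        fun Γ₃ ρ hρ a a' ha => ?_
      have key := (ih₂ e₂ ((hτ.rename hρ).scons ha)).eeq_lapp (lrel.rename hf hρ)
      rw [← subst0_rename_psubst_liftS, ← subst0_rename_psubst_liftS] at key
      rw [← subst0_rename_shift ρ a f, ← subst0_rename_shift ρ a' f'] at key
      exact key
  | copow _ _ _ _ _ _ d₁ d₂ ih₁ ih₂ =>
    intro Γ' Δ' A' d' Γ₁ σ σ' he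
    cases d' with
    | copow _ _ _ _ _ _ e₁ e₂ =>
      rw [cps_copow, cps_copow]
      have a := (d₁.judgTy R).hasTy
      have a' := (e₁.judgTy R).hasTy
      refine .elimTm he (ih₂ e₂ he) (d₂.judgTy R) (e₂.judgTy R) (.capp .svar a)
        (.capp .svar a') fun Γ₂ τ τ' hτ Z f f' hf => ?_
      have b := a.psubst hτ.isSub
      have b' := a'.psubst hτ.isSub'
      simp only [psubst, ssubst, b.stoupFree.ssubst_eq, b'.stoupFree.ssubst_eq]
      exact StoupRel.capp hf ⟨b, b', (ih₁ e₁ hτ).relV⟩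
  | copowlet _ _ _ _ _ _ _ d₁ d₂ ih₁ ih₂ =>
    intro Γ' Δ' A' d' Γ₁ σ σ' he
    cases d' with
    | copowlet _ _ _ _ _ _ _ e₁ e₂ =>
      rw [cps_copowlet, cps_copowlet]
      have u := (d₂.judgTy R).hasTy_some
      have u' := (e₂.judgTy R).hasTy_some
      refine .elimTm he (ih₁ e₁ he) (d₁.judgTy R) (e₁.judgTy R) (.clam u) (.clam u')
        fun Γ₂ τ τ' hτ Z f f' hf => ?_
      have v := u.psubst (hτ.isSub_liftS _)
      have v' := u'.psubst (hτ.isSub_liftS' _)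
      simp only [psubst, ssubst]
      refine stoupRel_clam_copow (v.ssubst hf.1.shift) (v'.ssubst hf.2.1.shift)
        fun Γ₃ ρ hρ a a' ha => ?_
      have hτ₃ := (hτ.rename hρ).scons ha
      have key := (ih₂ e₂ hτ₃).stoupRel_ssubst (u.psubst hτ₃.isSub) (u'.psubst hτ₃.isSub')
        (lrel.rename hf hρ)
      rw [← subst0_rename_psubst_liftS, ← subst0_rename_psubst_liftS] at key
      rwa [subst0_rename_ssubst_shift _ ha.1.stoupFree,
        subst0_rename_ssubst_shift _ ha.2.1.stoupFree]
  | cimage _ _ _ _ d ih =>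
    intro Γ' Δ' A' d' Γ₁ σ σ' he
    cases d' with
    | cimage _ _ _ _ e =>
      rw [cps_cimage, cps_cimage]
      exact .elimTm he (ih e he) (d.judgTy R) (e.judgTy R) .cunit .cunit
        fun _ _ _ _ _ _ _ _ => stoupRel_cunit
  | cinl _ _ _ _ _ d ih =>
    intro Γ' Δ' A' d' Γ₁ σ σ' he
    cases d' with
    | cinl _ _ _ _ _ e =>
      rw [cps_cinl, cps_cinl]
      exact .elimTm he (ih e he) (d.judgTy R) (e.judgTy R) (.cfst .svar) (.cfst .svar)
        fun _ _ _ _ _ _ _ hf => StoupRel.cfst hf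
  | cinr _ _ _ _ _ d ih =>
    intro Γ' Δ' A' d' Γ₁ σ σ' he
    cases d' with
    | cinr _ _ _ _ _ e =>
      rw [cps_cinr, cps_cinr]
      exact .elimTm he (ih e he) (d.judgTy R) (e.judgTy R) (.csnd .svar) (.csnd .svar)
        fun _ _ _ _ _ _ _ hf => StoupRel.csnd hf
  | ccase _ _ _ _ _ _ _ _ d d₁ d₂ ih ih₁ ih₂ =>
    intro Γ' Δ' A' d' Γ₁ σ σ' he
    cases d' with
    | ccase _ _ _ _ _ _ _ _ e e₁ e₂ =>
      rw [cps_ccase, cps_ccase]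
      have t₁ := (d₁.judgTy R).hasTy_some
      have t₂ := (d₂.judgTy R).hasTy_some
      have t₁' := (e₁.judgTy R).hasTy_some
      have t₂' := (e₂.judgTy R).hasTy_some
      exact .elimTm he (ih e he) (d.judgTy R) (e.judgTy R) (.cpair t₁ t₂) (.cpair t₁' t₂')
        fun _ _ _ hτ _ _ _ hf => StoupRel.cpair
          ((ih₁ e₁ hτ).stoupRel_ssubst (t₁.psubst hτ.isSub) (t₁'.psubst hτ.isSub') hf)
          ((ih₂ e₂ hτ).stoupRel_ssubst (t₂.psubst hτ.isSub) (t₂'.psubst hτ.isSub') hf)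
  | llam _ _ _ _ _ ih =>
    intro Γ' Δ' A' d' Γ₁ σ σ' he
    cases d' with
    | llam _ _ _ _ e => exact .val (ih e he).relV_asLin
  | lapp _ _ _ _ _ _ d₁ d₂ ih₁ ih₂ =>
    intro Γ' Δ' A' d' Γ₁ σ σ' he
    cases d' with
    | lapp _ _ _ _ _ _ e₁ e₂ =>
      rw [cps_lapp, cps_lapp]
      have a := (d₁.judgTy R).hasTy
      have a' := (e₁.judgTy R).hasTy
      refine .elimTm he (ih₂ e₂ he) (d₂.judgTy R) (e₂.judgTy R) (.lapp a .svar)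
        (.lapp a' .svar) fun Γ₂ τ τ' hτ Z f f' hf => ?_
      simp only [psubst, ssubst, (a.psubst hτ.isSub).stoupFree.ssubst_eq,
        (a'.psubst hτ.isSub').stoupFree.ssubst_eq]
      have key := (ih₁ e₁ hτ).relV _ _ (isRen_id Γ₂) _ _ _ hf
      rwa [rename_id, rename_id] at key

/-- The translation of a value judgement does not depend on its derivation. -/
theorem Deriv.eeq_cps (R : CType) {Γ : List VType} {t : Tm} {A : VType}
    (d d' : Deriv Γ none t A) :
    EEq (cpsCtx R Γ) none (cps R d) (cps R d') (cpsV R A) := by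
  have hs := isSub_var (cpsCtx R Γ)
  have he : EnvRel R Γ Γ (cpsCtx R Γ) Tm.var Tm.var :=
    ⟨stoupFree_var, stoupFree_var, hs, hs, fun n A A' hn hn' => by
      obtain rfl : A = A' := by simpa [hn] using hn'
      have h := hs n (cpsV R A) (by rw [cpsCtx_getElem?, hn]; rfl)
      exact (relV_iff_eeq R A h h).2 h.eeq⟩
  have key := (d.judgRel R d' he).relV
  rw [psubst_var, psubst_var] at key
  exact (relV_iff_eeq R A (d.judgTy R).hasTy (d'.judgTy R).hasTy).1 key

end SubstitutionProperty

/-- **Substitution property of the self-translation, value into value**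
(Proposition 5.1(1)): if `Γ, x:A ⊢ t : B` and `Γ ⊢ u : A`, then
`Γᶜ ⊢ (t[u/x])ᶜ = tᶜ[uᶜ/x] : Bᶜ` in the equational theory of EEC. -/
theorem cps_subst_value_value (R : CType) (Γ : List VType) (t u : Tm) (A B : VType)
    (dt : Deriv (A :: Γ) none t B) (du : Deriv Γ none u A)
    (dtu : Deriv Γ none (Tm.subst0 u t) B) :
    EEq (cpsCtx R Γ) none (cps R dtu) (Tm.subst0 (cps R du) (cps R dt)) (cpsV R B) := by
  have h : ∀ n C, (A :: Γ)[n]? = some C →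
      ∃ e : Deriv Γ none (Tm.scons u Tm.var n) C, cps R e = Tm.scons (cps R du) Tm.var n := by
    intro n C hn
    cases n with
    | zero =>
      obtain rfl : A = C := Option.some.inj hn
      exact ⟨du, rfl⟩
    | succ n => exact ⟨.var Γ n C hn, rfl⟩
  have hd := dt.exists_psubst R
    (Tm.stoupFree_scons (du.judgTy R).hasTy.stoupFree Tm.stoupFree_var) h
  rw [← Tm.subst0_eq_psubst, ← Tm.subst0_eq_psubst] at hd
  obtain ⟨d, hd⟩ := hd
  rw [← hd]
  exact dtu.eeq_cps R d

end EEC
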